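/- arXiv:1709.00969 — 3 statements merged into one kernel-verified Lean document; each statement's English description precedes it below -/
import Mathlib

section
/- Let a ≥ 0, b > 0, σ > 0, and let ν be a measure on (0,∞) with ∫_0^∞ (z∧1) ν(dz) < ∞. Fix x ≥ 0, t > 0 and κ > 0, and let μ be a probability measure on [0,∞) whose Laplace transform satisfies, for every real u ≤ 0, ∫ e^{uy} μ(dy) = (1 − (σ²u/(2b))(1 − e^{−bt}))^{−2a/σ²} · exp(x ψ(t,u)) · exp(∫_0^t ∫_0^∞ (e^{zψ(s,u)} − 1) ν(dz) ds). Then ∫ y^κ μ(dy) < ∞ if and only if ∫_{(1,∞)} z^κ ν(dz) < ∞. (μ is the law at time t of the jump-diffusion CIR process started at x, i.e. of the solution of dX_t = (a − bX_t)dt + σ√(X_t) dB_t + dJ_t with J a pure-jump subordinator with Lévy measure ν.) -/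
open MeasureTheory Filter Set
open scoped ENNReal

/-- `ψ(t,u) = u e^{−bt} / (1 − (σ²u/(2b))(1 − e^{−bt}))`. -/
noncomputable def psi (b σ t u : ℝ) : ℝ :=
  u * Real.exp (-b * t) / (1 - σ ^ 2 * u / (2 * b) * (1 - Real.exp (-b * t)))

noncomputable def sepFun : BoundedContinuousFunction ℝ ℝ :=
  BoundedContinuousFunction.ofNormedAddCommGroup
    (fun y => Real.exp (-(max y 0)) + (1 - Real.exp (min y 0))) (by fun_prop) 2 (by
      intro y
      have h1 : Real.exp (-(max y 0)) ≤ 1 := Real.exp_le_one_iff.2 (by simp)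
      have h2 : Real.exp (min y 0) ≤ 1 := Real.exp_le_one_iff.2 (by simp)
      have h3 := Real.exp_pos (-(max y 0))
      have h4 := Real.exp_pos (min y 0)
      rw [Real.norm_eq_abs, abs_le]
      constructor <;> linarith)

lemma sepFun_apply (y : ℝ) :
    sepFun y = Real.exp (-(max y 0)) + (1 - Real.exp (min y 0)) := rfl

lemma sepFun_of_nonneg {y : ℝ} (hy : 0 ≤ y) : sepFun y = Real.exp (-y) := by
  rw [sepFun_apply, max_eq_left hy, min_eq_right hy]; simp

lemma sepFun_anti : StrictAnti (fun y => sepFun y) := by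
  intro x y hxy
  simp only [sepFun_apply]
  rcases le_or_gt 0 x with h | h
  · rw [max_eq_left h, min_eq_right h, max_eq_left (h.trans hxy.le), min_eq_right (h.trans hxy.le)]
    have := Real.exp_lt_exp.2 (neg_lt_neg hxy)
    linarith
  · have h1 : Real.exp (-(max y 0)) ≤ Real.exp (-(max x 0)) := by
      apply Real.exp_le_exp.2
      exact neg_le_neg (max_le_max hxy.le le_rfl)
    have h2 : Real.exp (min x 0) < Real.exp (min y 0) := by
      apply Real.exp_lt_exp.2
      rw [min_eq_left h.le]
      exact lt_min hxy h
    linarith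

lemma laplace_unique (P Q : Measure ℝ) [IsFiniteMeasure P] [IsFiniteMeasure Q]
    (hP : P (Iio 0) = 0) (hQ : Q (Iio 0) = 0)
    (h : ∀ n : ℕ, ∫⁻ y, ENNReal.ofReal (Real.exp (-(n * y))) ∂P
      = ∫⁻ y, ENNReal.ofReal (Real.exp (-(n * y))) ∂Q) : P = Q := by
  have key : ∀ (ρ : Measure ℝ) [IsFiniteMeasure ρ], ρ (Iio 0) = 0 → ∀ n : ℕ,
      ∫ y, (sepFun y) ^ n ∂ρ = (∫⁻ y, ENNReal.ofReal (Real.exp (-(n * y))) ∂ρ).toReal := by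
    intro ρ _ hρ n
    rw [← integral_eq_lintegral_of_nonneg_ae (ae_of_all _ fun y => (Real.exp_pos _).le)
      (by fun_prop)]
    apply integral_congr_ae
    have : ∀ᵐ y ∂ρ, y ∉ Iio 0 := measure_eq_zero_iff_ae_notMem.1 hρ
    filter_upwards [this] with y hy
    rw [sepFun_of_nonneg (by simpa using hy), ← Real.exp_nat_mul]
    congr 1; ring
  let A : StarSubalgebra ℝ (BoundedContinuousFunction ℝ ℝ) :=
    { (Polynomial.aeval (R := ℝ) sepFun).range with
      star_mem' := by
        intro a ha
        have : star a = a := by ext x; simp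
        rw [this]; exact ha }
  have hA : ∀ g, g ∈ A ↔ ∃ p : Polynomial ℝ, Polynomial.aeval sepFun p = g := fun g => Iff.rfl
  refine ext_of_forall_mem_subalgebra_integral_eq_of_pseudoEMetric_complete_countable
    (𝕜 := ℝ) (A := A) ?_ ?_
  · intro x y hxy
    refine ⟨sepFun, ⟨BoundedContinuousFunction.toContinuousMapStarₐ ℝ sepFun, ?_, rfl⟩,
      fun h => hxy (sepFun_anti.injective h)⟩
    exact ⟨sepFun, ⟨Polynomial.X, by simp⟩, rfl⟩
  · intro g hg
    obtain ⟨p, rfl⟩ := (hA g).1 hg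
    induction p using Polynomial.induction_on' with
    | add p q hp hq =>
      have hp' := hp ⟨p, rfl⟩
      have hq' := hq ⟨q, rfl⟩
      simp only [map_add, BoundedContinuousFunction.coe_add, Pi.add_apply]
      rw [integral_add (BoundedContinuousFunction.integrable _ _)
        (BoundedContinuousFunction.integrable _ _), integral_add
        (BoundedContinuousFunction.integrable _ _) (BoundedContinuousFunction.integrable _ _),
        hp', hq']
    | monomial n a =>
      have : ∀ x, (Polynomial.aeval sepFun (Polynomial.monomial n a)) x = a * (sepFun x) ^ n := by
        intro x
        simp [Polynomial.aeval_monomial]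
      simp only [this]
      rw [integral_const_mul, integral_const_mul, key P hP, key Q hQ, h]

lemma gam (k : ℕ) {β : ℝ} (hβ : 0 < β) :
    ∫⁻ y in Ioi (0:ℝ), ENNReal.ofReal (y ^ k * Real.exp (-(β * y)))
      = ENNReal.ofReal (k.factorial / β ^ (k + 1)) := by
  have h := Real.integral_rpow_mul_exp_neg_mul_Ioi (a := (k:ℝ) + 1) (by positivity) hβ
  have e : ∀ y : ℝ, y ^ ((k:ℝ) + 1 - 1) = y ^ k := by
    intro y; rw [add_sub_cancel_right, Real.rpow_natCast]
  simp only [e] at h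
  rw [Real.Gamma_nat_eq_factorial] at h
  have h2 : (1 / β) ^ ((k:ℝ) + 1) * (k.factorial : ℝ) = k.factorial / β ^ (k + 1) := by
    rw [← Nat.cast_succ, Real.rpow_natCast, one_div, inv_pow]
    field_simp
  rw [h2] at h
  have hint : Integrable (fun y : ℝ => y ^ k * Real.exp (-(β * y))) (volume.restrict (Ioi 0)) := by
    by_contra hc
    rw [integral_undef hc] at h
    have : (0:ℝ) < k.factorial / β ^ (k + 1) := by positivity
    linarith
  rw [← h, ofReal_integral_eq_lintegral_ofReal hint]
  filter_upwards [ae_restrict_mem measurableSet_Ioi] with y hy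
  have : (0:ℝ) < y := hy
  positivity

noncomputable def wd (m r y : ℝ) : ℝ≥0∞ :=
  ∑' k : ℕ, ENNReal.ofReal (Real.exp (-m) * (m * r) ^ (k + 1) / ((k + 1).factorial * k.factorial))
    * ENNReal.ofReal (y ^ k * Real.exp (-(r * y)))

lemma measurable_wd {α : Type*} [MeasurableSpace α] {f g h : α → ℝ} (hf : Measurable f)
    (hg : Measurable g) (hh : Measurable h) : Measurable fun x => wd (f x) (g x) (h x) := by
  unfold wd
  refine Measurable.tsum fun k => ?_
  fun_prop

lemma exp_hasSum (x : ℝ) : HasSum (fun n : ℕ => x ^ n / n.factorial) (Real.exp x) := by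
  rw [Real.exp_eq_exp_ℝ]; exact NormedSpace.expSeries_div_hasSum_exp x

lemma wd_F1 {m r u : ℝ} (hm : 0 ≤ m) (hr : 0 < r) (hu : 0 < r + u) :
    ∫⁻ y in Ioi (0:ℝ), ENNReal.ofReal (Real.exp (-(u * y))) * wd m r y
      = ENNReal.ofReal (Real.exp (-m) * (Real.exp (m * r / (r + u)) - 1)) := by
  have h1 : ∀ y : ℝ, 0 < y → ENNReal.ofReal (Real.exp (-(u * y))) * wd m r y =
      ∑' k : ℕ, ENNReal.ofReal (Real.exp (-m) * (m * r) ^ (k + 1) /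
        ((k + 1).factorial * k.factorial))
        * ENNReal.ofReal (y ^ k * Real.exp (-((r + u) * y))) := by
    intro y hy
    rw [wd, ← ENNReal.tsum_mul_left]
    congr 1; ext k
    rw [mul_left_comm, ← ENNReal.ofReal_mul (by positivity)]
    congr 2
    rw [mul_left_comm, ← Real.exp_add]
    congr 2; ring
  rw [setLIntegral_congr_fun measurableSet_Ioi (fun y hy => h1 y hy),
    lintegral_tsum (fun k => by fun_prop)]
  have h2 : HasSum (fun k : ℕ => Real.exp (-m) * (m * r) ^ (k + 1) /
        ((k + 1).factorial * k.factorial) * (k.factorial / (r + u) ^ (k + 1)))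
        (Real.exp (-m) * (Real.exp (m * r / (r + u)) - 1)) := by
    have h := (hasSum_nat_add_iff' 1).2 (exp_hasSum (m * r / (r + u)))
    simp only [Finset.sum_range_one, pow_zero, Nat.factorial_zero, Nat.cast_one, div_one] at h
    refine (h.mul_left (Real.exp (-m))).congr_fun ?_ 
    intro k
    rw [div_pow]
    field_simp
  rw [← h2.tsum_eq, ENNReal.ofReal_tsum_of_nonneg (fun k => by positivity) h2.summable]
  congr 1; ext k
  rw [lintegral_const_mul _ (by fun_prop), gam k hu, ← ENNReal.ofReal_mul (by positivity)]

lemma wd_F2 {m r u : ℝ} (hm : 0 ≤ m) (hr : 0 < r) (hu : 0 < r + u) :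
    ∫⁻ y in Ioi (0:ℝ), ENNReal.ofReal (y * Real.exp (-(u * y))) * wd m r y
      = ENNReal.ofReal (m * r / (r + u) ^ 2 * Real.exp (-(m * u / (r + u)))) := by
  have h1 : ∀ y : ℝ, 0 < y → ENNReal.ofReal (y * Real.exp (-(u * y))) * wd m r y =
      ∑' k : ℕ, ENNReal.ofReal (Real.exp (-m) * (m * r) ^ (k + 1) /
        ((k + 1).factorial * k.factorial))
        * ENNReal.ofReal (y ^ (k + 1) * Real.exp (-((r + u) * y))) := by
    intro y hy
    rw [wd, ← ENNReal.tsum_mul_left]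
    congr 1; ext k
    rw [mul_left_comm, ← ENNReal.ofReal_mul (by positivity)]
    congr 2
    have : Real.exp (-((r + u) * y)) = Real.exp (-(u * y)) * Real.exp (-(r * y)) := by
      rw [← Real.exp_add]; congr 1; ring
    rw [this]; ring
  rw [setLIntegral_congr_fun measurableSet_Ioi (fun y hy => h1 y hy),
    lintegral_tsum (fun k => by fun_prop)]
  have h2 : HasSum (fun k : ℕ => Real.exp (-m) * (m * r) ^ (k + 1) /
        ((k + 1).factorial * k.factorial) * ((k + 1).factorial / (r + u) ^ (k + 1 + 1)))
        (m * r / (r + u) ^ 2 * Real.exp (-(m * u / (r + u)))) := by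
    have h := exp_hasSum (m * r / (r + u))
    have e : m * r / (r + u) ^ 2 * Real.exp (-(m * u / (r + u))) =
        Real.exp (-m) * (m * r) / (r + u) ^ 2 * Real.exp (m * r / (r + u)) := by
      have : Real.exp (-(m * u / (r + u))) = Real.exp (-m) * Real.exp (m * r / (r + u)) := by
        rw [← Real.exp_add]; congr 1; field_simp; ring
      rw [this]; ring
    rw [e]
    refine (h.mul_left (Real.exp (-m) * (m * r) / (r + u) ^ 2)).congr_fun ?_ 
    intro k
    rw [div_pow]
    field_simp
    try ring
  rw [← h2.tsum_eq, ENNReal.ofReal_tsum_of_nonneg (fun k => by positivity) h2.summable]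
  congr 1; ext k
  rw [lintegral_const_mul _ (by fun_prop), gam (k + 1) hu, ← ENNReal.ofReal_mul (by positivity)]

lemma conv_identity (μ η : Measure ℝ) [IsProbabilityMeasure μ] [SFinite η]
    (hμ : μ (Iio 0) = 0) (hη : η (Iio 0) = 0)
    (hL : ∀ u : ℝ, 0 < u → ∫⁻ y, ENNReal.ofReal (y * Real.exp (-(u * y))) ∂μ =
      (∫⁻ y, ENNReal.ofReal (Real.exp (-(u * y))) ∂μ) *
        ∫⁻ y, ENNReal.ofReal (Real.exp (-(u * y))) ∂η)
    (g : ℝ → ℝ≥0∞) (hg : Measurable g) :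
    ∫⁻ y, g y * ENNReal.ofReal y ∂μ = ∫⁻ y₁, ∫⁻ y₂, g (y₁ + y₂) ∂η ∂μ := by
  have hadd : Measurable (fun p : ℝ × ℝ => p.1 + p.2) := by fun_prop
  have hP : ∀ f : ℝ → ℝ≥0∞, Measurable f →
      ∫⁻ y, f y ∂(μ.withDensity (fun y => ENNReal.ofReal (y * Real.exp (-y)))) =
      ∫⁻ y, ENNReal.ofReal (y * Real.exp (-y)) * f y ∂μ := by
    intro f hf
    rw [lintegral_withDensity_eq_lintegral_mul _ (by fun_prop) hf]; rfl
  have hQ : ∀ f : ℝ → ℝ≥0∞, Measurable f →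
      ∫⁻ y, f y ∂(((μ.prod η).map (fun p : ℝ × ℝ => p.1 + p.2)).withDensity
        (fun y => ENNReal.ofReal (Real.exp (-y)))) =
      ∫⁻ y₁, ∫⁻ y₂, ENNReal.ofReal (Real.exp (-(y₁ + y₂))) * f (y₁ + y₂) ∂η ∂μ := by
    intro f hf
    rw [lintegral_withDensity_eq_lintegral_mul _ (by fun_prop) hf,
      lintegral_map (by fun_prop) hadd, lintegral_prod _ (by fun_prop)]
    rfl
  have hQexp : ∀ u : ℝ, ∫⁻ y₁, ∫⁻ y₂, ENNReal.ofReal (Real.exp (-(u * (y₁ + y₂)))) ∂η ∂μ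
      = (∫⁻ y, ENNReal.ofReal (Real.exp (-(u * y))) ∂μ) *
        ∫⁻ y, ENNReal.ofReal (Real.exp (-(u * y))) ∂η := by
    intro u
    rw [← lintegral_mul_const _ (by fun_prop)]
    congr 1; ext y₁
    rw [← lintegral_const_mul _ (by fun_prop)]
    congr 1; ext y₂
    rw [← ENNReal.ofReal_mul (by positivity), ← Real.exp_add]
    congr 2; ring
  have hEq : ∀ n : ℕ,
      ∫⁻ y, ENNReal.ofReal (Real.exp (-(n * y)))
        ∂(μ.withDensity (fun y => ENNReal.ofReal (y * Real.exp (-y)))) =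
      ∫⁻ y, ENNReal.ofReal (Real.exp (-(n * y)))
        ∂(((μ.prod η).map (fun p : ℝ × ℝ => p.1 + p.2)).withDensity
        (fun y => ENNReal.ofReal (Real.exp (-y)))) := by
    intro n
    rw [hP _ (by fun_prop), hQ _ (by fun_prop)]
    have h := hL (n + 1) (by positivity)
    rw [← hQexp] at h
    have e1 : ∀ y : ℝ, ENNReal.ofReal (y * Real.exp (-y)) * ENNReal.ofReal (Real.exp (-(n * y)))
        = ENNReal.ofReal (y * Real.exp (-(((n:ℝ) + 1) * y))) := by
      intro y
      rw [← ENNReal.ofReal_mul' (by positivity), mul_assoc, ← Real.exp_add]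
      congr 3; ring
    have e2 : ∀ y : ℝ, ENNReal.ofReal (Real.exp (-y)) * ENNReal.ofReal (Real.exp (-(n * y)))
        = ENNReal.ofReal (Real.exp (-(((n:ℝ) + 1) * y))) := by
      intro y
      rw [← ENNReal.ofReal_mul' (by positivity), ← Real.exp_add]
      congr 2; ring
    simp only [e1, e2]
    exact h
  have hPfin : IsFiniteMeasure (μ.withDensity (fun y => ENNReal.ofReal (y * Real.exp (-y)))) := by
    constructor
    rw [withDensity_apply _ MeasurableSet.univ, Measure.restrict_univ]
    calc ∫⁻ y, ENNReal.ofReal (y * Real.exp (-y)) ∂μ ≤ ∫⁻ y, 1 ∂μ := by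
          apply lintegral_mono
          intro y
          apply ENNReal.ofReal_le_one.2
          have := Real.add_one_le_exp y
          rw [Real.exp_neg, ← div_eq_mul_inv, div_le_one (Real.exp_pos _)]
          linarith
      _ < ⊤ := by simp
  have hQfin : IsFiniteMeasure (((μ.prod η).map (fun p : ℝ × ℝ => p.1 + p.2)).withDensity
        (fun y => ENNReal.ofReal (Real.exp (-y)))) := by
    constructor
    have h0 := hEq 0
    simp only [Nat.cast_zero, zero_mul, neg_zero, Real.exp_zero, ENNReal.ofReal_one,
      lintegral_one] at h0
    rw [← h0]
    exact measure_lt_top _ _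
  have hmain : μ.withDensity (fun y => ENNReal.ofReal (y * Real.exp (-y))) =
      (((μ.prod η).map (fun p : ℝ × ℝ => p.1 + p.2)).withDensity
        (fun y => ENNReal.ofReal (Real.exp (-y)))) := by
    refine laplace_unique _ _ ?_ ?_ hEq
    · exact withDensity_absolutelyContinuous _ _ hμ
    · refine withDensity_absolutelyContinuous _ _ ?_
      rw [Measure.map_apply hadd measurableSet_Iio]
      have : (fun p : ℝ × ℝ => p.1 + p.2) ⁻¹' Iio 0 ⊆ (Iio 0 ×ˢ univ) ∪ (univ ×ˢ Iio 0) := by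
        rintro ⟨p, q⟩ hpq
        simp only [mem_preimage, mem_Iio, mem_union, mem_prod, mem_univ, and_true, true_and] at *
        by_contra! hc
        linarith
      refine measure_mono_null this (measure_union_null ?_ ?_)
      · rw [Measure.prod_prod, hμ, zero_mul]
      · rw [Measure.prod_prod, hη, mul_zero]
  have hfin := hP (fun y => g y * ENNReal.ofReal (Real.exp y)) (by fun_prop)
  rw [hmain, hQ _ (by fun_prop)] at hfin
  have e1 : ∀ y : ℝ, ENNReal.ofReal (Real.exp (-y)) * (g y * ENNReal.ofReal (Real.exp y)) = g y := by
    intro y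
    rw [mul_left_comm, ← ENNReal.ofReal_mul (by positivity), ← Real.exp_add]
    simp
  have e2 : ∀ y : ℝ, ENNReal.ofReal (y * Real.exp (-y)) * (g y * ENNReal.ofReal (Real.exp y))
      = g y * ENNReal.ofReal y := by
    intro y
    rw [mul_left_comm, ← ENNReal.ofReal_mul' (by positivity), mul_assoc, ← Real.exp_add]
    simp
  simp only [e1, e2] at hfin
  exact hfin.symm

lemma rec_aux (μ η : Measure ℝ) [IsProbabilityMeasure μ] [SFinite η]
    (hμ : μ (Iio 0) = 0) (hη : η (Iio 0) = 0)
    (hC : ∀ g : ℝ → ℝ≥0∞, Measurable g →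
      ∫⁻ y, g y * ENNReal.ofReal y ∂μ = ∫⁻ y₁, ∫⁻ y₂, g (y₁ + y₂) ∂η ∂μ) (n : ℕ) :
    ∀ κ : ℝ, 0 < κ → κ ≤ n → ∫⁻ y, ENNReal.ofReal ((1 + y) ^ (κ - 1)) ∂η < ⊤ →
      ∫⁻ y, ENNReal.ofReal ((1 + y) ^ κ) ∂μ < ⊤ := by
  have hμ' : ∀ᵐ y ∂μ, 0 ≤ y := by
    filter_upwards [measure_eq_zero_iff_ae_notMem.1 hμ] with y hy; simpa using hy
  have hη' : ∀ᵐ y ∂η, 0 ≤ y := by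
    filter_upwards [measure_eq_zero_iff_ae_notMem.1 hη] with y hy; simpa using hy
  have split : ∀ κ : ℝ, ∫⁻ y, ENNReal.ofReal ((1 + y) ^ κ) ∂μ =
      ∫⁻ y, ENNReal.ofReal ((1 + y) ^ (κ - 1)) ∂μ +
      ∫⁻ y, ENNReal.ofReal ((1 + y) ^ (κ - 1)) * ENNReal.ofReal y ∂μ := by
    intro κ
    rw [← lintegral_add_left (by fun_prop)]
    apply lintegral_congr_ae
    filter_upwards [hμ'] with y hy
    rw [← ENNReal.ofReal_mul (by positivity), ← ENNReal.ofReal_add (by positivity) (by positivity)]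
    congr 1
    rw [Real.rpow_sub_one (by positivity)]
    field_simp
  induction n with
  | zero => intro κ h1 h2; norm_num at h2; linarith
  | succ n ih =>
    intro κ h1 h2 hJ
    rw [split, hC _ (by fun_prop)]
    rcases le_or_gt κ 1 with hk | hk
    · refine ENNReal.add_lt_top.2 ⟨?_, ?_⟩
      · calc ∫⁻ y, ENNReal.ofReal ((1 + y) ^ (κ - 1)) ∂μ ≤ ∫⁻ y, 1 ∂μ := by
              apply lintegral_mono_ae
              filter_upwards [hμ'] with y hy
              apply ENNReal.ofReal_le_one.2
              exact Real.rpow_le_one_of_one_le_of_nonpos (by linarith) (by linarith)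
          _ < ⊤ := by simp
      · calc ∫⁻ y₁, ∫⁻ y₂, ENNReal.ofReal ((1 + (y₁ + y₂)) ^ (κ - 1)) ∂η ∂μ
            ≤ ∫⁻ y₁, ∫⁻ y₂, ENNReal.ofReal ((1 + y₂) ^ (κ - 1)) ∂η ∂μ := by
              apply lintegral_mono_ae
              filter_upwards [hμ'] with y₁ hy₁
              apply lintegral_mono_ae
              filter_upwards [hη'] with y₂ hy₂
              apply ENNReal.ofReal_le_ofReal
              exact Real.rpow_le_rpow_of_nonpos (by linarith) (by linarith) (by linarith)
          _ < ⊤ := by simpa using hJ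
    · have h3 : ∫⁻ y, ENNReal.ofReal ((1 + y) ^ (κ - 1)) ∂μ < ⊤ := by
        apply ih _ (by linarith) (by push_cast at h2; linarith)
        refine lt_of_le_of_lt (lintegral_mono_ae ?_) hJ
        filter_upwards [hη'] with y hy
        apply ENNReal.ofReal_le_ofReal
        exact Real.rpow_le_rpow_of_exponent_le (by linarith) (by linarith)
      refine ENNReal.add_lt_top.2 ⟨h3, ?_⟩
      calc ∫⁻ y₁, ∫⁻ y₂, ENNReal.ofReal ((1 + (y₁ + y₂)) ^ (κ - 1)) ∂η ∂μ
            ≤ ∫⁻ y₁, ∫⁻ y₂, ENNReal.ofReal ((1 + y₁) ^ (κ - 1)) *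
                ENNReal.ofReal ((1 + y₂) ^ (κ - 1)) ∂η ∂μ := by
              apply lintegral_mono_ae
              filter_upwards [hμ'] with y₁ hy₁
              apply lintegral_mono_ae
              filter_upwards [hη'] with y₂ hy₂
              rw [← ENNReal.ofReal_mul (by positivity), ← Real.mul_rpow (by positivity)
                (by positivity)]
              apply ENNReal.ofReal_le_ofReal
              exact Real.rpow_le_rpow (by positivity) (by nlinarith) (by linarith)
          _ = (∫⁻ y, ENNReal.ofReal ((1 + y) ^ (κ - 1)) ∂μ) *
              ∫⁻ y, ENNReal.ofReal ((1 + y) ^ (κ - 1)) ∂η := by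
              rw [← lintegral_mul_const _ (by fun_prop)]
              congr 1; ext y₁
              rw [← lintegral_const_mul _ (by fun_prop)]
          _ < ⊤ := ENNReal.mul_lt_top h3 hJ

lemma moment_iff_eta (μ η : Measure ℝ) [IsProbabilityMeasure μ] [SFinite η]
    (hμ : μ (Iio 0) = 0) (hη : η (Iio 0) = 0)
    (hC : ∀ g : ℝ → ℝ≥0∞, Measurable g →
      ∫⁻ y, g y * ENNReal.ofReal y ∂μ = ∫⁻ y₁, ∫⁻ y₂, g (y₁ + y₂) ∂η ∂μ)
    {κ : ℝ} (hκ : 0 < κ) :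
    (∫⁻ y, ENNReal.ofReal (y ^ κ) ∂μ < ⊤) ↔
      ∫⁻ y, ENNReal.ofReal ((1 + y) ^ (κ - 1)) ∂η < ⊤ := by
  have hμ' : ∀ᵐ y ∂μ, 0 ≤ y := by
    filter_upwards [measure_eq_zero_iff_ae_notMem.1 hμ] with y hy; simpa using hy
  have hη' : ∀ᵐ y ∂η, 0 ≤ y := by
    filter_upwards [measure_eq_zero_iff_ae_notMem.1 hη] with y hy; simpa using hy
  constructor
  · intro h
    have h1 : ∫⁻ y, ENNReal.ofReal ((1 + y) ^ (κ - 1)) * ENNReal.ofReal y ∂μ < ⊤ := by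
      calc ∫⁻ y, ENNReal.ofReal ((1 + y) ^ (κ - 1)) * ENNReal.ofReal y ∂μ
          ≤ ∫⁻ y, ENNReal.ofReal (2 ^ κ) * (1 + ENNReal.ofReal (y ^ κ)) ∂μ := by
            apply lintegral_mono_ae
            filter_upwards [hμ'] with y hy
            rw [← ENNReal.ofReal_one, ← ENNReal.ofReal_add (by positivity) (by positivity),
              ← ENNReal.ofReal_mul (by positivity), ← ENNReal.ofReal_mul (by positivity)]
            apply ENNReal.ofReal_le_ofReal
            have a1 : (1 + y) ^ (κ - 1) * y ≤ (1 + y) ^ κ := by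
              rw [Real.rpow_sub_one (by positivity), div_mul_eq_mul_div,
                div_le_iff₀ (by positivity)]
              have : 0 ≤ (1 + y) ^ κ := by positivity
              nlinarith
            refine a1.trans ?_
            rcases le_or_gt y 1 with h1 | h1
            · have a2 : (1 + y) ^ κ ≤ 2 ^ κ :=
                Real.rpow_le_rpow (by positivity) (by linarith) hκ.le
              have a3 : 0 ≤ y ^ κ := by positivity
              have a4 : (0:ℝ) ≤ 2 ^ κ := by positivity
              nlinarith
            · have a2 : (1 + y) ^ κ ≤ (2 * y) ^ κ :=
                Real.rpow_le_rpow (by positivity) (by linarith) hκ.le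
              rw [Real.mul_rpow (by positivity) (by positivity)] at a2
              have a4 : (0:ℝ) ≤ 2 ^ κ := by positivity
              linarith
        _ < ⊤ := by
            rw [lintegral_const_mul _ (by fun_prop), lintegral_add_left (by fun_prop)]
            refine ENNReal.mul_lt_top ENNReal.ofReal_lt_top (ENNReal.add_lt_top.2 ⟨by simp, h⟩)
    rw [hC _ (by fun_prop)] at h1
    rcases le_or_gt 1 κ with hk | hk
    · refine lt_of_le_of_lt ?_ h1
      calc ∫⁻ y, ENNReal.ofReal ((1 + y) ^ (κ - 1)) ∂η
          = ∫⁻ _, ∫⁻ y, ENNReal.ofReal ((1 + y) ^ (κ - 1)) ∂η ∂μ := by simp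
        _ ≤ _ := by
          apply lintegral_mono_ae
          filter_upwards [hμ'] with y₁ hy₁
          apply lintegral_mono_ae
          filter_upwards [hη'] with y₂ hy₂
          apply ENNReal.ofReal_le_ofReal
          exact Real.rpow_le_rpow (by linarith) (by linarith) (by linarith)
    · have h2 : (∫⁻ y, ENNReal.ofReal ((1 + y) ^ (κ - 1)) ∂μ) *
              ∫⁻ y, ENNReal.ofReal ((1 + y) ^ (κ - 1)) ∂η < ⊤ := by
        refine lt_of_le_of_lt ?_ h1
        rw [← lintegral_mul_const _ (by fun_prop)]
        apply lintegral_mono_ae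
        filter_upwards [hμ'] with y₁ hy₁
        rw [← lintegral_const_mul _ (by fun_prop)]
        apply lintegral_mono_ae
        filter_upwards [hη'] with y₂ hy₂
        rw [← ENNReal.ofReal_mul (by positivity), ← Real.mul_rpow (by positivity)
          (by positivity)]
        apply ENNReal.ofReal_le_ofReal
        exact Real.rpow_le_rpow_of_nonpos (by positivity) (by nlinarith) (by linarith)
      refine lt_top_iff_ne_top.2 fun htop => ?_
      rw [htop, ENNReal.mul_top] at h2
      · exact lt_irrefl _ h2
      · intro h0
        rw [lintegral_eq_zero_iff (by fun_prop)] at h0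
        have : ∀ᵐ y ∂μ, False := by
          filter_upwards [h0, hμ'] with y hy hy'
          simp only [Pi.zero_apply, ENNReal.ofReal_eq_zero] at hy
          have : 0 < (1 + y) ^ (κ - 1) := by positivity
          linarith
        simp at this
        exact IsProbabilityMeasure.ne_zero μ this
  · intro h
    obtain ⟨n, hn⟩ := exists_nat_ge κ
    refine lt_of_le_of_lt (lintegral_mono_ae ?_) (rec_aux μ η hμ hη hC n κ hκ hn h)
    filter_upwards [hμ'] with y hy
    apply ENNReal.ofReal_le_ofReal
    exact Real.rpow_le_rpow hy (by linarith) hκ.le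

lemma wd_G1 {z ε c u : ℝ} (hz : 0 ≤ z) (hε : 0 < ε) (hc : 0 < c) (hu : 0 < 1 + c * u) :
    ∫⁻ y in Ioi (0:ℝ), ENNReal.ofReal (Real.exp (-(u * y))) * wd (z * ε / c) (1 / c) y
      = ENNReal.ofReal (Real.exp (-(z * ε * u / (1 + c * u))) - Real.exp (-(z * ε / c))) := by
  have e : 1 / c + u = (1 + c * u) / c := by field_simp
  rw [wd_F1 (by positivity) (by positivity) (by rw [e]; positivity)]
  congr 1
  rw [mul_sub, ← Real.exp_add, mul_one]
  congr 2
  rw [e]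
  field_simp
  ring

lemma wd_G2 {z ε c u : ℝ} (hz : 0 ≤ z) (hε : 0 < ε) (hc : 0 < c) (hu : 0 < 1 + c * u) :
    ∫⁻ y in Ioi (0:ℝ), ENNReal.ofReal (y * Real.exp (-(u * y))) * wd (z * ε / c) (1 / c) y
      = ENNReal.ofReal (z * ε / (1 + c * u) ^ 2 * Real.exp (-(z * ε * u / (1 + c * u)))) := by
  have e : 1 / c + u = (1 + c * u) / c := by field_simp
  rw [wd_F2 (by positivity) (by positivity) (by rw [e]; positivity), e]
  have e1 : z * ε / c * (1 / c) / ((1 + c * u) / c) ^ 2 = z * ε / (1 + c * u) ^ 2 := by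
    field_simp
  have e2 : z * ε / c * u / ((1 + c * u) / c) = z * ε * u / (1 + c * u) := by
    field_simp
  rw [e1, e2]

noncomputable def Amom (κ z ε c : ℝ) : ℝ≥0∞ :=
  ∫⁻ y in Ioi (0:ℝ), ENNReal.ofReal ((1 + y) ^ (κ - 1) * y) * wd (z * ε / c) (1 / c) y

lemma measurable_wd' (m r : ℝ) : Measurable (wd m r) :=
  measurable_wd measurable_const measurable_const measurable_id

lemma one_add_rpow_le {κ θ x : ℝ} (hκ : 0 < κ) (hθ : 0 < θ) (hx : 0 ≤ x) :
    (1 + x) ^ κ ≤ (κ / θ) ^ κ * Real.exp θ * Real.exp (θ * x) := by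
  have h1 : 1 + x ≤ (κ / θ) * Real.exp ((θ / κ) * (1 + x)) := by
    have h := Real.add_one_le_exp ((θ / κ) * (1 + x))
    have h2 : 1 + x = (κ / θ) * ((θ / κ) * (1 + x)) := by field_simp
    calc 1 + x = (κ / θ) * ((θ / κ) * (1 + x)) := h2
      _ ≤ _ := by gcongr; linarith
  calc (1 + x) ^ κ ≤ ((κ / θ) * Real.exp ((θ / κ) * (1 + x))) ^ κ :=
        Real.rpow_le_rpow (by positivity) h1 hκ.le
    _ = _ := by
        rw [Real.mul_rpow (by positivity) (by positivity), ← Real.exp_mul, mul_assoc ((κ / θ) ^ κ),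
          ← Real.exp_add]
        congr 2
        field_simp

lemma Amom_upper {κ C : ℝ} (hκ : 0 < κ) (hC : 0 < C) : ∃ D : ℝ, 0 < D ∧ ∀ z ε c : ℝ, 0 < z →
    0 < ε → ε ≤ 1 → 0 < c → c ≤ C →
    (z ≤ 1 → Amom κ z ε c ≤ ENNReal.ofReal (D * z)) ∧
    (1 ≤ z → Amom κ z ε c ≤ ENNReal.ofReal (D * z ^ κ)) := by
  set θ : ℝ := 1 / (2 * (1 + C)) with hθd
  have hθ : 0 < θ := by positivity
  have hθ1 : θ ≤ 1 := by rw [hθd, div_le_one (by positivity)]; linarith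
  have hCθ : C * θ ≤ 1 / 2 := by
    rw [hθd]; rw [mul_one_div, div_le_div_iff₀ (by positivity) (by positivity)]; linarith
  set K : ℝ := (κ / θ) ^ κ * Real.exp θ with hK
  have hKpos : 0 < K := by positivity
  refine ⟨K * (4 * Real.exp 2), by positivity, ?_⟩
  intro z ε c hz hε hε1 hc hcC
  have hcθ : c * θ ≤ 1 / 2 := le_trans (by gcongr) hCθ
  constructor
  · intro hz1
    have hpos : 1 / 2 ≤ 1 + c * (-θ) := by linarith
    calc Amom κ z ε c ≤ ∫⁻ y in Ioi (0:ℝ), ENNReal.ofReal K *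
          (ENNReal.ofReal (y * Real.exp (-(-θ * y))) * wd (z * ε / c) (1 / c) y) := by
          apply setLIntegral_mono' measurableSet_Ioi
          intro y hy
          have hy' : (0:ℝ) < y := hy
          rw [← mul_assoc, ← ENNReal.ofReal_mul hKpos.le]
          refine mul_le_mul' (ENNReal.ofReal_le_ofReal ?_) le_rfl
          have h1 : (1 + y) ^ (κ - 1) ≤ (1 + y) ^ κ :=
            Real.rpow_le_rpow_of_exponent_le (by linarith) (by linarith)
          have h2 := one_add_rpow_le hκ hθ hy'.le
          rw [show -(-θ * y) = θ * y by ring]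
          calc (1 + y) ^ (κ - 1) * y ≤ (K * Real.exp (θ * y)) * y := by
                gcongr; exact h1.trans h2
            _ = _ := by ring
      _ = ENNReal.ofReal (K * (z * ε / (1 + c * (-θ)) ^ 2 *
            Real.exp (-(z * ε * (-θ) / (1 + c * (-θ)))))) := by
          have mw := measurable_wd' (z * ε / c) (1 / c)
          rw [lintegral_const_mul _ (by fun_prop),
            wd_G2 hz.le hε hc (by linarith), ENNReal.ofReal_mul hKpos.le]
      _ ≤ _ := by
          apply ENNReal.ofReal_le_ofReal
          rw [mul_assoc K]
          refine mul_le_mul_of_nonneg_left ?_ hKpos.le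
          rw [show 4 * Real.exp 2 * z = z * 4 * Real.exp 2 by ring]
          refine mul_le_mul ?_ (Real.exp_le_exp.2 ?_) (by positivity) (by positivity)
          · rw [div_le_iff₀ (by positivity)]
            have : (1 / 2 : ℝ) ^ 2 ≤ (1 + c * (-θ)) ^ 2 := by gcongr
            nlinarith
          · rw [← neg_div, div_le_iff₀ (by linarith)]
            have : z * ε * θ ≤ 1 := by
              calc z * ε * θ ≤ 1 * 1 * 1 := by gcongr
                _ = 1 := by norm_num
            linarith
  · intro hz1
    have hcθz : c * (θ / z) ≤ 1 / 2 := by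
      refine le_trans ?_ hcθ
      gcongr
      exact div_le_self hθ.le hz1
    have hpos : 1 / 2 ≤ 1 + c * (-(θ / z)) := by linarith
    calc Amom κ z ε c ≤ ∫⁻ y in Ioi (0:ℝ), ENNReal.ofReal (K * z ^ κ) *
          (ENNReal.ofReal (Real.exp (-(-(θ / z) * y))) * wd (z * ε / c) (1 / c) y) := by
          apply setLIntegral_mono' measurableSet_Ioi
          intro y hy
          have hy' : (0:ℝ) < y := hy
          rw [← mul_assoc, ← ENNReal.ofReal_mul (by positivity)]
          refine mul_le_mul' (ENNReal.ofReal_le_ofReal ?_) le_rfl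
          have a1 : (1 + y) ^ (κ - 1) * y ≤ (1 + y) ^ κ := by
              rw [Real.rpow_sub_one (by positivity), div_mul_eq_mul_div,
                div_le_iff₀ (by positivity)]
              have : 0 ≤ (1 + y) ^ κ := by positivity
              nlinarith
          have h2 := one_add_rpow_le hκ hθ (show 0 ≤ y / z by positivity)
          calc (1 + y) ^ (κ - 1) * y ≤ (1 + y) ^ κ := a1
            _ ≤ (z * (1 + y / z)) ^ κ := by
                apply Real.rpow_le_rpow (by positivity) _ hκ.le
                rw [mul_add, mul_div_cancel₀ _ hz.ne']; linarith
            _ = z ^ κ * (1 + y / z) ^ κ := Real.mul_rpow (by positivity) (by positivity)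
            _ ≤ z ^ κ * (K * Real.exp (θ * (y / z))) := by gcongr
            _ = _ := by
                rw [show -(-(θ / z) * y) = θ * (y / z) by ring]; ring
      _ = ENNReal.ofReal (K * z ^ κ * (Real.exp (-(z * ε * (-(θ / z)) / (1 + c * (-(θ / z)))))
            - Real.exp (-(z * ε / c)))) := by
          have mw := measurable_wd' (z * ε / c) (1 / c)
          rw [lintegral_const_mul _ (by fun_prop),
            wd_G1 hz.le hε hc (by linarith), ENNReal.ofReal_mul (p := K * z ^ κ) (by positivity)]
      _ ≤ _ := by
          apply ENNReal.ofReal_le_ofReal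
          rw [mul_right_comm K (4 * Real.exp 2)]
          gcongr
          have h1 : Real.exp (-(z * ε * (-(θ / z)) / (1 + c * (-(θ / z))))) ≤ Real.exp 2 := by
            gcongr
            rw [← neg_div, div_le_iff₀ (by linarith)]
            have h3 : -(z * ε * (-(θ / z))) = ε * θ := by field_simp
            rw [h3]
            have : ε * θ ≤ 1 := by
              calc ε * θ ≤ 1 * 1 := by gcongr
                _ = 1 := by norm_num
            linarith
          have h2 := Real.exp_pos (-(z * ε / c))
          have h3 := Real.exp_pos 2
          linarith

lemma Amom_lower {κ C ε₀ : ℝ} (hC : 0 < C) (hε₀ : 0 < ε₀) :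
    ∃ d : ℝ, 0 < d ∧ ∀ z ε c : ℝ, 1 ≤ z →
    ε₀ ≤ ε → ε ≤ 1 → 0 < c → c ≤ C → ENNReal.ofReal (d * z ^ κ) ≤ Amom κ z ε c := by
  rcases le_or_gt 1 κ with hk | hk
  · set δ := ε₀ / 2 with hδd
    have hδ : 0 < δ := by positivity
    refine ⟨δ ^ κ, by positivity, ?_⟩
    intro z ε c hz hε hε1 hc hcC
    have hz0 : 0 < z := by linarith
    have hεp : 0 < ε := by linarith
    have hm : ∫⁻ y in Ioi (0:ℝ), ENNReal.ofReal y * wd (z * ε / c) (1 / c) y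
        = ENNReal.ofReal (z * ε) := by
      have := wd_G2 (u := 0) hz0.le hεp hc (by linarith)
      simpa using this
    have h0 : ∫⁻ y in Ioi (0:ℝ), wd (z * ε / c) (1 / c) y ≤ 1 := by
      have := wd_G1 (u := 0) hz0.le hεp hc (by linarith)
      simp only [zero_mul, neg_zero, Real.exp_zero, ENNReal.ofReal_one, one_mul, mul_zero,
        add_zero, div_one] at this
      rw [this]
      apply ENNReal.ofReal_le_one.2
      have := Real.exp_pos (-(z * ε / c))
      linarith
    have h1 : ENNReal.ofReal (z * ε) ≤ ENNReal.ofReal (δ * z) +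
        ENNReal.ofReal ((δ * z) ^ (1 - κ)) * Amom κ z ε c := by
      calc ENNReal.ofReal (z * ε)
          = ∫⁻ y in Ioi (0:ℝ), ENNReal.ofReal y * wd (z * ε / c) (1 / c) y := hm.symm
        _ ≤ ∫⁻ y in Ioi (0:ℝ), (ENNReal.ofReal (δ * z) * wd (z * ε / c) (1 / c) y +
            ENNReal.ofReal ((δ * z) ^ (1 - κ)) *
            (ENNReal.ofReal ((1 + y) ^ (κ - 1) * y) * wd (z * ε / c) (1 / c) y)) := by
            apply setLIntegral_mono' measurableSet_Ioi
            intro y hy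
            have hy' : (0:ℝ) < y := hy
            rw [← mul_assoc, ← ENNReal.ofReal_mul (by positivity), ← add_mul,
              ← ENNReal.ofReal_add (by positivity) (by positivity)]
            gcongr
            rcases le_or_gt y (δ * z) with hyz | hyz
            · have : 0 ≤ (δ * z) ^ (1 - κ) * ((1 + y) ^ (κ - 1) * y) := by positivity
              linarith
            · have e1 : (δ * z) ^ (κ - 1) ≤ (1 + y) ^ (κ - 1) :=
                Real.rpow_le_rpow (by positivity) (by linarith) (by linarith)
              have e2 : (δ * z) ^ (1 - κ) * (δ * z) ^ (κ - 1) = 1 := by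
                rw [← Real.rpow_add (by positivity)]; simp
              have e3 : y ≤ (δ * z) ^ (1 - κ) * ((1 + y) ^ (κ - 1) * y) := by
                calc y = (δ * z) ^ (1 - κ) * ((δ * z) ^ (κ - 1) * y) := by
                      rw [← mul_assoc, e2, one_mul]
                  _ ≤ _ := by gcongr
              have : 0 < δ * z := by positivity
              linarith
        _ = ENNReal.ofReal (δ * z) * (∫⁻ y in Ioi (0:ℝ), wd (z * ε / c) (1 / c) y) +
            ENNReal.ofReal ((δ * z) ^ (1 - κ)) * Amom κ z ε c := by
            have mw := measurable_wd' (z * ε / c) (1 / c)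
            rw [lintegral_add_left (by fun_prop), lintegral_const_mul _ mw,
              lintegral_const_mul _ (by fun_prop)]
            rfl
        _ ≤ _ := by
            gcongr
            exact mul_le_of_le_one_right' h0
    have h2 : ENNReal.ofReal (δ * z) ≤ ENNReal.ofReal ((δ * z) ^ (1 - κ)) * Amom κ z ε c := by
      have : ENNReal.ofReal (δ * z) + ENNReal.ofReal (δ * z) ≤ ENNReal.ofReal (z * ε) := by
        rw [← ENNReal.ofReal_add (by positivity) (by positivity)]
        apply ENNReal.ofReal_le_ofReal
        rw [hδd]; nlinarith
      exact (ENNReal.add_le_add_iff_left ENNReal.ofReal_ne_top).1 (this.trans h1)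
    calc ENNReal.ofReal (δ ^ κ * z ^ κ)
        = ENNReal.ofReal ((δ * z) ^ (κ - 1)) * ENNReal.ofReal (δ * z) := by
          rw [← ENNReal.ofReal_mul (by positivity), ← Real.rpow_add_one (by positivity),
            sub_add_cancel, Real.mul_rpow (by positivity) (by positivity)]
      _ ≤ ENNReal.ofReal ((δ * z) ^ (κ - 1)) *
          (ENNReal.ofReal ((δ * z) ^ (1 - κ)) * Amom κ z ε c) := by gcongr
      _ = Amom κ z ε c := by
          rw [← mul_assoc, ← ENNReal.ofReal_mul (by positivity), ← Real.rpow_add (by positivity)]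
          simp
  · obtain ⟨β, hβd⟩ : ∃ β, β = 1 - κ := ⟨_, rfl⟩
    have hβ : 0 < β := by linarith
    refine ⟨ε₀ / (1 + C * β) ^ 2 * Real.exp (-β), by positivity, ?_⟩
    intro z ε c hz hε hε1 hc hcC
    have hz0 : 0 < z := by linarith
    have hεp : 0 < ε := by linarith
    have mw := measurable_wd' (z * ε / c) (1 / c)
    have hcz : c * (β / z) ≤ C * β := by
      have : β / z ≤ β := div_le_self hβ.le hz
      gcongr
    calc ENNReal.ofReal (ε₀ / (1 + C * β) ^ 2 * Real.exp (-β) * z ^ κ)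
        ≤ ENNReal.ofReal (z ^ (κ - 1) * (z * ε / (1 + c * (β / z)) ^ 2 *
          Real.exp (-(z * ε * (β / z) / (1 + c * (β / z)))))) := by
          apply ENNReal.ofReal_le_ofReal
          have e1 : z ^ κ = z ^ (κ - 1) * z := by
            rw [Real.rpow_sub_one hz0.ne', div_mul_cancel₀ _ hz0.ne']
          have e2 : ε₀ / (1 + C * β) ^ 2 ≤ ε / (1 + c * (β / z)) ^ 2 := by gcongr
          have e3 : Real.exp (-β) ≤ Real.exp (-(z * ε * (β / z) / (1 + c * (β / z)))) := by
            apply Real.exp_le_exp.2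
            apply neg_le_neg
            rw [div_le_iff₀ (by positivity)]
            have h3 : z * ε * (β / z) = ε * β := by field_simp
            rw [h3]
            have : 0 < c * (β / z) := by positivity
            nlinarith
          calc ε₀ / (1 + C * β) ^ 2 * Real.exp (-β) * z ^ κ
              ≤ ε / (1 + c * (β / z)) ^ 2 * Real.exp (-(z * ε * (β / z) / (1 + c * (β / z))))
                * z ^ κ := by gcongr
            _ = _ := by rw [e1]; ring
      _ = ∫⁻ y in Ioi (0:ℝ), ENNReal.ofReal (z ^ (κ - 1)) *
          (ENNReal.ofReal (y * Real.exp (-((β / z) * y))) * wd (z * ε / c) (1 / c) y) := by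
          rw [lintegral_const_mul _ (by fun_prop), wd_G2 hz0.le hεp hc (by positivity),
            ENNReal.ofReal_mul (by positivity)]
      _ ≤ Amom κ z ε c := by
          apply setLIntegral_mono' measurableSet_Ioi
          intro y hy
          have hy' : (0:ℝ) < y := hy
          rw [← mul_assoc, ← ENNReal.ofReal_mul (by positivity)]
          refine mul_le_mul' (ENNReal.ofReal_le_ofReal ?_) le_rfl
          have e1 : (z * (1 + y / z)) ^ (κ - 1) ≤ (1 + y) ^ (κ - 1) := by
            apply Real.rpow_le_rpow_of_nonpos (by positivity) _ (by linarith)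
            rw [mul_add, mul_div_cancel₀ _ hz0.ne']; linarith
          rw [Real.mul_rpow (by positivity) (by positivity)] at e1
          have e2 : Real.exp (-((β / z) * y)) ≤ (1 + y / z) ^ (κ - 1) := by
            have : Real.exp (-((β / z) * y)) = (Real.exp (y / z)) ^ (κ - 1) := by
              rw [← Real.exp_mul, hβd]; congr 1; ring
            rw [this]
            apply Real.rpow_le_rpow_of_nonpos (by positivity) _ (by linarith)
            have := Real.add_one_le_exp (y / z)
            linarith
          calc z ^ (κ - 1) * (y * Real.exp (-((β / z) * y)))
              = z ^ (κ - 1) * Real.exp (-((β / z) * y)) * y := by ring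
            _ ≤ z ^ (κ - 1) * (1 + y / z) ^ (κ - 1) * y := by gcongr
            _ ≤ _ := by gcongr

lemma wd_one_sub {z ε c u : ℝ} (hz : 0 ≤ z) (hε : 0 < ε) (hc : 0 < c) (hu : 0 ≤ u) :
    ∫⁻ y in Ioi (0:ℝ), ENNReal.ofReal (1 - Real.exp (-(u * y))) * wd (z * ε / c) (1 / c) y
      = ENNReal.ofReal (1 - Real.exp (-(z * ε * u / (1 + c * u)))) := by
  have mw := measurable_wd' (z * ε / c) (1 / c)
  have h0 := wd_G1 (u := 0) hz hε hc (by linarith)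
  have h1 := wd_G1 (u := u) hz hε hc (by positivity)
  have hle : Real.exp (-(z * ε / c)) ≤ Real.exp (-(z * ε * u / (1 + c * u))) := by
    apply Real.exp_le_exp.2
    apply neg_le_neg
    rw [div_le_div_iff₀ (by positivity) hc]
    have : 0 ≤ z * ε := by positivity
    nlinarith
  have hle1 : Real.exp (-(z * ε * u / (1 + c * u))) ≤ 1 := by
    apply Real.exp_le_one_iff.2
    have : 0 ≤ z * ε * u / (1 + c * u) := by positivity
    linarith
  have hadd : (∫⁻ y in Ioi (0:ℝ), ENNReal.ofReal (1 - Real.exp (-(u * y))) *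
        wd (z * ε / c) (1 / c) y) +
      ∫⁻ y in Ioi (0:ℝ), ENNReal.ofReal (Real.exp (-(u * y))) * wd (z * ε / c) (1 / c) y =
      ∫⁻ y in Ioi (0:ℝ), ENNReal.ofReal (Real.exp (-(0 * y))) * wd (z * ε / c) (1 / c) y := by
    rw [← lintegral_add_left (by fun_prop)]
    apply setLIntegral_congr_fun measurableSet_Ioi
    intro y hy
    have hy' : (0:ℝ) < y := hy
    have : Real.exp (-(u * y)) ≤ 1 := by
      apply Real.exp_le_one_iff.2
      have : 0 ≤ u * y := by positivity
      linarith
    simp only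
    rw [← add_mul, ← ENNReal.ofReal_add (by linarith) (by positivity)]
    congr 2
    simp
  rw [h0, h1] at hadd
  refine (ENNReal.add_left_inj (a := ENNReal.ofReal (Real.exp (-(z * ε * u / (1 + c * u))) -
    Real.exp (-(z * ε / c)))) ENNReal.ofReal_ne_top).1 ?_
  rw [hadd, ← ENNReal.ofReal_add (by linarith) (by linarith)]
  congr 1
  simp

lemma mul_exp_neg_le (x : ℝ) : x * Real.exp (-x) ≤ 1 - Real.exp (-x) := by
  have h := Real.add_one_le_exp x
  have h1 := Real.exp_pos (-x)
  have h2 : Real.exp x * Real.exp (-x) = 1 := by rw [← Real.exp_add]; simp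
  nlinarith

lemma integrable_one_sub (L : Measure ℝ) (hL0 : ∀ᵐ y ∂L, 0 ≤ y) {u : ℝ} (hu : 0 ≤ u)
    (hfin : ∫⁻ y, ENNReal.ofReal (1 - Real.exp (-(u * y))) ∂L < ⊤) :
    Integrable (fun y => 1 - Real.exp (-(u * y))) L := by
  refine ⟨by fun_prop, ?_⟩
  rw [hasFiniteIntegral_iff_ofReal]
  · exact hfin
  · filter_upwards [hL0] with y hy
    have : Real.exp (-(u * y)) ≤ 1 := by
      apply Real.exp_le_one_iff.2
      have : 0 ≤ u * y := by positivity
      linarith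
    simpa using this

lemma integrable_mul_exp (L : Measure ℝ) (hL0 : ∀ᵐ y ∂L, 0 ≤ y) {u : ℝ} (hu : 0 < u)
    (hfin : ∫⁻ y, ENNReal.ofReal (1 - Real.exp (-(u * y))) ∂L < ⊤) :
    Integrable (fun y => y * Real.exp (-(u * y))) L := by
  refine ((integrable_one_sub L hL0 hu.le hfin).const_mul (1 / u)).mono' (by fun_prop) ?_
  filter_upwards [hL0] with y hy
  rw [Real.norm_of_nonneg (by positivity)]
  have := mul_exp_neg_le (u * y)
  rw [div_mul_eq_mul_div, le_div_iff₀ hu]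
  linarith

lemma hasDeriv_one_sub (L : Measure ℝ) (hL0 : ∀ᵐ y ∂L, 0 ≤ y)
    (hfin : ∀ u : ℝ, 0 ≤ u → ∫⁻ y, ENNReal.ofReal (1 - Real.exp (-(u * y))) ∂L < ⊤)
    {u : ℝ} (hu : 0 < u) :
    HasDerivAt (fun v => ∫ y, (1 - Real.exp (-(v * y))) ∂L)
      (∫ y, y * Real.exp (-(u * y)) ∂L) u := by
  refine (hasDerivAt_integral_of_dominated_loc_of_deriv_le (μ := L)
    (F := fun v y => 1 - Real.exp (-(v * y))) (F' := fun v y => y * Real.exp (-(v * y)))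
    (bound := fun y => y * Real.exp (-((u / 2) * y))) (Ioi_mem_nhds (show u / 2 < u by linarith))
    (Eventually.of_forall fun v => by fun_prop)
    (integrable_one_sub L hL0 hu.le (hfin u hu.le)) (by fun_prop) ?_
    (integrable_mul_exp L hL0 (by positivity) (hfin (u / 2) (by positivity))) ?_).2
  · filter_upwards [hL0] with y hy v hv
    rw [Real.norm_of_nonneg (by positivity)]
    have : u / 2 < v := hv
    gcongr
  · filter_upwards with y v hv
    have h1 : HasDerivAt (fun v : ℝ => -(v * y)) (-(1 * y)) v :=
      ((hasDerivAt_id v).mul_const y).neg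
    have := (h1.exp).const_sub 1
    convert this using 1
    ring

lemma sfinite_of_min (ν : Measure ℝ)
    (hν : ∫⁻ z in Set.Ioi (0 : ℝ), ENNReal.ofReal (min z 1) ∂ν < ⊤) :
    SFinite (ν.restrict (Ioi 0)) := by
  set f : ℝ → ℝ≥0∞ := fun z => ENNReal.ofReal (min z 1)
  have hf : Measurable f := by fun_prop
  have h1 : IsFiniteMeasure ((ν.restrict (Ioi 0)).withDensity f) := by
    constructor
    rw [withDensity_apply _ MeasurableSet.univ, Measure.restrict_univ]
    exact hν
  have h2 := withDensity_inv_same₀ (μ := ν.restrict (Ioi 0)) hf.aemeasurable (by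
    filter_upwards [ae_restrict_mem measurableSet_Ioi] with z hz
    have : (0:ℝ) < z := hz
    simp only [f, ne_eq, ENNReal.ofReal_eq_zero, not_le]
    positivity) (ae_of_all _ fun z => ENNReal.ofReal_ne_top)
  rw [← h2]
  infer_instance

noncomputable def cc (b σ s : ℝ) : ℝ := σ ^ 2 / (2 * b) * (1 - Real.exp (-b * s))

attribute [irreducible] wd

noncomputable def Wd (b σ t : ℝ) (νp : Measure ℝ) (y : ℝ) : ℝ≥0∞ :=
  ∫⁻ p, wd (p.2 * Real.exp (-b * p.1) / cc b σ p.1) (1 / cc b σ p.1) y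
    ∂((volume.restrict (Ioc (0:ℝ) t)).prod νp)

lemma measurable_cc (b σ : ℝ) : Measurable (cc b σ) := by unfold cc; fun_prop

lemma measurable_wdp (b σ : ℝ) : Measurable (fun q : ℝ × (ℝ × ℝ) =>
    wd (q.2.2 * Real.exp (-b * q.2.1) / cc b σ q.2.1) (1 / cc b σ q.2.1) q.1) := by
  have := measurable_cc b σ
  apply measurable_wd <;> fun_prop

lemma measurable_Wd (b σ t : ℝ) (νp : Measure ℝ) [SFinite νp] : Measurable (Wd b σ t νp) :=
  (measurable_wdp b σ).lintegral_prod_right'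

lemma measurable_inner (b σ : ℝ) (g : ℝ → ℝ≥0∞) (hg : Measurable g) :
    Measurable (fun p : ℝ × ℝ => ∫⁻ y in Ioi (0:ℝ), g y *
      wd (p.2 * Real.exp (-b * p.1) / cc b σ p.1) (1 / cc b σ p.1) y) := by
  have hcm := measurable_cc b σ
  have hm2 : Measurable (fun q : (ℝ × ℝ) × ℝ => g q.2 *
        wd (q.1.2 * Real.exp (-b * q.1.1) / cc b σ q.1.1) (1 / cc b σ q.1.1) q.2) := by
    refine Measurable.mul (by fun_prop) ?_
    exact measurable_wd (by fun_prop) (by fun_prop) (by fun_prop)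
  exact hm2.lintegral_prod_right'

lemma Wd_tonelli (b σ t : ℝ) (νp : Measure ℝ) [SFinite νp] (g : ℝ → ℝ≥0∞) (hg : Measurable g) :
    ∫⁻ y in Ioi (0:ℝ), g y * Wd b σ t νp y =
    ∫⁻ p, (∫⁻ y in Ioi (0:ℝ), g y *
      wd (p.2 * Real.exp (-b * p.1) / cc b σ p.1) (1 / cc b σ p.1) y)
      ∂((volume.restrict (Ioc (0:ℝ) t)).prod νp) := by
  have hm := measurable_wdp b σ
  have hm2 : Measurable (fun q : ℝ × (ℝ × ℝ) => g q.1 *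
    wd (q.2.2 * Real.exp (-b * q.2.1) / cc b σ q.2.1) (1 / cc b σ q.2.1) q.1) := by fun_prop
  have hsw := lintegral_lintegral_swap (μ := volume.restrict (Ioi (0:ℝ)))
    (ν := (volume.restrict (Ioc (0:ℝ) t)).prod νp)
    (f := fun y p => g y * wd (p.2 * Real.exp (-b * p.1) / cc b σ p.1) (1 / cc b σ p.1) y)
    hm2.aemeasurable
  rw [← hsw]
  congr 1; ext y
  rw [Wd, lintegral_const_mul]
  have hcm := measurable_cc b σ
  exact measurable_wd (by fun_prop) (by fun_prop) (by fun_prop)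

lemma cc_pos {b σ s : ℝ} (hb : 0 < b) (hσ : 0 < σ) (hs : 0 < s) : 0 < cc b σ s := by
  unfold cc
  have : Real.exp (-b * s) < 1 := Real.exp_lt_one_iff.2 (by nlinarith)
  have h2 : 0 < 1 - Real.exp (-b * s) := by linarith
  positivity

lemma cc_le {b σ s t : ℝ} (hb : 0 < b) (hst : s ≤ t) : cc b σ s ≤ cc b σ t := by
  unfold cc
  have : Real.exp (-b * t) ≤ Real.exp (-b * s) := Real.exp_le_exp.2 (by nlinarith)
  gcongr

lemma psi_neg (b σ s u : ℝ) :
    psi b σ s (-u) = -(Real.exp (-b * s) * u / (1 + cc b σ s * u)) := by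
  have : 1 - σ ^ 2 * (-u) / (2 * b) * (1 - Real.exp (-b * s)) = 1 + cc b σ s * u := by
    unfold cc; ring
  rw [psi, this]; ring

/-- The jump part of the exponent. -/
lemma jump_exponent {b σ t : ℝ} (hb : 0 < b) (hσ : 0 < σ)
    (ν : Measure ℝ) [SFinite (ν.restrict (Ioi 0))]
    (hν : ∫⁻ z in Set.Ioi (0 : ℝ), ENNReal.ofReal (min z 1) ∂ν < ⊤) {u : ℝ} (hu : 0 ≤ u) :
    (∫⁻ y in Ioi (0:ℝ), ENNReal.ofReal (1 - Real.exp (-(u * y))) *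
      Wd b σ t (ν.restrict (Ioi 0)) y < ⊤) ∧
    ∫ s in Ioc (0:ℝ) t, ∫ z in Ioi (0:ℝ), (Real.exp (z * psi b σ s (-u)) - 1) ∂ν =
    -(∫⁻ y in Ioi (0:ℝ), ENNReal.ofReal (1 - Real.exp (-(u * y))) *
      Wd b σ t (ν.restrict (Ioi 0)) y).toReal := by
  have hcm := measurable_cc b σ
  set νp := ν.restrict (Ioi 0) with hνp
  have hpos : ∀ᵐ z ∂νp, 0 < z := ae_restrict_mem measurableSet_Ioi
  set F : ℝ → ℝ≥0∞ := fun s => ∫⁻ z, ENNReal.ofReal (1 - Real.exp (-(z * Real.exp (-b * s) * u /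
    (1 + cc b σ s * u)))) ∂νp with hF
  have hFm : Measurable F := by
    have : Measurable (fun q : ℝ × ℝ => ENNReal.ofReal (1 - Real.exp (-(q.2 * Real.exp (-b * q.1)
      * u / (1 + cc b σ q.1 * u))))) := by fun_prop
    exact this.lintegral_prod_right'
  have hFB : ∀ s, 0 < s → F s ≤ ENNReal.ofReal (1 + u) *
      ∫⁻ z, ENNReal.ofReal (min z 1) ∂νp := by
    intro s hs
    rw [← lintegral_const_mul _ (by fun_prop)]
    apply lintegral_mono_ae
    filter_upwards [hpos] with z hz
    rw [← ENNReal.ofReal_mul (by positivity)]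
    apply ENNReal.ofReal_le_ofReal
    have hc := cc_pos hb hσ hs
    have he : Real.exp (-b * s) ≤ 1 := Real.exp_le_one_iff.2 (by nlinarith)
    set q := z * Real.exp (-b * s) * u / (1 + cc b σ s * u) with hq
    have hq0 : 0 ≤ q := by positivity
    have hq1 : q ≤ z * u := by
      rw [hq]
      calc z * Real.exp (-b * s) * u / (1 + cc b σ s * u) ≤ z * Real.exp (-b * s) * u :=
            div_le_self (by positivity) (by
              have : 0 ≤ cc b σ s * u := by positivity
              linarith)
        _ ≤ z * 1 * u := by gcongr
        _ = z * u := by ring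
    have h1 := Real.add_one_le_exp (-q)
    have h2 := Real.exp_pos (-q)
    rcases le_total z 1 with hz1 | hz1
    · rw [min_eq_left hz1]; nlinarith
    · rw [min_eq_right hz1]; linarith
  have hFB' : ∫⁻ s in Ioc (0:ℝ) t, F s < ⊤ := by
    calc ∫⁻ s in Ioc (0:ℝ) t, F s ≤ ∫⁻ s in Ioc (0:ℝ) t, ENNReal.ofReal (1 + u) *
          ∫⁻ z, ENNReal.ofReal (min z 1) ∂νp :=
          setLIntegral_mono' measurableSet_Ioc fun s hs => hFB s hs.1
      _ < ⊤ := by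
          rw [setLIntegral_const]
          exact ENNReal.mul_lt_top (ENNReal.mul_lt_top ENNReal.ofReal_lt_top hν) (by simp)
  have hW : ∫⁻ y in Ioi (0:ℝ), ENNReal.ofReal (1 - Real.exp (-(u * y))) * Wd b σ t νp y =
      ∫⁻ s in Ioc (0:ℝ) t, F s := by
    rw [Wd_tonelli _ _ _ _ _ (by fun_prop), lintegral_prod]
    · apply setLIntegral_congr_fun measurableSet_Ioc
      intro s hs
      apply lintegral_congr_ae
      filter_upwards [hpos] with z hz
      exact wd_one_sub hz.le (Real.exp_pos _) (cc_pos hb hσ hs.1) hu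
    · exact (measurable_inner b σ _ (by fun_prop)).aemeasurable
  rw [hW]
  refine ⟨hFB', ?_⟩
  rw [← integral_toReal hFm.aemeasurable, ← integral_neg]
  · apply setIntegral_congr_fun measurableSet_Ioc
    intro s hs
    simp only
    have hc := cc_pos hb hσ hs.1
    have hint : ∫ z, (1 - Real.exp (-(z * Real.exp (-b * s) * u / (1 + cc b σ s * u)))) ∂νp
        = (F s).toReal := by
      rw [integral_eq_lintegral_of_nonneg_ae _ (by fun_prop)]
      filter_upwards [hpos] with z hz
      have h0 : 0 ≤ z * Real.exp (-b * s) * u / (1 + cc b σ s * u) := by positivity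
      have : Real.exp (-(z * Real.exp (-b * s) * u / (1 + cc b σ s * u))) ≤ 1 :=
        Real.exp_le_one_iff.2 (by linarith)
      simpa using this
    rw [← hint, ← integral_neg]
    congr 1; ext z
    rw [psi_neg, neg_sub]
    congr 2; ring
  · filter_upwards [ae_restrict_mem measurableSet_Ioc] with s hs
    exact lt_of_le_of_lt (hFB s hs.1) (ENNReal.mul_lt_top ENNReal.ofReal_lt_top hν)

/-- Moment bounds for the jump part. -/
lemma jump_moment_iff {b σ t κ : ℝ} (hb : 0 < b) (hσ : 0 < σ) (ht : 0 < t) (hκ : 0 < κ)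
    (ν : Measure ℝ) [SFinite (ν.restrict (Ioi 0))]
    (hν : ∫⁻ z in Set.Ioi (0 : ℝ), ENNReal.ofReal (min z 1) ∂ν < ⊤) :
    (∫⁻ y in Ioi (0:ℝ), ENNReal.ofReal ((1 + y) ^ (κ - 1) * y) *
      Wd b σ t (ν.restrict (Ioi 0)) y < ⊤) ↔
    ∫⁻ z in Ioi (1:ℝ), ENNReal.ofReal (z ^ κ) ∂ν < ⊤ := by
  have hcm := measurable_cc b σ
  have hC := cc_pos hb hσ ht
  have hpos : ∀ᵐ z ∂(ν.restrict (Ioi 0)), 0 < z := ae_restrict_mem measurableSet_Ioi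
  have hW : ∫⁻ y in Ioi (0:ℝ), ENNReal.ofReal ((1 + y) ^ (κ - 1) * y) *
      Wd b σ t (ν.restrict (Ioi 0)) y =
      ∫⁻ s in Ioc (0:ℝ) t, ∫⁻ z in Ioi (0:ℝ), Amom κ z (Real.exp (-b * s)) (cc b σ s) ∂ν := by
    rw [Wd_tonelli _ _ _ _ _ (by fun_prop), lintegral_prod]
    · rfl
    · exact (measurable_inner b σ _ (by fun_prop)).aemeasurable
  have hind : ∫⁻ z in Ioi (1:ℝ), ENNReal.ofReal (z ^ κ) ∂ν =
      ∫⁻ z in Ioi (0:ℝ), (Ioi (1:ℝ)).indicator (fun z => ENNReal.ofReal (z ^ κ)) z ∂ν := by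
    rw [lintegral_indicator measurableSet_Ioi, Measure.restrict_restrict measurableSet_Ioi]
    congr 2
    ext z
    simp only [mem_inter_iff, mem_Ioi]
    constructor
    · intro h; exact ⟨h, by linarith⟩
    · intro h; exact h.1
  have hmi : Measurable ((Ioi (1:ℝ)).indicator (fun z => ENNReal.ofReal (z ^ κ))) :=
    Measurable.indicator (by fun_prop) measurableSet_Ioi
  rw [hW, hind]
  have he1 : ∀ s, 0 < s → Real.exp (-b * s) ≤ 1 :=
    fun s hs => Real.exp_le_one_iff.2 (by nlinarith)
  constructor
  · intro h
    obtain ⟨d, hd, hlow⟩ := Amom_lower (κ := κ) hC (Real.exp_pos (-b * t))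
    have h1 : ∫⁻ s in Ioc (0:ℝ) t, (ENNReal.ofReal d * ∫⁻ z in Ioi (0:ℝ),
        (Ioi (1:ℝ)).indicator (fun z => ENNReal.ofReal (z ^ κ)) z ∂ν) < ⊤ := by
      refine lt_of_le_of_lt (setLIntegral_mono' measurableSet_Ioc ?_) h
      intro s hs
      rw [← lintegral_const_mul _ hmi]
      apply lintegral_mono
      intro z
      beta_reduce
      by_cases hz : z ∈ Ioi (1:ℝ)
      · rw [indicator_of_mem hz, ← ENNReal.ofReal_mul hd.le]
        exact hlow z _ _ (le_of_lt hz) (Real.exp_le_exp.2 (by nlinarith [hs.2])) (he1 s hs.1)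
          (cc_pos hb hσ hs.1) (cc_le hb hs.2)
      · rw [indicator_of_notMem hz]; simp
    rw [setLIntegral_const] at h1
    refine lt_top_iff_ne_top.2 fun htop => ?_
    rw [htop, ENNReal.mul_top (by simpa using hd), ENNReal.top_mul (by simpa using ht)] at h1
    exact lt_irrefl _ h1
  · intro h
    obtain ⟨D, hD, hup⟩ := Amom_upper hκ hC
    calc ∫⁻ s in Ioc (0:ℝ) t, ∫⁻ z in Ioi (0:ℝ), Amom κ z (Real.exp (-b * s)) (cc b σ s) ∂ν
        ≤ ∫⁻ s in Ioc (0:ℝ) t, ENNReal.ofReal D * ((∫⁻ z in Ioi (0:ℝ), ENNReal.ofReal (min z 1) ∂ν)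
          + ∫⁻ z in Ioi (0:ℝ), (Ioi (1:ℝ)).indicator (fun z => ENNReal.ofReal (z ^ κ)) z ∂ν) := by
          refine setLIntegral_mono' measurableSet_Ioc ?_
          intro s hs
          rw [← lintegral_add_left (by fun_prop), ← lintegral_const_mul _ (by fun_prop)]
          apply lintegral_mono_ae
          filter_upwards [hpos] with z hz
          have hb := hup z (Real.exp (-b * s)) (cc b σ s) hz (Real.exp_pos _) (he1 s hs.1)
            (cc_pos hb hσ hs.1) (cc_le hb hs.2)
          by_cases hz1 : z ∈ Ioi (1:ℝ)
          · rw [indicator_of_mem hz1]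
            refine (hb.2 (le_of_lt hz1)).trans ?_
            rw [ENNReal.ofReal_mul hD.le]
            gcongr
            exact le_add_self
          · rw [indicator_of_notMem hz1, add_zero]
            have hz2 : z ≤ 1 := by simpa using hz1
            refine (hb.1 hz2).trans ?_
            rw [ENNReal.ofReal_mul hD.le, min_eq_left hz2]
      _ < ⊤ := by
          rw [setLIntegral_const]
          exact ENNReal.mul_lt_top (ENNReal.mul_lt_top ENNReal.ofReal_lt_top
            (ENNReal.add_lt_top.2 ⟨hν, h⟩)) (by simp)

lemma main_abstract {C p q κ : ℝ} (hC : 0 < C) (hp : 0 ≤ p) (hq : 0 ≤ q) (hκ : 0 < κ)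
    (W : ℝ → ℝ≥0∞) (hW : Measurable W)
    (hWfin : ∀ u : ℝ, 0 ≤ u →
      ∫⁻ y in Ioi (0:ℝ), ENNReal.ofReal (1 - Real.exp (-(u * y))) * W y < ⊤)
    (μ : Measure ℝ) [IsProbabilityMeasure μ] (hμ : μ (Iio 0) = 0)
    (hLap : ∀ u : ℝ, 0 ≤ u → ∫ y, Real.exp (-(u * y)) ∂μ =
      (1 + C * u) ^ (-p) * Real.exp (-(q * u / (1 + C * u))) *
        Real.exp (-(∫⁻ y in Ioi (0:ℝ), ENNReal.ofReal (1 - Real.exp (-(u * y))) * W y).toReal)) :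
    (∫⁻ y, ENNReal.ofReal (y ^ κ) ∂μ < ⊤) ↔
      ∫⁻ y in Ioi (0:ℝ), ENNReal.ofReal ((1 + y) ^ (κ - 1) * y) * W y < ⊤ := by
  set Y : Measure ℝ := volume.restrict (Ioi 0) with hY
  have hY0 : ∀ᵐ y ∂Y, 0 < y := ae_restrict_mem measurableSet_Ioi
  have hμ0 : ∀ᵐ y ∂μ, 0 ≤ y := by
    filter_upwards [measure_eq_zero_iff_ae_notMem.1 hμ] with y hy; simpa using hy
  -- the jump measure
  set Λ : Measure ℝ := Y.withDensity W with hΛ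
  have hΛ0 : ∀ᵐ y ∂Λ, 0 ≤ y :=
    (withDensity_absolutelyContinuous Y W).ae_le (hY0.mono fun y hy => hy.le)
  have hΛint : ∀ f : ℝ → ℝ≥0∞, Measurable f → ∫⁻ y, f y ∂Λ = ∫⁻ y, f y * W y ∂Y := by
    intro f hf
    rw [hΛ, lintegral_withDensity_eq_lintegral_mul _ hW hf]
    refine lintegral_congr fun y => ?_
    simp [mul_comm]
  have hΛfin : ∀ u : ℝ, 0 ≤ u → ∫⁻ y, ENNReal.ofReal (1 - Real.exp (-(u * y))) ∂Λ < ⊤ := by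
    intro u hu
    rw [hΛint _ (by fun_prop)]
    exact hWfin u hu
  have hμfin : ∀ u : ℝ, 0 ≤ u → ∫⁻ y, ENNReal.ofReal (1 - Real.exp (-(u * y))) ∂μ < ⊤ := by
    intro u hu
    calc ∫⁻ y, ENNReal.ofReal (1 - Real.exp (-(u * y))) ∂μ ≤ ∫⁻ y, 1 ∂μ := by
          apply lintegral_mono
          intro y
          beta_reduce
          rw [← ENNReal.ofReal_one]
          apply ENNReal.ofReal_le_ofReal
          linarith [Real.exp_pos (-(u * y))]
      _ < ⊤ := by simp
  have nn1 : ∀ (L : Measure ℝ), (∀ᵐ y ∂L, 0 ≤ y) → ∀ u : ℝ, 0 ≤ u →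
      0 ≤ᵐ[L] fun y => 1 - Real.exp (-(u * y)) := by
    intro L hL u hu
    filter_upwards [hL] with y hy
    have : Real.exp (-(u * y)) ≤ 1 := Real.exp_le_one_iff.2 (by nlinarith [mul_nonneg hu hy])
    simpa using this
  have hexpint : ∀ u : ℝ, 0 ≤ u → Integrable (fun y => Real.exp (-(u * y))) μ := by
    intro u hu
    refine (integrable_const (1:ℝ)).mono' (by fun_prop) ?_
    filter_upwards [hμ0] with y hy
    rw [Real.norm_of_nonneg (Real.exp_pos _).le]
    exact Real.exp_le_one_iff.2 (by nlinarith [mul_nonneg hu hy])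
  have hLap2 : ∀ u : ℝ, 0 ≤ u → ∫ y, (1 - Real.exp (-(u * y))) ∂μ =
      1 - (1 + C * u) ^ (-p) * Real.exp (-(q * u / (1 + C * u))) *
        Real.exp (-(∫ y, (1 - Real.exp (-(u * y))) ∂Λ)) := by
    intro u hu
    rw [integral_sub (integrable_const _) (hexpint u hu), hLap u hu,
      integral_eq_lintegral_of_nonneg_ae (nn1 Λ hΛ0 u hu) (by fun_prop), hΛint _ (by fun_prop)]
    simp
  -- differentiate
  have hder : ∀ u : ℝ, 0 < u → ∫ y, y * Real.exp (-(u * y)) ∂μ =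
      (∫ y, Real.exp (-(u * y)) ∂μ) * (p * C / (1 + C * u) + q / (1 + C * u) ^ 2 +
        ∫ y, y * Real.exp (-(u * y)) ∂Λ) := by
    intro u hu
    have hpos : 0 < 1 + C * u := by positivity
    have d1 := hasDeriv_one_sub μ hμ0 hμfin hu
    have d2 := hasDeriv_one_sub Λ hΛ0 hΛfin hu
    have e0 : HasDerivAt (fun v : ℝ => 1 + C * v) C u := by
      simpa using ((hasDerivAt_id u).const_mul C).const_add 1
    have e1 : HasDerivAt (fun v : ℝ => (1 + C * v) ^ (-p)) (C * (-p) * (1 + C * u) ^ (-p - 1)) u :=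
      e0.rpow_const (Or.inl hpos.ne')
    have e2a : HasDerivAt (fun v : ℝ => q * v) q u := by
      simpa using (hasDerivAt_id u).const_mul q
    have e2 := (e2a.div e0 hpos.ne').neg.exp
    have e3 := d2.neg.exp
    have e4 := ((e1.mul e2).mul e3).const_sub 1
    have heq : (fun v => ∫ y, (1 - Real.exp (-(v * y))) ∂μ) =ᶠ[nhds u] fun v =>
      1 - (1 + C * v) ^ (-p) * Real.exp (-(q * v / (1 + C * v))) *
        Real.exp (-(∫ y, (1 - Real.exp (-(v * y))) ∂Λ)) := by
      filter_upwards [Ioi_mem_nhds hu] with v hv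
      exact hLap2 v (le_of_lt hv)
    have d3 := d1.congr_of_eventuallyEq heq.symm
    have key := d3.unique e4
    have hL1 : ∫ y, Real.exp (-(u * y)) ∂μ = (1 + C * u) ^ (-p) *
        Real.exp (-(q * u / (1 + C * u))) *
        Real.exp (-(∫ y, (1 - Real.exp (-(u * y))) ∂Λ)) := by
      have := hLap2 u hu.le
      rw [integral_sub (integrable_const _) (hexpint u hu.le)] at this
      simp only [integral_const, probReal_univ, smul_eq_mul, mul_one] at this
      linarith
    rw [key, hL1, Real.rpow_sub hpos, Real.rpow_one]
    simp only [Pi.mul_apply, Pi.neg_apply, Pi.div_apply]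
    field_simp
    ring
  set Rr : ℝ := 1 / C with hRr
  have hR : 0 < Rr := by positivity
  set l : ℝ → ℝ≥0∞ := fun y => ENNReal.ofReal (p * (y ^ 0 * Real.exp (-(Rr * y)))) +
    ENNReal.ofReal (q * Rr ^ 2 * (y ^ 1 * Real.exp (-(Rr * y)))) with hl
  have hlm : Measurable l := by fun_prop
  set D : ℝ → ℝ≥0∞ := fun y => l y + ENNReal.ofReal y * W y with hD
  have hDm : Measurable D := by fun_prop
  set η : Measure ℝ := Y.withDensity D with hη
  have hη0 : η (Iio 0) = 0 := by
    apply withDensity_absolutelyContinuous Y D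
    rw [hY, Measure.restrict_apply measurableSet_Iio]
    convert measure_empty (μ := (volume : Measure ℝ))
    ext y
    simp only [mem_inter_iff, mem_Iio, mem_Ioi, mem_empty_iff_false, iff_false]
    intro h; linarith [h.1, h.2]
  have hηint : ∀ f : ℝ → ℝ≥0∞, Measurable f → ∫⁻ y, f y ∂η =
      ∫⁻ y, f y * l y ∂Y + ∫⁻ y, f y * ENNReal.ofReal y * W y ∂Y := by
    intro f hf
    rw [hη, lintegral_withDensity_eq_lintegral_mul _ hDm hf, ← lintegral_add_left (by fun_prop)]
    refine lintegral_congr fun y => ?_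
    simp only [Pi.mul_apply, hD]
    ring
  have hsum : ∀ θ : ℝ, θ < Rr → ∫⁻ y, ENNReal.ofReal (Real.exp (θ * y)) * l y ∂Y =
      ENNReal.ofReal (p / (Rr - θ) + q * Rr ^ 2 / (Rr - θ) ^ 2) := by
    intro θ hθ
    have hβ : 0 < Rr - θ := by linarith
    have g0 := gam 0 hβ
    have g1 := gam 1 hβ
    have : ∀ y : ℝ, ENNReal.ofReal (Real.exp (θ * y)) * l y =
        ENNReal.ofReal p * ENNReal.ofReal (y ^ 0 * Real.exp (-((Rr - θ) * y))) +
        ENNReal.ofReal (q * Rr ^ 2) * ENNReal.ofReal (y ^ 1 * Real.exp (-((Rr - θ) * y))) := by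
      intro y
      have hee : Real.exp (-((Rr - θ) * y)) = Real.exp (θ * y) * Real.exp (-(Rr * y)) := by
        rw [← Real.exp_add]; congr 1; ring
      rw [hl]
      beta_reduce
      rw [mul_add, ← ENNReal.ofReal_mul (Real.exp_pos _).le,
        ← ENNReal.ofReal_mul (Real.exp_pos _).le, ← ENNReal.ofReal_mul hp,
        ← ENNReal.ofReal_mul (by positivity), hee]
      congr 2 <;> ring
    simp_rw [this]
    rw [lintegral_add_left (by fun_prop), lintegral_const_mul _ (by fun_prop),
      lintegral_const_mul _ (by fun_prop), g0, g1, ← ENNReal.ofReal_mul hp,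
      ← ENNReal.ofReal_mul (by positivity), ← ENNReal.ofReal_add (by positivity) (by positivity)]
    congr 1
    simp
    field_simp
  have hyexp : ∀ u : ℝ, ∀ y : ℝ, ENNReal.ofReal (Real.exp (-(u * y))) * ENNReal.ofReal y =
      ENNReal.ofReal (y * Real.exp (-(u * y))) := by
    intro u y
    rw [← ENNReal.ofReal_mul (Real.exp_pos _).le, mul_comm]
  have nn2 : ∀ (L : Measure ℝ), (∀ᵐ y ∂L, 0 ≤ y) → ∀ u : ℝ,
      0 ≤ᵐ[L] fun y => y * Real.exp (-(u * y)) := by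
    intro L hL u
    filter_upwards [hL] with y hy
    exact mul_nonneg hy (Real.exp_pos _).le
  have hL : ∀ u : ℝ, 0 < u → ∫⁻ y, ENNReal.ofReal (y * Real.exp (-(u * y))) ∂μ =
      (∫⁻ y, ENNReal.ofReal (Real.exp (-(u * y))) ∂μ) *
        ∫⁻ y, ENNReal.ofReal (Real.exp (-(u * y))) ∂η := by
    intro u hu
    have i1 := integrable_mul_exp μ hμ0 hu (hμfin u hu.le)
    have i2 := integrable_mul_exp Λ hΛ0 hu (hΛfin u hu.le)
    have s1 := hsum (-u) (by linarith)
    have hE : ∫⁻ y, ENNReal.ofReal (Real.exp (-(u * y))) ∂η =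
        ENNReal.ofReal (p * C / (1 + C * u) + q / (1 + C * u) ^ 2 +
        ∫ y, y * Real.exp (-(u * y)) ∂Λ) := by
      rw [hηint _ (by fun_prop)]
      simp_rw [hyexp]
      rw [← hΛint _ (by fun_prop), ← ofReal_integral_eq_lintegral_ofReal i2 (nn2 Λ hΛ0 u)]
      simp only [neg_mul] at s1
      rw [s1, ← ENNReal.ofReal_add]
      · congr 2
        have hpos : 0 < 1 + C * u := by positivity
        have hr : Rr - -u = (1 + C * u) / C := by rw [hRr]; field_simp; ring
        rw [hr, hRr]
        field_simp
      · have : 0 < Rr - -u := by linarith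
        positivity
      · exact integral_nonneg_of_ae (nn2 Λ hΛ0 u)
    rw [hE, ← ofReal_integral_eq_lintegral_ofReal i1 (nn2 μ hμ0 u),
      ← ofReal_integral_eq_lintegral_ofReal (hexpint u hu.le)
        (Eventually.of_forall fun y => (Real.exp_pos _).le), ← ENNReal.ofReal_mul
        (integral_nonneg fun y => (Real.exp_pos _).le), hder u hu]
  rw [moment_iff_eta μ η hμ hη0 (conv_identity μ η hμ hη0 hL) hκ, hηint _ (by fun_prop)]
  have hlight : ∫⁻ y, ENNReal.ofReal ((1 + y) ^ (κ - 1)) * l y ∂Y < ⊤ := by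
    have hθ : 0 < Rr / 2 := by positivity
    set K := (κ / (Rr / 2)) ^ κ * Real.exp (Rr / 2) with hK
    have hK0 : 0 ≤ K := by positivity
    calc ∫⁻ y, ENNReal.ofReal ((1 + y) ^ (κ - 1)) * l y ∂Y
        ≤ ∫⁻ y, ENNReal.ofReal K * (ENNReal.ofReal (Real.exp (Rr / 2 * y)) * l y) ∂Y := by
          apply lintegral_mono_ae
          filter_upwards [hY0] with y hy
          rw [← mul_assoc, ← ENNReal.ofReal_mul hK0]
          gcongr
          calc (1 + y) ^ (κ - 1) ≤ (1 + y) ^ κ :=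
                Real.rpow_le_rpow_of_exponent_le (by linarith) (by linarith)
            _ ≤ _ := one_add_rpow_le hκ hθ hy.le
      _ < ⊤ := by
          rw [lintegral_const_mul _ (by fun_prop), hsum _ (by linarith)]
          exact ENNReal.mul_lt_top ENNReal.ofReal_lt_top ENNReal.ofReal_lt_top
  have hsecond : ∫⁻ y, ENNReal.ofReal ((1 + y) ^ (κ - 1)) * ENNReal.ofReal y * W y ∂Y =
      ∫⁻ y, ENNReal.ofReal ((1 + y) ^ (κ - 1) * y) * W y ∂Y := by
    apply lintegral_congr_ae
    filter_upwards [hY0] with y hy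
    rw [← ENNReal.ofReal_mul (by positivity)]
  rw [hsecond, ENNReal.add_lt_top]
  exact ⟨fun h => h.2, fun h => ⟨hlight, h⟩⟩

theorem jcir_kappa_moment_iff (a b σ κ x t : ℝ) (ha : 0 ≤ a) (hb : 0 < b) (hσ : 0 < σ)
    (hκ : 0 < κ) (hx : 0 ≤ x) (ht : 0 < t)
    (ν : Measure ℝ) (hνsupp : ν (Set.Iic 0) = 0)
    (hν : ∫⁻ z in Set.Ioi (0 : ℝ), ENNReal.ofReal (min z 1) ∂ν < ⊤)
    (μ : Measure ℝ) (hμ : IsProbabilityMeasure μ) (hμsupp : μ (Set.Iio 0) = 0)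
    (hLap : ∀ u : ℝ, u ≤ 0 →
      ∫ y, Real.exp (u * y) ∂μ =
        (1 - σ ^ 2 * u / (2 * b) * (1 - Real.exp (-b * t))) ^ (-(2 * a / σ ^ 2)) *
          Real.exp (x * psi b σ t u) *
          Real.exp (∫ s in Set.Ioc (0 : ℝ) t,
            ∫ z in Set.Ioi (0 : ℝ), (Real.exp (z * psi b σ s u) - 1) ∂ν)) :
    (∫⁻ y, ENNReal.ofReal (y ^ κ) ∂μ < ⊤) ↔
      ∫⁻ z in Set.Ioi (1 : ℝ), ENNReal.ofReal (z ^ κ) ∂ν < ⊤ := by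
  have hC := cc_pos hb hσ ht
  haveI := sfinite_of_min ν hν
  have hC' : ∀ u : ℝ, 1 - σ ^ 2 * (-u) / (2 * b) * (1 - Real.exp (-b * t)) = 1 + cc b σ t * u := by
    intro u; rw [cc]; ring
  rw [← jump_moment_iff hb hσ ht hκ ν hν]
  refine main_abstract (C := cc b σ t) (p := 2 * a / σ ^ 2) (q := x * Real.exp (-b * t)) hC
    (by positivity) (by positivity) hκ _ (measurable_Wd b σ t _)
    (fun u hu => (jump_exponent hb hσ ν hν hu).1) μ hμsupp ?_
  intro u hu
  have h := hLap (-u) (by linarith)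
  rw [hC', (jump_exponent hb hσ ν hν hu).2, psi_neg] at h
  simp only [neg_mul] at h ⊢
  rw [h]
  congr 3
  ring
end

section
/- Let a ≥ 0, b > 0, σ > 0, κ > 0, and let ν be a measure on (0,∞) with ∫_0^∞ (z∧1) ν(dz) < ∞ and ∫_{(1,∞)} z^κ ν(dz) < ∞. Fix x ≥ 0 and T > 0, and let (μ_t)_{t∈(0,T]} be a family of probability measures on [0,∞) such that for every t ∈ (0,T] and every real u ≤ 0, ∫ e^{uy} μ_t(dy) = (1 − (σ²u/(2b))(1 − e^{−bt}))^{−2a/σ²} · exp(x ψ(t,u)) · exp(∫_0^t ∫_0^∞ (e^{zψ(s,u)} − 1) ν(dz) ds). Then sup_{t∈(0,T]} ∫ y^κ μ_t(dy) < ∞. -/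
open MeasureTheory Filter Set
open scoped ENNReal

noncomputable def jG (ν : Measure ℝ) (v : ℝ) : ℝ := ∫ z in Set.Ioi (0 : ℝ), (Real.exp (z * v) - 1) ∂ν

noncomputable def jD (b σ t u : ℝ) : ℝ := 1 - σ ^ 2 * u / (2 * b) * (1 - Real.exp (-b * t))

lemma jD_ge {b σ t u : ℝ} (hb : 0 < b) (ht : 0 ≤ t) (hu : u ≤ 0) : 1 ≤ jD b σ t u := by
  unfold jD
  have h1 : Real.exp (-b * t) ≤ 1 := Real.exp_le_one_iff.2 (by nlinarith)
  have h2 : σ ^ 2 * u / (2 * b) ≤ 0 :=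
    div_nonpos_of_nonpos_of_nonneg (mul_nonpos_of_nonneg_of_nonpos (sq_nonneg _) hu) (by linarith)
  nlinarith

lemma psi_eq (b σ t u : ℝ) : psi b σ t u = u * Real.exp (-b * t) / jD b σ t u := rfl

lemma psi_nonpos {b σ t u : ℝ} (hb : 0 < b) (ht : 0 ≤ t) (hu : u ≤ 0) : psi b σ t u ≤ 0 := by
  rw [psi_eq]
  have := jD_ge (σ := σ) hb ht hu
  exact div_nonpos_of_nonpos_of_nonneg
    (mul_nonpos_of_nonpos_of_nonneg hu (Real.exp_pos _).le) (by linarith)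

lemma psi_ge {b σ t u : ℝ} (hb : 0 < b) (ht : 0 ≤ t) (hu : u ≤ 0) : u ≤ psi b σ t u := by
  rw [psi_eq]
  have h := jD_ge (σ := σ) hb ht hu
  have h1 : Real.exp (-b * t) ≤ 1 := Real.exp_le_one_iff.2 (by nlinarith)
  rw [le_div_iff₀ (by linarith)]
  nlinarith

lemma jD_mul {b σ t h u : ℝ} (hb : 0 < b) (hh : 0 ≤ h) (hu : u ≤ 0) :
    jD b σ (t + h) u = jD b σ t (psi b σ h u) * jD b σ h u := by
  have h1 := jD_ge (σ := σ) hb hh hu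
  have h2 : jD b σ h u ≠ 0 := by linarith
  have h3 : jD b σ t (psi b σ h u) * jD b σ h u =
      jD b σ h u - σ ^ 2 * (u * Real.exp (-b * h)) / (2 * b) * (1 - Real.exp (-b * t)) := by
    rw [psi_eq, jD]
    field_simp
  rw [h3]
  unfold jD
  have : Real.exp (-b * (t + h)) = Real.exp (-b * t) * Real.exp (-b * h) := by
    rw [← Real.exp_add]; ring_nf
  rw [this]
  ring

lemma psi_add {b σ t h u : ℝ} (hb : 0 < b) (ht : 0 ≤ t) (hh : 0 ≤ h) (hu : u ≤ 0) :
    psi b σ (t + h) u = psi b σ t (psi b σ h u) := by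
  have h1 := jD_ge (σ := σ) hb hh hu
  have h4 := jD_ge (σ := σ) hb ht (psi_nonpos (σ := σ) hb hh hu)
  rw [psi_eq b σ (t+h), psi_eq b σ t, jD_mul hb hh hu]
  have : Real.exp (-b * (t + h)) = Real.exp (-b * t) * Real.exp (-b * h) := by
    rw [← Real.exp_add]; ring_nf
  rw [this]
  have h2 : jD b σ h u ≠ 0 := by linarith
  have h5 : jD b σ t (psi b σ h u) ≠ 0 := by linarith
  rw [div_eq_div_iff (mul_ne_zero h5 h2) h5]
  have h6 : psi b σ h u * jD b σ h u = u * Real.exp (-b * h) := by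
    rw [psi_eq]; field_simp
  linear_combination (-Real.exp (-b * t) * jD b σ t (psi b σ h u)) * h6

lemma jD_hasDeriv (b σ u t : ℝ) (hb : 0 < b) :
    HasDerivAt (fun t => jD b σ t u) (-(σ ^ 2 * u / 2) * Real.exp (-b * t)) t := by
  unfold jD
  have h1 : HasDerivAt (fun t => Real.exp (-b * t)) (Real.exp (-b * t) * (-b)) t := by
    have := ((hasDerivAt_id t).const_mul (-b)).exp
    simpa using this
  refine (((h1.const_sub 1).const_mul (σ ^ 2 * u / (2 * b))).const_sub 1).congr_deriv ?_
  field_simp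

lemma psi_hasDeriv_zero (b σ u : ℝ) (hb : 0 < b) :
    HasDerivAt (fun t => psi b σ t u) (-b * u + σ ^ 2 / 2 * u ^ 2) 0 := by
  have h1 : HasDerivAt (fun t => Real.exp (-b * t)) (Real.exp (-b * 0) * (-b)) 0 := by
    have := ((hasDerivAt_id (0:ℝ)).const_mul (-b)).exp
    simpa using this
  have h0 : jD b σ 0 u = 1 := by simp [jD]
  refine (((h1.const_mul u)).div (jD_hasDeriv b σ u 0 hb) (by rw [h0]; norm_num)).congr_deriv ?_
  rw [h0]; simp; ring

lemma psi_cont {b σ u : ℝ} (hb : 0 < b) (hu : u ≤ 0) :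
    ContinuousOn (fun t => psi b σ t u) (Ici 0) := by
  have : ContinuousOn (fun t => u * Real.exp (-b * t) / jD b σ t u) (Ici 0) := by
    apply ContinuousOn.div
    · fun_prop
    · exact fun t _ => (jD_hasDeriv b σ u t hb).continuousAt.continuousWithinAt
    · intro t ht
      have := jD_ge (σ := σ) hb ht hu
      linarith
  exact this

lemma exp_bound {z v w : ℝ} (hz : 0 < z) (hv : v ≤ 0) (hw : w ≤ v) :
    ‖Real.exp (z * v) - 1‖ ≤ (1 - w) * min z 1 := by
  have h1 : Real.exp (z * v) ≤ 1 := Real.exp_le_one_iff.2 (by nlinarith)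
  have h2 := Real.add_one_le_exp (z * v)
  have h3 := Real.exp_pos (z * v)
  rw [Real.norm_eq_abs, abs_of_nonpos (by linarith)]
  rcases le_total z 1 with h | h
  · rw [min_eq_left h]; nlinarith
  · rw [min_eq_right h]; nlinarith

section
variable {ν : Measure ℝ}

lemma exp_int (hI : Integrable (fun z : ℝ => min z 1) (ν.restrict (Ioi 0))) {v : ℝ} (hv : v ≤ 0) :
    Integrable (fun z => Real.exp (z * v) - 1) (ν.restrict (Ioi 0)) := by
  refine Integrable.mono' (hI.const_mul (1 - v)) (by fun_prop) ?_
  filter_upwards [ae_restrict_mem measurableSet_Ioi] with z hz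
  exact exp_bound hz hv le_rfl

lemma jG_cont (hI : Integrable (fun z : ℝ => min z 1) (ν.restrict (Ioi 0))) (w : ℝ) :
    ContinuousOn (jG ν) (Icc w 0) := by
  unfold jG
  apply continuousOn_of_dominated (bound := fun z => (1 - w) * min z 1)
  · intro v _; fun_prop
  · intro v hv
    filter_upwards [ae_restrict_mem measurableSet_Ioi] with z hz
    exact exp_bound hz hv.2 hv.1
  · exact hI.const_mul _
  · filter_upwards with z
    fun_prop

lemma Gpsi_cont (hI : Integrable (fun z : ℝ => min z 1) (ν.restrict (Ioi 0))) {b σ u : ℝ}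
    (hb : 0 < b) (hu : u ≤ 0) :
    ContinuousOn (fun s => jG ν (psi b σ s u)) (Ici 0) :=
  (jG_cont hI u).comp (psi_cont hb hu) fun _ ht => ⟨psi_ge hb ht hu, psi_nonpos hb ht hu⟩

lemma Gpsi_ii (hI : Integrable (fun z : ℝ => min z 1) (ν.restrict (Ioi 0))) {b σ u : ℝ}
    (hb : 0 < b) (hu : u ≤ 0) {s t : ℝ} (hs : 0 ≤ s) (hst : s ≤ t) :
    IntervalIntegrable (fun s => jG ν (psi b σ s u)) volume s t := by
  apply ContinuousOn.intervalIntegrable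
  rw [uIcc_of_le hst]
  exact (Gpsi_cont hI hb hu).mono fun x hx => hs.trans hx.1

/-- the kernel factor -/
noncomputable def jK (ν : Measure ℝ) (a b σ t u : ℝ) : ℝ :=
  jD b σ t u ^ (-(2 * a / σ ^ 2)) * Real.exp (∫ s in (0:ℝ)..t, jG ν (psi b σ s u))

lemma jK_add (hI : Integrable (fun z : ℝ => min z 1) (ν.restrict (Ioi 0))) {a b σ t h u : ℝ}
    (hb : 0 < b) (ht : 0 ≤ t) (hh : 0 ≤ h) (hu : u ≤ 0) :
    jK ν a b σ (t + h) u = jK ν a b σ t (psi b σ h u) * jK ν a b σ h u := by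
  have h1 := jD_ge (σ := σ) hb hh hu
  have h4 := jD_ge (σ := σ) hb ht (psi_nonpos (σ := σ) hb hh hu)
  unfold jK
  rw [jD_mul hb hh hu, Real.mul_rpow (by linarith) (by linarith)]
  have e : ∫ s in (0:ℝ)..(t+h), jG ν (psi b σ s u) =
      (∫ s in (0:ℝ)..t, jG ν (psi b σ s (psi b σ h u))) + ∫ s in (0:ℝ)..h, jG ν (psi b σ s u) := by
    rw [← intervalIntegral.integral_add_adjacent_intervals (b := h)
      (Gpsi_ii hI hb hu le_rfl hh) (Gpsi_ii hI hb hu hh (by linarith)), add_comm]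
    congr 1
    have : ∫ s in h..(t+h), jG ν (psi b σ s u) = ∫ s in (0:ℝ)..t, jG ν (psi b σ (s + h) u) := by
      rw [intervalIntegral.integral_comp_add_right (fun s => jG ν (psi b σ s u))]
      simp
    rw [this]
    apply intervalIntegral.integral_congr
    intro s hs
    rw [uIcc_of_le ht] at hs
    simp only
    rw [psi_add hb hs.1 hh hu]
  rw [e, Real.exp_add]
  ring

lemma jK_deriv (hI : Integrable (fun z : ℝ => min z 1) (ν.restrict (Ioi 0))) {a b σ u : ℝ}
    (hb : 0 < b) (hσ : 0 < σ) (hu : u ≤ 0) :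
    HasDerivWithinAt (fun h => jK ν a b σ h u) (a * u + jG ν u) (Ici 0) 0 := by
  unfold jK
  have h0 : jD b σ 0 u = 1 := by simp [jD]
  have p0 : psi b σ 0 u = u := by simp [psi]
  have h1 : HasDerivWithinAt (fun h => ∫ s in (0:ℝ)..h, jG ν (psi b σ s u)) (jG ν u) (Ici 0) 0 := by
    have hc := Gpsi_cont (σ := σ) hI hb hu
    have := intervalIntegral.integral_hasDerivWithinAt_right (a := 0) (b := 0)
      (f := fun s => jG ν (psi b σ s u)) (by simp) (s := Ici 0) (t := Ioi 0)
      (⟨Ioi 0, self_mem_nhdsWithin, (hc.mono Ioi_subset_Ici_self).aestronglyMeasurable measurableSet_Ioi⟩)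
      ((hc 0 self_mem_Ici).mono Ioi_subset_Ici_self)
    simpa [p0] using this
  have h2 := (jD_hasDeriv b σ u 0 hb).rpow_const (p := -(2 * a / σ ^ 2)) (Or.inl (by rw [h0]; norm_num))
  refine (h2.hasDerivWithinAt.mul h1.exp).congr_deriv ?_
  simp [h0]
  field_simp
end

section
variable {ν : Measure ℝ}

lemma m_int {m : Measure ℝ} [IsProbabilityMeasure m] (hs : ∀ᵐ y ∂m, 0 ≤ y) {u : ℝ} (hu : u ≤ 0) :
    Integrable (fun y => Real.exp (u * y)) m := by
  refine Integrable.mono' (integrable_const 1) (by fun_prop) ?_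
  filter_upwards [hs] with y hy
  rw [Real.norm_eq_abs, abs_of_pos (Real.exp_pos _)]
  exact Real.exp_le_one_iff.2 (by nlinarith)

lemma m_interior {m : Measure ℝ} [IsProbabilityMeasure m] (hs : ∀ᵐ y ∂m, 0 ≤ y) {u : ℝ} (hu : u < 0) :
    u ∈ interior (ProbabilityTheory.integrableExpSet (fun y : ℝ => y) m) := by
  rw [mem_interior]
  exact ⟨Iio 0, fun v hv => m_int hs (le_of_lt hv), isOpen_Iio, hu⟩

lemma b1_int {m : Measure ℝ} [IsProbabilityMeasure m] (hs : ∀ᵐ y ∂m, 0 ≤ y) {u : ℝ} (hu : u < 0) :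
    Integrable (fun y => y * Real.exp (u * y)) m := by
  simpa using ProbabilityTheory.integrable_pow_mul_exp_of_mem_interior_integrableExpSet
    (m_interior hs hu) 1

lemma b1 (hI : Integrable (fun z : ℝ => min z 1) (ν.restrict (Ioi 0))) {a b σ x T : ℝ}
    (hb : 0 < b) (hσ : 0 < σ) {m : ℝ → Measure ℝ} (hm : ∀ t, IsProbabilityMeasure (m t))
    (hs : ∀ t, ∀ᵐ y ∂(m t), 0 ≤ y)
    (hF : ∀ t ∈ Icc 0 T, ∀ u : ℝ, u ≤ 0 → ∫ y, Real.exp (u * y) ∂(m t) =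
      jK ν a b σ t u * Real.exp (x * psi b σ t u)) {u : ℝ} (hu : u ≤ 0) {t : ℝ} (ht : t ∈ Ico 0 T) :
    HasDerivWithinAt (fun t => ∫ y, Real.exp (u * y) ∂(m t))
      (∫ y, (a * u + jG ν u + (-b * u + σ ^ 2 / 2 * u ^ 2) * y) * Real.exp (u * y) ∂(m t)) (Ici t) t
    ∧ Integrable (fun y => (a * u + jG ν u + (-b * u + σ ^ 2 / 2 * u ^ 2) * y) * Real.exp (u * y)) (m t)
    := by
  have := hm
  rcases hu.eq_or_lt with rfl | hu'
  · have h0 : jG ν 0 = 0 := by simp [jG]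
    simp [h0, hasDerivWithinAt_const]
  have i1 := (m_int (hs t) hu).const_mul (a * u + jG ν u)
  have i2 := (b1_int (hs t) hu').const_mul (-b * u + σ ^ 2 / 2 * u ^ 2)
  have e : (fun y => (a * u + jG ν u + (-b * u + σ ^ 2 / 2 * u ^ 2) * y) * Real.exp (u * y)) =
      fun y => (a * u + jG ν u) * Real.exp (u * y) +
        (-b * u + σ ^ 2 / 2 * u ^ 2) * (y * Real.exp (u * y)) := by
    ext y; ring
  rw [e]
  refine ⟨?_, i1.add i2⟩
  rw [integral_add i1 i2, integral_const_mul, integral_const_mul]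
  have p0 : psi b σ 0 u = u := by simp [psi]
  have k0 : jK ν a b σ 0 u = 1 := by simp [jK, jD]
  have d1 : HasDerivAt (fun w => ∫ y, Real.exp (w * y) ∂(m t)) (∫ y, y * Real.exp (u * y) ∂(m t)) u :=
    ProbabilityTheory.hasDerivAt_mgf (m_interior (hs t) hu')
  have d2 : HasDerivAt (fun h => ∫ y, Real.exp (psi b σ h u * y) ∂(m t))
      ((∫ y, y * Real.exp (u * y) ∂(m t)) * (-b * u + σ ^ 2 / 2 * u ^ 2)) 0 := by
    have d1' := d1
    rw [← p0] at d1'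
    have := HasDerivAt.comp 0 d1' (psi_hasDeriv_zero b σ u hb)
    rw [p0] at this
    exact this
  have d3 := d2.hasDerivWithinAt.mul (jK_deriv (a := a) hI hb hσ hu)
  have d4 : HasDerivWithinAt (fun s => s - t) 1 (Ici t) t := (hasDerivWithinAt_id _ _).sub_const t
  have d3' := d3
  rw [← sub_self t] at d3'
  have d5 := HasDerivWithinAt.comp (h := fun s => s - t) t d3' d4 (fun s hs => by simpa using hs)
  simp only [sub_self, p0, k0] at d5
  refine (d5.congr_of_eventuallyEq (f₁ := fun t => ∫ y, Real.exp (u * y) ∂(m t)) ?_ ?_).congr_deriv ?_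
  · have : Icc t T ∈ nhdsWithin t (Ici t) := Icc_mem_nhdsGE ht.2
    filter_upwards [this] with s hs'
    have hh : 0 ≤ s - t := by linarith [hs'.1]
    have hs0 : s = t + (s - t) := by ring
    simp only [Function.comp, Pi.mul_apply]
    rw [hF s ⟨ht.1.trans hs'.1, hs'.2⟩ u hu, hF t ⟨ht.1, ht.2.le⟩ _ (psi_nonpos hb hh hu),
      ← psi_add hb ht.1 hh hu, ← hs0]
    nth_rw 1 [hs0]
    rw [jK_add hI hb ht.1 hh hu]
    ring
  · simp [p0, k0]
  · ring

lemma b2 (hI : Integrable (fun z : ℝ => min z 1) (ν.restrict (Ioi 0))) {a b σ x T : ℝ}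
    (hb : 0 < b) (hT : 0 ≤ T) {m : ℝ → Measure ℝ}
    (hF : ∀ t ∈ Icc 0 T, ∀ u : ℝ, u ≤ 0 → ∫ y, Real.exp (u * y) ∂(m t) =
      jK ν a b σ t u * Real.exp (x * psi b σ t u)) {u : ℝ} (hu : u ≤ 0) :
    ContinuousOn (fun t => ∫ y, Real.exp (u * y) ∂(m t)) (Icc 0 T) := by
  have hsub : Icc 0 T ⊆ Ici (0:ℝ) := fun t h => h.1
  have h1 : ContinuousOn (fun t => jK ν a b σ t u * Real.exp (x * psi b σ t u)) (Icc 0 T) := by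
    unfold jK
    refine ContinuousOn.mul (ContinuousOn.mul ?_ ?_) ?_
    · apply ContinuousOn.rpow_const
      · exact fun t _ => (jD_hasDeriv b σ u t hb).continuousAt.continuousWithinAt
      · intro t ht
        have := jD_ge (σ := σ) hb ht.1 hu
        left; linarith
    · apply ContinuousOn.rexp
      have := intervalIntegral.continuousOn_primitive_interval (a := 0) (b := T) (μ := volume)
        (f := fun s => jG ν (psi b σ s u)) (by
          rw [uIcc_of_le hT]
          exact ((Gpsi_cont hI hb hu).mono hsub).integrableOn_Icc)
      rwa [uIcc_of_le hT] at this
    · exact (((psi_cont hb hu).mono hsub).const_mul x).rexp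
  exact h1.congr fun t ht => hF t ht u hu

/-- generator applied to `P (exp (-ε y))` -/
noncomputable def jB (ν : Measure ℝ) (a b σ ε : ℝ) (P : Polynomial ℝ) (y : ℝ) : ℝ :=
  (a - b * y) * (-ε * Real.exp (-ε * y) * P.derivative.eval (Real.exp (-ε * y))) +
  σ ^ 2 / 2 * y * ε ^ 2 * (Real.exp (-ε * y) * P.derivative.eval (Real.exp (-ε * y)) +
    Real.exp (-ε * y) ^ 2 * P.derivative.derivative.eval (Real.exp (-ε * y))) +
  ∫ z in Ioi (0:ℝ), (P.eval (Real.exp (-ε * y) * Real.exp (-ε * z)) - P.eval (Real.exp (-ε * y))) ∂ν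

lemma jump_mono_eq (ε v : ℝ) (c : ℝ) (k : ℕ) (z : ℝ) :
    ((Polynomial.monomial k c).eval (v * Real.exp (-ε * z)) - (Polynomial.monomial k c).eval v) =
    c * v ^ k * (Real.exp (z * (-(k * ε))) - 1) := by
  simp only [Polynomial.eval_monomial, mul_pow, ← Real.exp_nat_mul]
  ring_nf

lemma jump_int (hI : Integrable (fun z : ℝ => min z 1) (ν.restrict (Ioi 0))) {ε : ℝ} (hε : 0 < ε)
    (P : Polynomial ℝ) (v : ℝ) :
    Integrable (fun z => P.eval (v * Real.exp (-ε * z)) - P.eval v) (ν.restrict (Ioi 0)) := by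
  induction P using Polynomial.induction_on' with
  | add p q hp hq =>
    convert! hp.add hq using 1
    ext z; simp; ring
  | monomial k c =>
    simp_rw [jump_mono_eq]
    exact (exp_int hI (by simp; positivity)).const_mul _

lemma jB_add (hI : Integrable (fun z : ℝ => min z 1) (ν.restrict (Ioi 0))) {a b σ ε : ℝ} (hε : 0 < ε)
    (P Q : Polynomial ℝ) : jB ν a b σ ε (P + Q) = jB ν a b σ ε P + jB ν a b σ ε Q := by
  ext y
  have := integral_add (jump_int hI hε P (Real.exp (-ε * y))) (jump_int hI hε Q (Real.exp (-ε * y)))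
  simp only [jB, Pi.add_apply]
  have e : ∫ z in Ioi (0:ℝ), ((P+Q).eval (Real.exp (-ε * y) * Real.exp (-ε * z)) - (P+Q).eval (Real.exp (-ε * y))) ∂ν
     = ∫ z in Ioi (0:ℝ), ((P.eval (Real.exp (-ε * y) * Real.exp (-ε * z)) - P.eval (Real.exp (-ε * y))) + (Q.eval (Real.exp (-ε * y) * Real.exp (-ε * z)) - Q.eval (Real.exp (-ε * y)))) ∂ν := by
    congr 1; ext z; simp; ring
  rw [e, this]
  simp only [Polynomial.derivative_add, Polynomial.eval_add]
  ring

lemma jB_monomial {a b σ ε : ℝ} (k : ℕ) (c : ℝ) (y : ℝ) :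
    jB ν a b σ ε (Polynomial.monomial k c) y =
    c * ((a * (-(k * ε)) + jG ν (-(k * ε)) + (-b * (-(k * ε)) + σ ^ 2 / 2 * (-(k * ε)) ^ 2) * y) *
      Real.exp (-(k * ε) * y)) := by
  unfold jB
  simp_rw [jump_mono_eq]
  rw [integral_const_mul]
  change _ + _ * jG ν _ = _
  have e : Real.exp (-(k * ε) * y) = Real.exp (-ε * y) ^ k := by
    rw [← Real.exp_nat_mul]; ring_nf
  rw [e]
  generalize Real.exp (-ε * y) = v
  generalize jG ν (-(k * ε)) = g
  rcases k with _ | _ | k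
  · simp
  · simp; ring
  · simp; ring

lemma P_int {m : Measure ℝ} [IsProbabilityMeasure m] (hs : ∀ᵐ y ∂m, 0 ≤ y) {ε : ℝ} (hε : 0 < ε)
    (P : Polynomial ℝ) : Integrable (fun y => P.eval (Real.exp (-ε * y))) m := by
  induction P using Polynomial.induction_on' with
  | add p q hp hq =>
    convert! hp.add hq using 1
    ext z; simp
  | monomial k c =>
    have e : ∀ y, Real.exp (-ε * y) ^ k = Real.exp (-(k * ε) * y) := by
      intro y
      rw [← Real.exp_nat_mul]; ring_nf
    simp only [Polynomial.eval_monomial, e]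
    exact (m_int hs (by simp; positivity)).const_mul _

lemma b3 (hI : Integrable (fun z : ℝ => min z 1) (ν.restrict (Ioi 0))) {a b σ x T : ℝ}
    (hb : 0 < b) (hσ : 0 < σ) (hT : 0 ≤ T)
    {m : ℝ → Measure ℝ} (hm : ∀ t, IsProbabilityMeasure (m t))
    (hs : ∀ t, ∀ᵐ y ∂(m t), 0 ≤ y)
    (hF : ∀ t ∈ Icc 0 T, ∀ u : ℝ, u ≤ 0 → ∫ y, Real.exp (u * y) ∂(m t) =
      jK ν a b σ t u * Real.exp (x * psi b σ t u)) {ε : ℝ} (hε : 0 < ε) (P : Polynomial ℝ) :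
    ContinuousOn (fun t => ∫ y, P.eval (Real.exp (-ε * y)) ∂(m t)) (Icc 0 T) ∧
    ∀ t ∈ Ico 0 T,
    HasDerivWithinAt (fun t => ∫ y, P.eval (Real.exp (-ε * y)) ∂(m t))
      (∫ y, jB ν a b σ ε P y ∂(m t)) (Ici t) t ∧ Integrable (jB ν a b σ ε P) (m t) := by
  induction P using Polynomial.induction_on' with
  | add p q hp hq =>
    have e : (fun t => ∫ y, (p + q).eval (Real.exp (-ε * y)) ∂(m t)) =
      fun t => (∫ y, p.eval (Real.exp (-ε * y)) ∂(m t)) + ∫ y, q.eval (Real.exp (-ε * y)) ∂(m t) := by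
      ext t
      have := hm t
      rw [← integral_add (P_int (hs t) hε p) (P_int (hs t) hε q)]
      simp
    rw [e, jB_add hI hε]
    refine ⟨hp.1.add hq.1, fun t ht => ?_⟩
    obtain ⟨h1, h2⟩ := hp.2 t ht
    obtain ⟨h3, h4⟩ := hq.2 t ht
    refine ⟨?_, h2.add h4⟩
    simp only [Pi.add_apply]
    rw [integral_add h2 h4]
    exact h1.add h3
  | monomial k c =>
    have hk : -(k * ε) ≤ 0 := by simp; positivity
    have e : (fun t => ∫ y, (Polynomial.monomial k c).eval (Real.exp (-ε * y)) ∂(m t)) =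
        fun t => c * ∫ y, Real.exp (-(k * ε) * y) ∂(m t) := by
      ext t
      rw [← integral_const_mul]
      congr 1; ext y
      rw [Polynomial.eval_monomial, ← Real.exp_nat_mul]; ring_nf
    rw [e]
    refine ⟨(b2 hI hb hT hF hk).const_mul c, fun t ht => ?_⟩
    obtain ⟨h1, h2⟩ := b1 hI hb hσ hm hs hF hk ht
    have e2 : jB ν a b σ ε (Polynomial.monomial k c) = _ := funext (jB_monomial k c)
    rw [e2, integral_const_mul]
    exact ⟨h1.const_mul c, h2.const_mul c⟩
end

lemma poly_anti (Q : Polynomial ℝ) : ∃ P : Polynomial ℝ, P.derivative = Q := by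
  induction Q using Polynomial.induction_on' with
  | add p q hp hq =>
    obtain ⟨p', rfl⟩ := hp
    obtain ⟨q', rfl⟩ := hq
    exact ⟨p' + q', by simp⟩
  | monomial k c =>
    refine ⟨Polynomial.monomial (k + 1) (c / (k + 1)), ?_⟩
    rw [Polynomial.derivative_monomial]
    congr 1
    push_cast
    field_simp

lemma poly_anti_near {f f' : ℝ → ℝ} (hf : ∀ v ∈ Icc (0:ℝ) 1, HasDerivAt f (f' v) v) {δ : ℝ}
    (Q : Polynomial ℝ) (hQ : ∀ v ∈ Icc (0:ℝ) 1, |Q.eval v - f' v| ≤ δ) :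
    ∃ P : Polynomial ℝ, P.derivative = Q ∧ ∀ v ∈ Icc (0:ℝ) 1, |P.eval v - f v| ≤ δ := by
  obtain ⟨P, hP⟩ := poly_anti Q
  refine ⟨P + Polynomial.C (f 0 - P.eval 0), by simp [hP], fun v hv => ?_⟩
  have h := Convex.norm_image_sub_le_of_norm_hasDerivWithin_le (s := Icc (0:ℝ) 1) (x := 0) (y := v) (C := δ)
    (f := fun v => P.eval v - f v) (f' := fun v => Q.eval v - f' v)
    (fun w hw => by
      have := ((P.hasDerivAt w).sub (hf w hw)).hasDerivWithinAt (s := Icc (0:ℝ) 1)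
      rw [hP] at this
      exact this)
    hQ (convex_Icc 0 1) (by simp) hv
  simp only [Real.norm_eq_abs, sub_zero] at h
  rw [abs_of_nonneg hv.1] at h
  have hδ : 0 ≤ δ := (abs_nonneg _).trans (hQ v hv)
  have : (P + Polynomial.C (f 0 - P.eval 0)).eval v - f v = P.eval v - f v - (P.eval 0 - f 0) := by
    simp; ring
  rw [this]
  nlinarith [hv.2]

lemma poly_near {f f' f'' : ℝ → ℝ} (hf : ∀ v ∈ Icc (0:ℝ) 1, HasDerivAt f (f' v) v)
    (hf' : ∀ v ∈ Icc (0:ℝ) 1, HasDerivAt f' (f'' v) v) (hc : ContinuousOn f'' (Icc 0 1))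
    {δ : ℝ} (hδ : 0 < δ) : ∃ P : Polynomial ℝ, ∀ v ∈ Icc (0:ℝ) 1, |P.eval v - f v| ≤ δ ∧
      |P.derivative.eval v - f' v| ≤ δ ∧ |P.derivative.derivative.eval v - f'' v| ≤ δ := by
  obtain ⟨Q, hQ⟩ := exists_polynomial_near_of_continuousOn 0 1 f'' hc δ hδ
  obtain ⟨P1, rfl, h1⟩ := poly_anti_near hf' Q (fun v hv => (hQ v hv).le)
  obtain ⟨P, rfl, h2⟩ := poly_anti_near hf P1 h1
  exact ⟨P, fun v hv => ⟨h2 v hv, h1 v hv, (hQ v hv).le⟩⟩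

noncomputable def jS (ε v : ℝ) : ℝ := 1 + (1 - v) / ε

lemma jS_ge {ε v : ℝ} (hε : 0 < ε) (hv : v ≤ 1) : 1 ≤ jS ε v := by
  unfold jS
  have : 0 ≤ (1 - v) / ε := div_nonneg (by linarith) hε.le
  linarith

lemma jS_deriv (ε v : ℝ) : HasDerivAt (jS ε) (-(1 / ε)) v := by
  unfold jS
  refine ((((hasDerivAt_id v).const_sub 1).div_const ε).const_add 1).congr_deriv ?_
  ring

lemma jS_pow_deriv {ε v : ℝ} (hε : 0 < ε) (hv : v ≤ 1) (p : ℝ) :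
    HasDerivAt (fun v => jS ε v ^ p) (-(p / ε) * jS ε v ^ (p - 1)) v := by
  have := jS_ge hε hv
  refine ((jS_deriv ε v).rpow_const (p := p) (Or.inl (by linarith))).congr_deriv ?_
  ring

lemma jS_poly {ε : ℝ} (hε : 0 < ε) (κ : ℝ) {δ : ℝ} (hδ : 0 < δ) :
    ∃ P : Polynomial ℝ, ∀ v ∈ Icc (0:ℝ) 1, |P.eval v - jS ε v ^ κ| ≤ δ ∧
      |P.derivative.eval v - (-(κ / ε) * jS ε v ^ (κ - 1))| ≤ δ ∧
      |P.derivative.derivative.eval v - (κ * (κ - 1) / ε ^ 2 * jS ε v ^ (κ - 2))| ≤ δ := by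
  refine poly_near (fun v hv => jS_pow_deriv hε hv.2 κ) (fun v hv => ?_) ?_ hδ
  · refine ((jS_pow_deriv hε hv.2 (κ - 1)).const_mul _).congr_deriv ?_
    rw [show κ - 1 - 1 = κ - 2 by ring]
    field_simp
  · intro v hv
    exact ((jS_pow_deriv hε hv.2 (κ - 2)).continuousAt.continuousWithinAt).const_mul _

lemma jump_bound {ν : Measure ℝ} (hI : Integrable (fun z : ℝ => min z 1) (ν.restrict (Ioi 0)))
    {κ : ℝ} (hκ : 0 < κ)
    (hJ : Integrable (fun z : ℝ => (1 + z) ^ κ - 1) (ν.restrict (Ioi 0))) {ε δ : ℝ} (hε : 0 < ε)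
    (P : Polynomial ℝ)
    (hP0 : ∀ v ∈ Icc (0:ℝ) 1, |P.derivative.eval v - (-(κ / ε) * jS ε v ^ (κ - 1))| ≤ δ)
    {v : ℝ} (hv : v ∈ Icc (0:ℝ) 1) :
    ∫ z in Ioi (0:ℝ), (P.eval (v * Real.exp (-ε * z)) - P.eval v) ∂ν ≤
      jS ε v ^ κ * (∫ z in Ioi (0:ℝ), ((1 + z) ^ κ - 1) ∂ν) + δ * (-jG ν (-ε)) := by
  have i2 := exp_int hI (v := -ε) (by linarith)
  have e : jS ε v ^ κ * (∫ z in Ioi (0:ℝ), ((1 + z) ^ κ - 1) ∂ν) + δ * (-jG ν (-ε)) =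
      ∫ z in Ioi (0:ℝ), (jS ε v ^ κ * ((1 + z) ^ κ - 1) + (-δ) * (Real.exp (z * -ε) - 1)) ∂ν := by
    rw [integral_add (hJ.const_mul _) (i2.const_mul _), integral_const_mul, integral_const_mul, jG]
    ring
  rw [e]
  refine integral_mono_ae (jump_int hI hε P v) ((hJ.const_mul _).add (i2.const_mul _)) ?_
  filter_upwards [ae_restrict_mem measurableSet_Ioi] with z hz
  have hz : 0 < z := hz
  have hw1 : Real.exp (-ε * z) ≤ 1 := Real.exp_le_one_iff.2 (by nlinarith)
  have hw0 := Real.exp_pos (-ε * z)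
  have hw2 := Real.add_one_le_exp (-ε * z)
  have hzz : z * -ε = -ε * z := by ring
  simp only [hzz]
  set w := Real.exp (-ε * z)
  have hvw : v * w ∈ Icc (0:ℝ) 1 := ⟨mul_nonneg hv.1 hw0.le, by nlinarith [hv.1, hv.2]⟩
  have hδ : 0 ≤ δ := (abs_nonneg _).trans (hP0 v hv)
  have h := Convex.norm_image_sub_le_of_norm_hasDerivWithin_le (s := Icc (0:ℝ) 1) (x := v) (y := v * w) (C := δ)
    (f := fun v => P.eval v - jS ε v ^ κ)
    (f' := fun v => P.derivative.eval v - (-(κ / ε) * jS ε v ^ (κ - 1)))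
    (fun w hw => ((P.hasDerivAt w).sub (jS_pow_deriv hε hw.2 κ)).hasDerivWithinAt)
    hP0 (convex_Icc 0 1) hv hvw
  simp only [Real.norm_eq_abs] at h
  have h1 : |v * w - v| ≤ 1 - w := by
    rw [abs_of_nonpos (by nlinarith [hv.1])]
    nlinarith [hv.1, hv.2]
  have h2 : δ * |v * w - v| ≤ δ * (1 - w) := mul_le_mul_of_nonneg_left h1 hδ
  have h3 := (le_abs_self _).trans (h.trans h2)
  have hs := jS_ge hε hv.2
  have h4 : jS ε (v * w) ≤ jS ε v * (1 + z) := by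
    have : jS ε (v * w) ≤ jS ε v + z := by
      unfold jS
      have : (1 - v * w) / ε ≤ (1 - v) / ε + z := by
        rw [div_add' _ _ _ hε.ne']
        apply div_le_div_of_nonneg_right _ hε.le
        nlinarith [hv.1, hv.2]
      linarith
    nlinarith
  have h5 : jS ε (v * w) ^ κ ≤ jS ε v ^ κ * (1 + z) ^ κ := by
    rw [← Real.mul_rpow (by linarith) (by linarith)]
    exact Real.rpow_le_rpow (by linarith [jS_ge hε hvw.2]) h4 hκ.le
  linarith

set_option maxHeartbeats 2000000 in
lemma jB_bound {ν : Measure ℝ} (hI : Integrable (fun z : ℝ => min z 1) (ν.restrict (Ioi 0)))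
    {κ : ℝ} (hκ : 0 < κ)
    (hJ : Integrable (fun z : ℝ => (1 + z) ^ κ - 1) (ν.restrict (Ioi 0))) {ε δ : ℝ} (hε : 0 < ε)
    {a b σ : ℝ} (ha : 0 ≤ a) (hb : 0 < b)
    (P : Polynomial ℝ)
    (hP : ∀ v ∈ Icc (0:ℝ) 1, |P.eval v - jS ε v ^ κ| ≤ δ ∧
      |P.derivative.eval v - (-(κ / ε) * jS ε v ^ (κ - 1))| ≤ δ ∧
      |P.derivative.derivative.eval v - (κ * (κ - 1) / ε ^ 2 * jS ε v ^ (κ - 2))| ≤ δ)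
    {y : ℝ} (hy : 0 ≤ y) :
    jB ν a b σ ε P y ≤ (a * κ + σ ^ 2 / 2 * (κ * |κ - 1|) + ∫ z in Ioi (0:ℝ), ((1 + z) ^ κ - 1) ∂ν) *
      jS ε (Real.exp (-ε * y)) ^ κ + δ * (a * ε + b + σ ^ 2 * ε + (-jG ν (-ε))) := by
  unfold jB
  have hv0 := Real.exp_pos (-ε * y)
  have hv1 : Real.exp (-ε * y) ≤ 1 := Real.exp_le_one_iff.2 (by nlinarith)
  have hyv : ε * y * Real.exp (-ε * y) ≤ 1 - Real.exp (-ε * y) := by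
    have h1 := Real.add_one_le_exp (ε * y)
    have h2 : Real.exp (ε * y) * Real.exp (-ε * y) = 1 := by
      rw [← Real.exp_add]; simp
    nlinarith
  set v := Real.exp (-ε * y)
  have hv : v ∈ Icc (0:ℝ) 1 := ⟨hv0.le, hv1⟩
  have hjump := jump_bound hI hκ hJ hε P (fun v hv => (hP v hv).2.1) hv
  obtain ⟨-, h1, h2⟩ := hP v hv
  have hs := jS_ge hε hv1
  have hS : jS ε v = 1 + (1 - v) / ε := rfl
  have hδ : 0 ≤ δ := (abs_nonneg _).trans h1
  set s := jS ε v
  set p1 := P.derivative.eval v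
  set p2 := P.derivative.derivative.eval v
  obtain ⟨h1a, h1b⟩ := abs_le.1 h1
  have h2b := (le_abs_self _).trans h2
  have hk1 : s ^ (κ - 1) ≤ s ^ κ := Real.rpow_le_rpow_of_exponent_le hs (by linarith)
  have hk1p : 0 ≤ s ^ (κ - 1) := Real.rpow_nonneg (by linarith) _
  have hk2p : 0 ≤ s ^ (κ - 2) := Real.rpow_nonneg (by linarith) _
  have hk2 : s ^ (κ - 2) * s = s ^ (κ - 1) := by
    rw [← Real.rpow_add_one (by linarith)]; ring_nf
  -- term 1
  have t1 : a * (-ε * v * p1) ≤ a * κ * s ^ κ + δ * (a * ε) := by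
    have : -ε * v * p1 ≤ κ * s ^ κ + δ * ε := by
      have q : -p1 ≤ κ / ε * s ^ (κ - 1) + δ := by linarith
      have q2 : ε * v * (-p1) ≤ ε * v * (κ / ε * s ^ (κ - 1) + δ) :=
        mul_le_mul_of_nonneg_left q (by positivity)
      have q3 : ε * v * (κ / ε * s ^ (κ - 1) + δ) = v * (κ * s ^ (κ - 1) + δ * ε) := by
        field_simp
      have q4 : v * (κ * s ^ (κ - 1) + δ * ε) ≤ 1 * (κ * s ^ (κ - 1) + δ * ε) :=
        mul_le_mul_of_nonneg_right hv1 (by positivity)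
      nlinarith
    nlinarith
  have hp1 : p1 ≤ δ := by
    have : 0 ≤ κ / ε * s ^ (κ - 1) := by positivity
    linarith
  have hyv0 : 0 ≤ ε * y * v := by positivity
  have t2 : (-(b * y)) * (-ε * v * p1) ≤ δ * b := by
    have : (-(b * y)) * (-ε * v * p1) = b * ((ε * y * v) * p1) := by ring
    rw [this]
    have : (ε * y * v) * p1 ≤ δ := by nlinarith
    nlinarith
  have t3 : σ ^ 2 / 2 * y * ε ^ 2 * (v * p1) ≤ σ ^ 2 / 2 * (δ * ε) := by
    have : σ ^ 2 / 2 * y * ε ^ 2 * (v * p1) = σ ^ 2 / 2 * (ε * ((ε * y * v) * p1)) := by ring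
    rw [this]
    have : (ε * y * v) * p1 ≤ δ := by nlinarith
    have : ε * ((ε * y * v) * p1) ≤ δ * ε := by nlinarith
    exact mul_le_mul_of_nonneg_left this (by positivity)
  have t4 : σ ^ 2 / 2 * y * ε ^ 2 * (v ^ 2 * p2) ≤ σ ^ 2 / 2 * (κ * |κ - 1| * s ^ κ + δ * ε) := by
    have e : σ ^ 2 / 2 * y * ε ^ 2 * (v ^ 2 * p2) = σ ^ 2 / 2 * (y * v ^ 2 * (ε ^ 2 * p2)) := by ring
    rw [e]
    refine mul_le_mul_of_nonneg_left ?_ (by positivity)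
    have q1 : ε ^ 2 * p2 ≤ κ * |κ - 1| * s ^ (κ - 2) + ε ^ 2 * δ := by
      have a1 : p2 ≤ κ * (κ - 1) / ε ^ 2 * s ^ (κ - 2) + δ := by linarith
      have a2 : ε ^ 2 * p2 ≤ ε ^ 2 * (κ * (κ - 1) / ε ^ 2 * s ^ (κ - 2) + δ) :=
        mul_le_mul_of_nonneg_left a1 (by positivity)
      have a3 : ε ^ 2 * (κ * (κ - 1) / ε ^ 2 * s ^ (κ - 2) + δ) =
          κ * (κ - 1) * s ^ (κ - 2) + ε ^ 2 * δ := by field_simp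
      have a4 : κ * (κ - 1) * s ^ (κ - 2) ≤ κ * |κ - 1| * s ^ (κ - 2) := by
        gcongr
        exact le_abs_self _
      linarith
    have q2 : y * v ^ 2 * (ε ^ 2 * p2) ≤ y * v ^ 2 * (κ * |κ - 1| * s ^ (κ - 2) + ε ^ 2 * δ) :=
      mul_le_mul_of_nonneg_left q1 (by positivity)
    have q3 : y * v ^ 2 ≤ s := by
      have b1 : y * v ≤ (1 - v) / ε := by
        rw [le_div_iff₀ hε]; linarith
      have : 0 ≤ y * v := by positivity
      nlinarith
    have q4 : y * v ^ 2 * ε ≤ 1 := by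
      have c1 : (ε * y * v) * v ≤ 1 * 1 := mul_le_mul (by linarith) hv1 hv0.le zero_le_one
      linarith
    have q5 : y * v ^ 2 * s ^ (κ - 2) ≤ s ^ κ := by
      have := mul_le_mul_of_nonneg_right q3 hk2p
      linarith
    have q6 : κ * |κ - 1| * (y * v ^ 2 * s ^ (κ - 2)) ≤ κ * |κ - 1| * s ^ κ :=
      mul_le_mul_of_nonneg_left q5 (by positivity)
    have q7 : (δ * ε) * (y * v ^ 2 * ε) ≤ (δ * ε) * 1 := mul_le_mul_of_nonneg_left q4 (by positivity)
    linarith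
  linarith

lemma moment_eps {ν : Measure ℝ} (hI : Integrable (fun z : ℝ => min z 1) (ν.restrict (Ioi 0)))
    {a b σ x T κ : ℝ} (ha : 0 ≤ a) (hb : 0 < b) (hσ : 0 < σ) (hT : 0 ≤ T) (hx : 0 ≤ x) (hκ : 0 < κ)
    (hJ : Integrable (fun z : ℝ => (1 + z) ^ κ - 1) (ν.restrict (Ioi 0)))
    {m : ℝ → Measure ℝ} (hm : ∀ t, IsProbabilityMeasure (m t))
    (hs : ∀ t, ∀ᵐ y ∂(m t), 0 ≤ y) (hm0 : m 0 = Measure.dirac x)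
    (hF : ∀ t ∈ Icc 0 T, ∀ u : ℝ, u ≤ 0 → ∫ y, Real.exp (u * y) ∂(m t) =
      jK ν a b σ t u * Real.exp (x * psi b σ t u)) {ε : ℝ} (hε : 0 < ε) {t : ℝ} (ht : t ∈ Icc 0 T) :
    ∫⁻ y, ENNReal.ofReal (jS ε (Real.exp (-ε * y)) ^ κ) ∂(m t) ≤
      ENNReal.ofReal (((1 + x) ^ κ + 1) * Real.exp ((2 * (a * κ + σ ^ 2 / 2 * (κ * |κ - 1|) +
        ∫ z in Ioi (0:ℝ), ((1 + z) ^ κ - 1) ∂ν) + 2) * T) + 1) := by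
  have hJ0 : 0 ≤ ∫ z in Ioi (0:ℝ), ((1 + z) ^ κ - 1) ∂ν := by
    apply setIntegral_nonneg measurableSet_Ioi
    intro z hz
    have hz : 0 < z := hz
    have := Real.one_le_rpow (x := 1 + z) (by linarith) hκ.le
    linarith
  set C0 := a * κ + σ ^ 2 / 2 * (κ * |κ - 1|) + ∫ z in Ioi (0:ℝ), ((1 + z) ^ κ - 1) ∂ν with hC0
  have hC0p : 0 ≤ C0 := by positivity
  set A := a * ε + b + σ ^ 2 * ε + (-jG ν (-ε)) with hA
  have hδ : 0 < min (1 / 2) (1 / (|A| + 1)) := by positivity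
  obtain ⟨P, hP⟩ := jS_poly hε κ hδ
  set δ := min (1 / 2) (1 / (|A| + 1)) with hδd
  have hδ2 : δ ≤ 1 / 2 := min_le_left _ _
  have hδA : δ * A ≤ 1 := by
    have h1 : δ ≤ 1 / (|A| + 1) := min_le_right _ _
    rw [le_div_iff₀ (by positivity)] at h1
    nlinarith [le_abs_self A, mul_le_mul_of_nonneg_left (le_abs_self A) hδ.le]
  have hv : ∀ y : ℝ, 0 ≤ y → Real.exp (-ε * y) ∈ Icc (0:ℝ) 1 := fun y hy =>
    ⟨(Real.exp_pos _).le, Real.exp_le_one_iff.2 (by nlinarith)⟩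
  have hPφ : ∀ y : ℝ, 0 ≤ y → |P.eval (Real.exp (-ε * y)) - jS ε (Real.exp (-ε * y)) ^ κ| ≤ 1 / 2 :=
    fun y hy => (hP _ (hv y hy)).1.trans hδ2
  have hφ1 : ∀ y : ℝ, 0 ≤ y → 1 ≤ jS ε (Real.exp (-ε * y)) ^ κ := fun y hy =>
    Real.one_le_rpow (jS_ge hε (hv y hy).2) hκ.le
  have hBP : ∀ y : ℝ, 0 ≤ y → jB ν a b σ ε P y ≤ (2 * C0 + 2) * P.eval (Real.exp (-ε * y)) := by
    intro y hy
    have h1 : jB ν a b σ ε P y ≤ C0 * jS ε (Real.exp (-ε * y)) ^ κ + δ * A :=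
      jB_bound hI hκ hJ hε ha hb P hP hy
    obtain ⟨h2, h3⟩ := abs_le.1 (hPφ y hy)
    have h4 := hφ1 y hy
    have h5 : C0 * jS ε (Real.exp (-ε * y)) ^ κ ≤ C0 * (2 * P.eval (Real.exp (-ε * y))) :=
      mul_le_mul_of_nonneg_left (by linarith) hC0p
    linarith
  obtain ⟨hcont, hder⟩ := b3 hI hb hσ hT hm hs hF hε P
  have hinit : ∫ y, P.eval (Real.exp (-ε * y)) ∂(m 0) ≤ (1 + x) ^ κ + 1 := by
    rw [hm0, integral_dirac]
    obtain ⟨h2, h3⟩ := abs_le.1 (hPφ x hx)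
    have : jS ε (Real.exp (-ε * x)) ^ κ ≤ (1 + x) ^ κ := by
      refine Real.rpow_le_rpow (by linarith [jS_ge hε (hv x hx).2]) ?_ hκ.le
      unfold jS
      have : (1 - Real.exp (-ε * x)) / ε ≤ x := by
        rw [div_le_iff₀ hε]
        linarith [Real.add_one_le_exp (-ε * x)]
      linarith
    linarith
  have hg := le_gronwallBound_of_liminf_deriv_right_le (K := 2 * C0 + 2) (ε := 0) hcont
    (fun s hs' r hr => by
      simpa [slope, smul_eq_mul] using (hder s hs').1.liminf_right_slope_le hr) hinit
    (fun s hs' => by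
      have := hm s
      rw [add_zero, ← integral_const_mul]
      refine integral_mono_ae (hder s hs').2 ((P_int (hs s) hε P).const_mul _) ?_
      filter_upwards [hs s] with y hy
      exact hBP y hy) t ht
  rw [gronwallBound_ε0, sub_zero] at hg
  have := hm t
  have hx1 : 0 ≤ (1 + x) ^ κ := by positivity
  have hg2 : ∫ y, (P.eval (Real.exp (-ε * y)) + 1) ∂(m t) ≤
      ((1 + x) ^ κ + 1) * Real.exp ((2 * C0 + 2) * T) + 1 := by
    rw [integral_add (P_int (hs t) hε P) (integrable_const 1)]
    have : Real.exp ((2 * C0 + 2) * t) ≤ Real.exp ((2 * C0 + 2) * T) :=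
      Real.exp_le_exp.2 (mul_le_mul_of_nonneg_left ht.2 (by positivity))
    have := mul_le_mul_of_nonneg_left this (show 0 ≤ (1 + x) ^ κ + 1 by positivity)
    have e1 : ∫ _y : ℝ, (1:ℝ) ∂(m t) = 1 := by simp
    rw [e1]
    linarith
  refine le_trans ?_ (ENNReal.ofReal_le_ofReal hg2)
  rw [ofReal_integral_eq_lintegral_ofReal (f := fun y => P.eval (Real.exp (-ε * y)) + 1) ((P_int (hs t) hε P).add (integrable_const 1))]
  · apply lintegral_mono_ae
    filter_upwards [hs t] with y hy
    apply ENNReal.ofReal_le_ofReal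
    obtain ⟨h2, h3⟩ := abs_le.1 (hPφ y hy)
    linarith
  · filter_upwards [hs t] with y hy
    obtain ⟨h2, h3⟩ := abs_le.1 (hPφ y hy)
    have := hφ1 y hy
    simp only [Pi.zero_apply]
    linarith

lemma fatou_step {m : Measure ℝ} (hs : ∀ᵐ y ∂m, 0 ≤ y) {κ : ℝ} (hκ : 0 < κ) {C : ℝ≥0∞}
    (h : ∀ ε : ℝ, 0 < ε → ∫⁻ y, ENNReal.ofReal (jS ε (Real.exp (-ε * y)) ^ κ) ∂m ≤ C) :
    ∫⁻ y, ENNReal.ofReal (y ^ κ) ∂m ≤ C := by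
  have hlim : ∀ y : ℝ, Tendsto (fun n : ℕ => jS (1 / ((n:ℝ) + 1)) (Real.exp (-(1 / ((n:ℝ) + 1)) * y)))
      atTop (nhds (1 + y)) := by
    intro y
    have hd : HasDerivAt (fun ε : ℝ => Real.exp (-ε * y)) (-y) 0 := by
      have := (((hasDerivAt_id (0:ℝ)).neg).mul_const y).exp
      simpa using this
    have h1 := hd.tendsto_slope_zero
    have h2 : Tendsto (fun n : ℕ => 1 / ((n:ℝ) + 1)) atTop (nhdsWithin 0 {0}ᶜ) := by
      rw [tendsto_nhdsWithin_iff]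
      refine ⟨tendsto_one_div_add_atTop_nhds_zero_nat, Eventually.of_forall fun n => ?_⟩
      have : (1 / ((n:ℝ) + 1)) ≠ 0 := by positivity
      simpa using this
    have h3 := ((h1.comp h2).neg).const_add 1
    rw [neg_neg] at h3
    refine h3.congr fun n => ?_
    simp only [Function.comp, zero_add, smul_eq_mul, jS]
    simp
    ring
  calc ∫⁻ y, ENNReal.ofReal (y ^ κ) ∂m
      ≤ ∫⁻ y, liminf (fun n : ℕ => ENNReal.ofReal
        (jS (1 / ((n:ℝ) + 1)) (Real.exp (-(1 / ((n:ℝ) + 1)) * y)) ^ κ)) atTop ∂m := by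
        apply lintegral_mono_ae
        filter_upwards [hs] with y hy
        have : Tendsto (fun n : ℕ => ENNReal.ofReal
          (jS (1 / ((n:ℝ) + 1)) (Real.exp (-(1 / ((n:ℝ) + 1)) * y)) ^ κ)) atTop
            (nhds (ENNReal.ofReal ((1 + y) ^ κ))) :=
          (ENNReal.continuous_ofReal.tendsto _).comp ((hlim y).rpow_const (Or.inr hκ.le))
        rw [this.liminf_eq]
        exact ENNReal.ofReal_le_ofReal (Real.rpow_le_rpow hy (by linarith) hκ.le)
    _ ≤ liminf (fun n : ℕ => ∫⁻ y, ENNReal.ofReal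
        (jS (1 / ((n:ℝ) + 1)) (Real.exp (-(1 / ((n:ℝ) + 1)) * y)) ^ κ) ∂m) atTop := by
        apply lintegral_liminf_le
        intro n
        unfold jS
        fun_prop
    _ ≤ C := by
        refine (liminf_le_liminf (v := fun _ => C) (Eventually.of_forall fun n => h _ (by positivity))).trans ?_
        simp

lemma J_int {ν : Measure ℝ} (hI : Integrable (fun z : ℝ => min z 1) (ν.restrict (Ioi 0)))
    {κ : ℝ} (hκ : 0 < κ)
    (hνκ : ∫⁻ z in Set.Ioi (1 : ℝ), ENNReal.ofReal (z ^ κ) ∂ν < ⊤) :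
    Integrable (fun z : ℝ => (1 + z) ^ κ - 1) (ν.restrict (Ioi 0)) := by
  have h1 : IntegrableOn (fun z : ℝ => z ^ κ) (Ioi 1) ν := by
    refine ⟨by fun_prop, ?_⟩
    rw [hasFiniteIntegral_iff_ofReal]
    · exact hνκ
    · filter_upwards [ae_restrict_mem measurableSet_Ioi] with z hz
      exact Real.rpow_nonneg (zero_le_one.trans (le_of_lt hz)) _
  have h2 : Integrable ((Ioi (1:ℝ)).indicator fun z : ℝ => z ^ κ) (ν.restrict (Ioi 0)) := by
    rw [integrable_indicator_iff measurableSet_Ioi]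
    exact h1.mono_measure Measure.restrict_le_self
  refine Integrable.mono' ((hI.const_mul (κ * 2 ^ κ)).add (h2.const_mul (2 ^ κ)))
    (by have : Measurable (fun z : ℝ => (1 + z) ^ κ - 1) := by fun_prop
        exact this.aestronglyMeasurable) ?_
  filter_upwards [ae_restrict_mem measurableSet_Ioi] with z hz
  have hz : 0 < z := hz
  have hge := Real.one_le_rpow (x := 1 + z) (by linarith) hκ.le
  rw [Real.norm_eq_abs, abs_of_nonneg (by linarith)]
  simp only [Pi.add_apply]
  rcases le_or_gt z 1 with h | h
  · rw [min_eq_left h, indicator_of_notMem (by simpa using h), mul_zero, add_zero]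
    have := Convex.norm_image_sub_le_of_norm_hasDerivWithin_le (s := Icc (0:ℝ) 1) (x := 0) (y := z)
      (C := κ * 2 ^ κ)
      (f := fun z : ℝ => (1 + z) ^ κ) (f' := fun z => κ * (1 + z) ^ (κ - 1))
      (fun w hw => by
        have := ((hasDerivAt_id w).const_add 1).rpow_const (p := κ) (Or.inl (by
          have := hw.1
          simp; linarith))
        refine (this.congr_deriv ?_).hasDerivWithinAt
        simp)
      (fun w hw => by
        have h0 := hw.1
        have h1 := hw.2
        rw [Real.norm_eq_abs, abs_of_nonneg (by positivity)]
        refine mul_le_mul_of_nonneg_left ?_ hκ.le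
        calc (1 + w) ^ (κ - 1) ≤ (1 + w) ^ κ :=
              Real.rpow_le_rpow_of_exponent_le (by linarith) (by linarith)
          _ ≤ 2 ^ κ := Real.rpow_le_rpow (by linarith) (by linarith) hκ.le)
      (convex_Icc 0 1) (by simp) ⟨hz.le, h⟩
    simp only [Real.norm_eq_abs, add_zero, Real.one_rpow, sub_zero] at this
    rw [abs_of_pos hz] at this
    exact (le_abs_self _).trans this
  · rw [min_eq_right h.le, indicator_of_mem (by simpa using h)]
    have h3 : (1 + z) ^ κ ≤ 2 ^ κ * z ^ κ := by
      rw [← Real.mul_rpow (by norm_num) hz.le]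
      exact Real.rpow_le_rpow (by linarith) (by linarith) hκ.le
    have : 0 ≤ κ * 2 ^ κ * 1 := by positivity
    linarith

theorem jcir_sup_kappa_moment (a b σ κ x T : ℝ) (ha : 0 ≤ a) (hb : 0 < b) (hσ : 0 < σ)
    (hκ : 0 < κ) (hx : 0 ≤ x) (hT : 0 < T)
    (ν : Measure ℝ) (hνsupp : ν (Set.Iic 0) = 0)
    (hν : ∫⁻ z in Set.Ioi (0 : ℝ), ENNReal.ofReal (min z 1) ∂ν < ⊤)
    (hνκ : ∫⁻ z in Set.Ioi (1 : ℝ), ENNReal.ofReal (z ^ κ) ∂ν < ⊤)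
    (μ : ℝ → Measure ℝ)
    (hμ : ∀ t ∈ Set.Ioc (0 : ℝ) T, IsProbabilityMeasure (μ t))
    (hμsupp : ∀ t ∈ Set.Ioc (0 : ℝ) T, μ t (Set.Iio 0) = 0)
    (hLap : ∀ t ∈ Set.Ioc (0 : ℝ) T, ∀ u : ℝ, u ≤ 0 →
      ∫ y, Real.exp (u * y) ∂(μ t) =
        (1 - σ ^ 2 * u / (2 * b) * (1 - Real.exp (-b * t))) ^ (-(2 * a / σ ^ 2)) *
          Real.exp (x * psi b σ t u) *
          Real.exp (∫ s in Set.Ioc (0 : ℝ) t,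
            ∫ z in Set.Ioi (0 : ℝ), (Real.exp (z * psi b σ s u) - 1) ∂ν)) :
    ∃ C : ℝ≥0∞, C < ⊤ ∧ ∀ t ∈ Set.Ioc (0 : ℝ) T,
      (∫⁻ y, ENNReal.ofReal (y ^ κ) ∂(μ t)) ≤ C := by
  have hI : Integrable (fun z : ℝ => min z 1) (ν.restrict (Ioi 0)) := by
    refine ⟨by fun_prop, ?_⟩
    rw [hasFiniteIntegral_iff_ofReal]
    · exact hν
    · filter_upwards [ae_restrict_mem measurableSet_Ioi] with z hz
      exact le_min (le_of_lt hz) zero_le_one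
  have hJ := J_int hI hκ hνκ
  let m : ℝ → Measure ℝ := fun t => if t ≤ 0 then Measure.dirac x else μ (min t T)
  have hmem : ∀ t : ℝ, ¬ t ≤ 0 → min t T ∈ Ioc 0 T := fun t ht =>
    ⟨lt_min (not_le.1 ht) hT, min_le_right _ _⟩
  have hm : ∀ t, IsProbabilityMeasure (m t) := by
    intro t
    simp only [m]
    split_ifs with h
    · infer_instance
    · exact hμ _ (hmem t h)
  have hs : ∀ t, ∀ᵐ y ∂(m t), 0 ≤ y := by
    intro t
    simp only [m]
    split_ifs with h
    · rw [ae_dirac_iff (p := fun y : ℝ => 0 ≤ y) measurableSet_Ici]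
      exact hx
    · rw [ae_iff]
      simp only [not_le]
      exact hμsupp _ (hmem t h)
  have hm0 : m 0 = Measure.dirac x := by simp [m]
  have hmt : ∀ t ∈ Ioc 0 T, m t = μ t := by
    intro t ht
    simp [m, not_le.2 ht.1, min_eq_left ht.2]
  have hF : ∀ t ∈ Icc 0 T, ∀ u : ℝ, u ≤ 0 → ∫ y, Real.exp (u * y) ∂(m t) =
      jK ν a b σ t u * Real.exp (x * psi b σ t u) := by
    intro t ht u hu
    rcases ht.1.eq_or_lt with rfl | h
    · rw [hm0, integral_dirac]
      simp [jK, jD, psi, mul_comm]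
    · rw [hmt t ⟨h, ht.2⟩, hLap t ⟨h, ht.2⟩ u hu, jK, intervalIntegral.integral_of_le ht.1]
      unfold jD jG
      ring
  refine ⟨ENNReal.ofReal (((1 + x) ^ κ + 1) * Real.exp ((2 * (a * κ + σ ^ 2 / 2 * (κ * |κ - 1|) +
        ∫ z in Ioi (0:ℝ), ((1 + z) ^ κ - 1) ∂ν) + 2) * T) + 1), ENNReal.ofReal_lt_top, fun t ht => ?_⟩
  rw [← hmt t ht]
  exact fatou_step (hs t) hκ fun ε hε =>
    moment_eps hI ha hb hσ hT.le hx hκ hJ hm hs hm0 hF hε ⟨ht.1.le, ht.2⟩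
end

section
/- Let a > 0, b > 0, σ > 0, and let ν be a measure on (0,∞) with ∫_0^∞ (z∧1) ν(dz) < ∞. Fix x ≥ 0 and t > 0, and let μ be a probability measure on [0,∞) whose Laplace transform satisfies, for every real u ≤ 0, ∫ e^{uy} μ(dy) = (1 − (σ²u/(2b))(1 − e^{−bt}))^{−2a/σ²} · exp(x ψ(t,u)) · exp(∫_0^t ∫_0^∞ (e^{zψ(s,u)} − 1) ν(dz) ds). Then μ is absolutely continuous with respect to Lebesgue measure, and it has a density f with respect to Lebesgue measure satisfying f(y) > 0 for every y > 0. -/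
open MeasureTheory Filter Set
open scoped ENNReal

open scoped Topology
open ProbabilityTheory

namespace JCIR

lemma integrable_exp_neg (μ : Measure ℝ) [IsFiniteMeasure μ] (hμ : μ (Set.Iio 0) = 0) {u : ℝ}
    (hu : u ≤ 0) : Integrable (fun y => Real.exp (u * y)) μ := by
  have h0 : ∀ᵐ y ∂μ, 0 ≤ y := by
    rw [ae_iff]; convert hμ using 2; ext; simp
  refine Integrable.of_bound (C := 1) (by fun_prop) ?_
  filter_upwards [h0] with y hy
  rw [Real.norm_eq_abs, abs_of_pos (Real.exp_pos _), Real.exp_le_one_iff]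
  exact mul_nonpos_of_nonpos_of_nonneg hu hy

lemma lap_unique (μ ν : Measure ℝ) [IsProbabilityMeasure μ] [IsProbabilityMeasure ν]
    (hμ : μ (Set.Iio 0) = 0) (hν : ν (Set.Iio 0) = 0)
    (h : ∀ u < 0, ∫ y, Real.exp (u * y) ∂μ = ∫ y, Real.exp (u * y) ∂ν) : μ = ν := by
  have key : ∀ (μ : Measure ℝ) [IsProbabilityMeasure μ], μ (Set.Iio 0) = 0 →
      AnalyticOnNhd ℂ (complexMGF id μ) {z | z.re < 0} := by
    intro μ _ hμ
    refine analyticOnNhd_complexMGF.mono ?_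
    intro z hz
    have : Set.Iio (0:ℝ) ⊆ interior (integrableExpSet id μ) := by
      refine interior_maximal ?_ isOpen_Iio
      intro u hu
      exact integrable_exp_neg μ hμ (le_of_lt hu)
    exact this hz
  have heq : Set.EqOn (complexMGF id μ) (complexMGF id ν) {z | z.re < 0} := by
    refine AnalyticOnNhd.eqOn_of_preconnected_of_frequently_eq (key μ hμ) (key ν hν)
      ((convex_Iio (0:ℝ)).linear_preimage Complex.reLm).isPreconnected
      (z₀ := ((-1 : ℝ) : ℂ)) (by simp) ?_
    have h_real : ∃ᶠ (x : ℝ) in 𝓝[≠] (-1), complexMGF id μ x = complexMGF id ν x := by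
      refine Eventually.frequently ?_
      have : ∀ᶠ x : ℝ in 𝓝[≠] (-1), x < 0 :=
        nhdsWithin_le_nhds (Iio_mem_nhds (by norm_num))
      filter_upwards [this] with y hy
      rw [complexMGF_ofReal, complexMGF_ofReal]
      simp only [mgf, id]
      rw [h y hy]
    rw [frequently_iff_seq_forall] at h_real ⊢
    obtain ⟨xs, hx_tendsto, hx_eq⟩ := h_real
    refine ⟨fun n ↦ xs n, ?_, fun n ↦ ?_⟩
    · rw [tendsto_nhdsWithin_iff] at hx_tendsto ⊢
      constructor
      · exact (Complex.continuous_ofReal.tendsto _).comp hx_tendsto.1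
      · filter_upwards [hx_tendsto.2] with n hn
        simp only [mem_compl_iff, mem_singleton_iff] at hn ⊢
        exact_mod_cast hn
    · simp [hx_eq]
  have lim : ∀ (μ : Measure ℝ) [IsProbabilityMeasure μ], μ (Set.Iio 0) = 0 → ∀ t : ℝ,
      Tendsto (fun n : ℕ => complexMGF id μ (((-(1 / ((n:ℝ) + 1)) : ℝ) : ℂ) + t * Complex.I)) atTop
        (𝓝 (charFun μ t)) := by
    intro μ _ hμ t
    have h0 : ∀ᵐ y ∂μ, 0 ≤ y := by
      rw [ae_iff]; convert hμ using 2; ext; simp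
    rw [← complexMGF_id_mul_I]
    unfold complexMGF
    refine tendsto_integral_of_dominated_convergence (fun _ => (1:ℝ)) (fun n => by fun_prop)
      (integrable_const _) ?_ ?_
    · intro n
      filter_upwards [h0] with y hy
      rw [Complex.norm_exp, Real.exp_le_one_iff]
      have hn : 0 < 1 / ((n:ℝ) + 1) := by positivity
      generalize 1 / ((n:ℝ) + 1) = q at hn ⊢
      simp
      positivity
    · refine ae_of_all _ fun y => ?_
      refine (Complex.continuous_exp.tendsto _).comp ?_
      refine Tendsto.mul_const _ ?_
      have h1 : Tendsto (fun n : ℕ => (((-(1 / ((n:ℝ) + 1)) : ℝ) : ℂ))) atTop (𝓝 ((-0 : ℝ):ℂ)) :=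
        (Complex.continuous_ofReal.tendsto _).comp (tendsto_one_div_add_atTop_nhds_zero_nat.neg)
      simpa using h1.add_const (t * Complex.I)
  refine Measure.ext_of_charFun ?_
  ext t
  refine tendsto_nhds_unique (lim μ hμ t) ?_
  refine (lim ν hν t).congr fun n => ?_
  refine (heq ?_).symm
  have hn : 0 < 1 / ((n:ℝ) + 1) := by positivity
  generalize 1 / ((n:ℝ) + 1) = q at hn ⊢
  simpa using hn

/-- convolution powers -/
noncomputable def cpow (M : Measure ℝ) : ℕ → Measure ℝ
  | 0 => Measure.dirac 0
  | n + 1 => M.conv (cpow M n)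

instance cpow_fin (M : Measure ℝ) [IsFiniteMeasure M] (n : ℕ) : IsFiniteMeasure (cpow M n) := by
  induction n with
  | zero => unfold cpow; infer_instance
  | succ n ih => unfold cpow; infer_instance

lemma lap_conv (M N : Measure ℝ) [SFinite M] [SFinite N] (p : ℝ) :
    ∫⁻ y, ENNReal.ofReal (Real.exp (-(p * y))) ∂(M.conv N) =
      (∫⁻ y, ENNReal.ofReal (Real.exp (-(p * y))) ∂M) *
      (∫⁻ y, ENNReal.ofReal (Real.exp (-(p * y))) ∂N) := by
  rw [Measure.lintegral_conv (by fun_prop), ← lintegral_mul_const _ (by fun_prop)]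
  refine lintegral_congr fun x => ?_
  rw [← lintegral_const_mul _ (by fun_prop)]
  refine lintegral_congr fun y => ?_
  rw [← ENNReal.ofReal_mul (Real.exp_pos _).le, ← Real.exp_add]
  congr 2; ring

lemma supp_conv (M N : Measure ℝ) [SFinite M] [SFinite N] (hM : M (Set.Iio 0) = 0)
    (hN : N (Set.Iio 0) = 0) : (M.conv N) (Set.Iio 0) = 0 := by
  rw [← lintegral_indicator_one measurableSet_Iio,
    Measure.lintegral_conv (by measurability)]
  have h0 : ∀ᵐ y ∂M, 0 ≤ y := by
    rw [ae_iff]; convert hM using 2; ext; simp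
  have h1 : ∀ᵐ y ∂N, 0 ≤ y := by
    rw [ae_iff]; convert hN using 2; ext; simp
  rw [← lintegral_zero (μ := M)]
  refine lintegral_congr_ae ?_
  filter_upwards [h0] with x hx
  rw [← lintegral_zero (μ := N)]
  refine lintegral_congr_ae ?_
  filter_upwards [h1] with y hy
  simp
  linarith

lemma lap_cpow (M : Measure ℝ) [IsFiniteMeasure M] (n : ℕ) (p : ℝ) :
    ∫⁻ y, ENNReal.ofReal (Real.exp (-(p * y))) ∂(cpow M n) =
      (∫⁻ y, ENNReal.ofReal (Real.exp (-(p * y))) ∂M) ^ n := by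
  induction n with
  | zero => simp [cpow]
  | succ n ih => rw [cpow, lap_conv, ih, pow_succ']

lemma supp_cpow (M : Measure ℝ) [IsFiniteMeasure M] (hM : M (Set.Iio 0) = 0) (n : ℕ) :
    cpow M n (Set.Iio 0) = 0 := by
  induction n with
  | zero => simp [cpow]
  | succ n ih => exact supp_conv _ _ hM ih

/-- compound Poisson -/
lemma exists_cp (M : Measure ℝ) [IsFiniteMeasure M] (hM : M (Set.Iio 0) = 0) :
    ∃ P : Measure ℝ, IsProbabilityMeasure P ∧ P (Set.Iio 0) = 0 ∧ ∀ p : ℝ, 0 ≤ p →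
      ∫⁻ y, ENNReal.ofReal (Real.exp (-(p * y))) ∂P =
        ENNReal.ofReal (Real.exp (-(∫⁻ y, ENNReal.ofReal (1 - Real.exp (-(p * y))) ∂M).toReal)) := by
  have h0 : ∀ᵐ y ∂M, 0 ≤ y := by
    rw [ae_iff]; convert hM using 2; ext; simp
  set m : ℝ := (M univ).toReal with hm
  let P : Measure ℝ := Measure.sum fun n : ℕ =>
    ENNReal.ofReal (Real.exp (-m) / n.factorial) • cpow M n
  have hL : ∀ p : ℝ, 0 ≤ p → ∫⁻ y, ENNReal.ofReal (Real.exp (-(p * y))) ∂P =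
        ENNReal.ofReal (Real.exp (-(∫⁻ y, ENNReal.ofReal (1 - Real.exp (-(p * y))) ∂M).toReal)) := by
    intro p hp
    set L := ∫⁻ y, ENNReal.ofReal (Real.exp (-(p * y))) ∂M with hLd
    have hle : ∀ᵐ y ∂M, Real.exp (-(p * y)) ≤ 1 := by
      filter_upwards [h0] with y hy
      rw [Real.exp_le_one_iff]; nlinarith [mul_nonneg hp hy]
    have hadd : L + ∫⁻ y, ENNReal.ofReal (1 - Real.exp (-(p * y))) ∂M = M univ := by
      rw [hLd, ← lintegral_add_left (by fun_prop), ← lintegral_one]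
      refine lintegral_congr_ae ?_
      filter_upwards [hle] with y hy
      rw [← ENNReal.ofReal_add (Real.exp_pos _).le (by linarith)]
      simp
    have hLf : L ≠ ⊤ := ne_top_of_le_ne_top (measure_ne_top M univ) (hadd ▸ le_self_add)
    have hRf : ∫⁻ y, ENNReal.ofReal (1 - Real.exp (-(p * y))) ∂M ≠ ⊤ :=
      ne_top_of_le_ne_top (measure_ne_top M univ) (hadd ▸ le_add_self)
    have hre : L.toReal + (∫⁻ y, ENNReal.ofReal (1 - Real.exp (-(p * y))) ∂M).toReal = m := by
      rw [← ENNReal.toReal_add hLf hRf, hadd]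
    rw [lintegral_sum_measure]
    have : ∀ n : ℕ, ∫⁻ y, ENNReal.ofReal (Real.exp (-(p * y)))
        ∂(ENNReal.ofReal (Real.exp (-m) / n.factorial) • cpow M n) =
        ENNReal.ofReal (Real.exp (-m) * (L.toReal ^ n / n.factorial)) := by
      intro n
      rw [lintegral_smul_measure, lap_cpow, ← hLd, smul_eq_mul]
      conv_lhs => rw [← ENNReal.ofReal_toReal hLf]
      rw [← ENNReal.ofReal_pow ENNReal.toReal_nonneg, ← ENNReal.ofReal_mul (by positivity)]
      congr 1; ring
    simp_rw [this]
    have hs : HasSum (fun n : ℕ => Real.exp (-m) * (L.toReal ^ n / n.factorial))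
        (Real.exp (-m) * Real.exp L.toReal) := by
      refine HasSum.mul_left _ ?_
      rw [Real.exp_eq_exp_ℝ]
      exact NormedSpace.expSeries_div_hasSum_exp L.toReal
    rw [← ENNReal.ofReal_tsum_of_nonneg (fun n => by positivity) hs.summable, hs.tsum_eq,
      ← Real.exp_add]
    congr 2
    linarith
  refine ⟨P, ⟨?_⟩, ?_, hL⟩
  · have := hL 0 le_rfl
    simpa using this
  · simp only [P]
    rw [Measure.sum_apply _ measurableSet_Iio]
    simp [supp_cpow M hM]

lemma exists_inf_conv (P : ℕ → Measure ℝ) [∀ k, IsProbabilityMeasure (P k)]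
    (hP : ∀ k, P k (Set.Iio 0) = 0) (φ : ℕ → ℝ → ℝ≥0∞)
    (hL : ∀ k, ∀ p : ℝ, 0 ≤ p → ∫⁻ y, ENNReal.ofReal (Real.exp (-(p * y))) ∂(P k) =
      ENNReal.ofReal (Real.exp (-(φ k p).toReal)))
    (hfin : ∀ p : ℝ, 0 ≤ p → ∑' k, φ k p ≠ ⊤)
    (h0 : Tendsto (fun n : ℕ => ∑' k, φ k (1 / ((n:ℝ) + 1))) atTop (𝓝 0)) :
    ∃ Q : Measure ℝ, IsProbabilityMeasure Q ∧ Q (Set.Iio 0) = 0 ∧ ∀ p : ℝ, 0 ≤ p →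
      ∫⁻ y, ENNReal.ofReal (Real.exp (-(p * y))) ∂Q =
        ENNReal.ofReal (Real.exp (-(∑' k, φ k p).toReal)) := by
  let Ω := Measure.infinitePi P
  let V : ℕ → (ℕ → ℝ) → ℝ≥0∞ := fun k ω => ENNReal.ofReal (Real.exp (-(max (ω k) 0)))
  have hV1 : ∀ k ω, V k ω ≤ 1 := by
    intro k ω
    simp only [V]
    rw [ENNReal.ofReal_le_one, Real.exp_le_one_iff]
    simp
  have hVm : ∀ k, Measurable (V k) := by
    intro k; simp only [V]; fun_prop
  let Zn : ℕ → (ℕ → ℝ) → ℝ≥0∞ := fun n ω => ∏ k ∈ Finset.range n, V k ω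
  have hZm : ∀ n, Measurable (Zn n) := by
    intro n; simp only [Zn]; fun_prop
  have hZanti : ∀ ω, Antitone (fun n => Zn n ω) := by
    intro ω
    refine antitone_nat_of_succ_le fun n => ?_
    simp only [Zn]
    rw [Finset.prod_range_succ]
    exact mul_le_of_le_one_right' (hV1 n ω)
  let Z : (ℕ → ℝ) → ℝ≥0∞ := fun ω => ⨅ n, Zn n ω
  have hZM : Measurable Z := Measurable.iInf hZm
  have hZ1n : ∀ n ω, Zn n ω ≤ 1 := by
    intro n ω
    exact Finset.prod_le_one' (fun k _ => hV1 k ω)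
  have hZ1 : ∀ ω, Z ω ≤ 1 := fun ω => (iInf_le _ 0).trans (hZ1n 0 ω)
  have hlim : ∀ ω, Tendsto (fun n => Zn n ω) atTop (𝓝 (Z ω)) := fun ω =>
    tendsto_atTop_iInf (hZanti ω)
  have hrp1 : ∀ z : ℝ≥0∞, z ≤ 1 → ∀ p : ℝ, 0 ≤ p → z ^ p ≤ 1 := fun z hz p hp =>
    ENNReal.rpow_le_one hz hp
  have hint : ∀ k, ∀ p : ℝ, 0 ≤ p → ∫⁻ ω, V k ω ^ p ∂Ω =
      ENNReal.ofReal (Real.exp (-(φ k p).toReal)) := by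
    intro k p hp
    rw [← hL k p hp]
    have e1 : ∫⁻ ω, V k ω ^ p ∂Ω =
        ∫⁻ y, ENNReal.ofReal (Real.exp (-(max y 0))) ^ p ∂(Ω.map (fun ω => ω k)) := by
      rw [lintegral_map (by fun_prop) (by fun_prop)]
    rw [e1]
    have e2 : Ω.map (fun ω => ω k) = P k := Measure.infinitePi_map_eval P k
    rw [e2]
    have h0 : ∀ᵐ y ∂(P k), 0 ≤ y := by
      rw [ae_iff]; convert hP k using 2; ext; simp
    refine lintegral_congr_ae ?_
    filter_upwards [h0] with y hy
    rw [max_eq_left hy, ENNReal.ofReal_rpow_of_pos (Real.exp_pos _), ← Real.exp_mul]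
    congr 2; ring
  have hindep : ∀ p : ℝ, iIndepFun (fun k ω => V k ω ^ p) Ω := by
    intro p
    exact iIndepFun_infinitePi (P := P)
      (X := fun _ y => ENNReal.ofReal (Real.exp (-(max y 0))) ^ p) (fun i => by fun_prop)
  have hintn : ∀ n, ∀ p : ℝ, 0 ≤ p → ∫⁻ ω, Zn n ω ^ p ∂Ω =
      ENNReal.ofReal (Real.exp (-(∑ k ∈ Finset.range n, φ k p).toReal)) := by
    intro n p hp
    have : ∀ ω, Zn n ω ^ p = ∏ k ∈ Finset.range n, V k ω ^ p := by
      intro ω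
      simp only [Zn]
      rw [ENNReal.prod_rpow_of_nonneg hp]
    simp_rw [this]
    rw [lintegral_prod_eq_prod_lintegral_of_indepFun _ _ (hindep p)
      (fun i => (hVm i).pow_const p)]
    rw [Finset.prod_congr rfl (fun k _ => hint k p hp)]
    rw [← ENNReal.ofReal_prod_of_nonneg (fun _ _ => (Real.exp_pos _).le), ← Real.exp_sum]
    congr 2
    rw [ENNReal.toReal_sum, Finset.sum_neg_distrib]
    intro k _
    exact ne_top_of_le_ne_top (hfin p hp) (ENNReal.le_tsum k)
  have hintZ : ∀ p : ℝ, 0 ≤ p → ∫⁻ ω, Z ω ^ p ∂Ω =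
      ENNReal.ofReal (Real.exp (-(∑' k, φ k p).toReal)) := by
    intro p hp
    have l1 : Tendsto (fun n => ∫⁻ ω, Zn n ω ^ p ∂Ω) atTop (𝓝 (∫⁻ ω, Z ω ^ p ∂Ω)) := by
      refine tendsto_lintegral_of_dominated_convergence (fun _ => 1)
        (fun n => (hZm n).pow_const p) (fun n => ae_of_all _ fun ω => hrp1 _ (hZ1n n ω) p hp)
        (by simp) (ae_of_all _ fun ω => ?_)
      exact (ENNReal.continuous_rpow_const.tendsto _).comp (hlim ω)
    refine tendsto_nhds_unique l1 ?_
    simp_rw [fun n => hintn n p hp]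
    refine (ENNReal.continuous_ofReal.tendsto _).comp ?_
    refine (Real.continuous_exp.tendsto _).comp ?_
    refine Tendsto.neg ?_
    refine (ENNReal.tendsto_toReal (hfin p hp)).comp ?_
    exact ENNReal.summable.hasSum.tendsto_sum_nat
  have hZpos : ∀ᵐ ω ∂Ω, Z ω ≠ 0 := by
    have l1 : Tendsto (fun n : ℕ => ∫⁻ ω, Z ω ^ (1 / ((n:ℝ) + 1)) ∂Ω) atTop (𝓝 1) := by
      simp_rw [fun n : ℕ => hintZ (1 / ((n:ℝ) + 1)) (by positivity)]
      have : (1 : ℝ≥0∞) = ENNReal.ofReal (Real.exp (-(0:ℝ≥0∞).toReal)) := by simp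
      rw [this]
      refine (ENNReal.continuous_ofReal.tendsto _).comp ?_
      refine (Real.continuous_exp.tendsto _).comp ?_
      refine Tendsto.neg ?_
      exact (ENNReal.tendsto_toReal (by simp)).comp h0
    have hb : ∀ n : ℕ, ∫⁻ ω, Z ω ^ (1 / ((n:ℝ) + 1)) ∂Ω ≤ Ω {ω | Z ω ≠ 0} := by
      intro n
      have hms : MeasurableSet {ω | Z ω ≠ 0} := (hZM (measurableSet_singleton 0)).compl
      rw [← lintegral_indicator_one hms]
      refine lintegral_mono fun ω => ?_
      by_cases h : Z ω = 0
      · rw [h, ENNReal.zero_rpow_of_pos (by positivity)]; exact zero_le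
      · rw [indicator_of_mem h]
        exact hrp1 _ (hZ1 ω) _ (by positivity)
    have h1 : 1 ≤ Ω {ω | Z ω ≠ 0} := le_of_tendsto' l1 hb
    have hms : MeasurableSet {ω | Z ω ≠ 0} := (hZM (measurableSet_singleton 0)).compl
    have h2 : Ω {ω | Z ω ≠ 0} = 1 := le_antisymm prob_le_one h1
    exact (prob_compl_eq_zero_iff hms).2 h2
  let X : (ℕ → ℝ) → ℝ := fun ω => -Real.log (Z ω).toReal
  have hXm : Measurable X := by simp only [X]; fun_prop
  refine ⟨Ω.map X, Measure.isProbabilityMeasure_map hXm.aemeasurable, ?_, ?_⟩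
  · rw [Measure.map_apply hXm measurableSet_Iio]
    convert measure_empty (μ := Ω)
    ext ω
    simp only [mem_preimage, mem_Iio, mem_empty_iff_false, iff_false, not_lt, X]
    have : (Z ω).toReal ≤ 1 := by
      simpa using ENNReal.toReal_mono (by simp) (hZ1 ω)
    have := Real.log_nonpos ENNReal.toReal_nonneg this
    linarith
  · intro p hp
    rw [lintegral_map (by fun_prop) hXm, ← hintZ p hp]
    refine lintegral_congr_ae ?_
    filter_upwards [hZpos] with ω hω
    have hne : Z ω ≠ ⊤ := ne_top_of_le_ne_top (by simp) (hZ1 ω)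
    have hpos : 0 < (Z ω).toReal := ENNReal.toReal_pos hω hne
    conv_rhs => rw [← ENNReal.ofReal_toReal hne]
    rw [ENNReal.ofReal_rpow_of_pos hpos, Real.rpow_def_of_pos hpos]
    congr 2
    simp only [X]; ring

/-- `1 - e^{-py} ≤ p (1 - e^{-y})` for `p ≥ 1`. -/
lemma bern {p y : ℝ} (hp : 1 ≤ p) :
    1 - Real.exp (-(p * y)) ≤ p * (1 - Real.exp (-y)) := by
  have := one_add_mul_self_le_rpow_one_add (s := Real.exp (-y) - 1)
    (by linarith [Real.exp_pos (-y)]) hp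
  rw [add_sub_cancel, ← Real.exp_mul] at this
  have e : -y * p = -(p * y) := by ring
  rw [e] at this
  linarith

lemma exists_id (M : Measure ℝ) [SFinite M] (hM : M (Set.Iio 0) = 0)
    (hfin : ∀ p : ℝ, 0 ≤ p → ∫⁻ y, ENNReal.ofReal (1 - Real.exp (-(p * y))) ∂M ≠ ⊤) :
    ∃ Q : Measure ℝ, IsProbabilityMeasure Q ∧ Q (Set.Iio 0) = 0 ∧ (∀ p : ℝ, 0 ≤ p →
      ∫⁻ y, ENNReal.ofReal (Real.exp (-(p * y))) ∂Q =
        ENNReal.ofReal (Real.exp (-(∫⁻ y, ENNReal.ofReal (1 - Real.exp (-(p * y))) ∂M).toReal))) ∧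
      ∀ ε : ℝ, 0 < ε → 0 < Q (Set.Iio ε) := by
  have hM0 : ∀ᵐ y ∂M, 0 ≤ y := by
    rw [ae_iff]; convert hM using 2; ext; simp
  have hMk : ∀ k, sfiniteSeq M k (Set.Iio 0) = 0 := fun k =>
    le_antisymm ((sfiniteSeq_le M k _).trans hM.le) zero_le
  choose P hP1 hP2 hP3 using fun k => exists_cp (sfiniteSeq M k) (hMk k)
  have hsum : ∀ p : ℝ, ∑' k, ∫⁻ y, ENNReal.ofReal (1 - Real.exp (-(p * y))) ∂(sfiniteSeq M k) =
      ∫⁻ y, ENNReal.ofReal (1 - Real.exp (-(p * y))) ∂M := by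
    intro p
    rw [← lintegral_sum_measure, sum_sfiniteSeq]
  have h1 := hfin 1 zero_le_one
  simp only [one_mul] at h1
  obtain ⟨Q, hQ1, hQ2, hQ3⟩ := exists_inf_conv P hP2
    (fun k p => ∫⁻ y, ENNReal.ofReal (1 - Real.exp (-(p * y))) ∂(sfiniteSeq M k)) hP3
    (fun p hp => by rw [hsum]; exact hfin p hp) (by
      simp_rw [hsum]
      rw [← lintegral_zero (μ := M)]
      refine tendsto_lintegral_of_dominated_convergence
        (fun y => ENNReal.ofReal (1 - Real.exp (-y))) (fun n => by fun_prop) (fun n => ?_) h1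
        (ae_of_all _ fun y => ?_)
      · filter_upwards [hM0] with y hy
        refine ENNReal.ofReal_le_ofReal ?_
        have : 1 / ((n:ℝ) + 1) ≤ 1 := by
          rw [div_le_one (by positivity)]; linarith [(Nat.cast_nonneg n : (0:ℝ) ≤ n)]
        have : Real.exp (-y) ≤ Real.exp (-(1 / ((n:ℝ) + 1) * y)) := by
          rw [Real.exp_le_exp]; nlinarith
        linarith
      · have : (0:ℝ≥0∞) = ENNReal.ofReal (1 - Real.exp (-(0 * y))) := by simp
        rw [this]
        refine (ENNReal.continuous_ofReal.tendsto _).comp ?_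
        refine Tendsto.const_sub _ ?_
        refine (Real.continuous_exp.tendsto _).comp ?_
        exact (tendsto_one_div_add_atTop_nhds_zero_nat.mul_const y).neg)
  simp_rw [hsum] at hQ3
  refine ⟨Q, hQ1, hQ2, hQ3, ?_⟩
  intro ε hε
  by_contra hcon
  have hQε : Q (Set.Iio ε) = 0 := by simpa using hcon
  have hQ0 : ∀ᵐ y ∂Q, ε ≤ y := by
    rw [ae_iff]; convert hQε using 2; ext; simp
  -- Φ(p) ≥ p ε
  have hlow : ∀ p : ℝ, 0 ≤ p →
      p * ε ≤ (∫⁻ y, ENNReal.ofReal (1 - Real.exp (-(p * y))) ∂M).toReal := by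
    intro p hp
    have h2 : ∫⁻ y, ENNReal.ofReal (Real.exp (-(p * y))) ∂Q ≤
        ENNReal.ofReal (Real.exp (-(p * ε))) := by
      calc _ ≤ ∫⁻ y, ENNReal.ofReal (Real.exp (-(p * ε))) ∂Q := by
            refine lintegral_mono_ae ?_
            filter_upwards [hQ0] with y hy
            refine ENNReal.ofReal_le_ofReal ?_
            rw [Real.exp_le_exp]; nlinarith
        _ = _ := by simp
    rw [hQ3 p hp, ENNReal.ofReal_le_ofReal_iff (Real.exp_pos _).le, Real.exp_le_exp] at h2
    linarith
  have hlim : Tendsto (fun n : ℕ => ∫⁻ y, ENNReal.ofReal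
      ((1 - Real.exp (-(((n:ℝ) + 1) * y))) * (1 / ((n:ℝ) + 1))) ∂M) atTop (𝓝 0) := by
    rw [← lintegral_zero (μ := M)]
    refine tendsto_lintegral_of_dominated_convergence
        (fun y => ENNReal.ofReal (1 - Real.exp (-y))) (fun n => by fun_prop) (fun n => ?_) h1
        ?_
    · filter_upwards with y
      refine ENNReal.ofReal_le_ofReal ?_
      rw [mul_one_div, div_le_iff₀ (by positivity), mul_comm (1 - Real.exp (-y))]
      exact bern (by linarith [(Nat.cast_nonneg n : (0:ℝ) ≤ n)])
    · filter_upwards [hM0] with y hy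
      rw [← ENNReal.ofReal_zero]
      refine (ENNReal.continuous_ofReal.tendsto _).comp ?_
      refine squeeze_zero (g := fun n : ℕ => 1 / ((n:ℝ) + 1)) (fun n => ?_) (fun n => ?_)
        tendsto_one_div_add_atTop_nhds_zero_nat
      · have : Real.exp (-(((n:ℝ) + 1) * y)) ≤ 1 := by
          rw [Real.exp_le_one_iff]
          have : 0 ≤ ((n:ℝ) + 1) * y := by positivity
          linarith
        have h3 : 0 ≤ 1 / ((n:ℝ) + 1) := by positivity
        exact mul_nonneg (by linarith) h3
      · have h3 : 0 ≤ 1 / ((n:ℝ) + 1) := by positivity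
        have := Real.exp_pos (-(((n:ℝ) + 1) * y))
        exact mul_le_of_le_one_left h3 (by linarith)
  have hge : ∀ n : ℕ, ENNReal.ofReal ε ≤ ∫⁻ y, ENNReal.ofReal
      ((1 - Real.exp (-(((n:ℝ) + 1) * y))) * (1 / ((n:ℝ) + 1))) ∂M := by
    intro n
    have hn : (0:ℝ) < (n:ℝ) + 1 := by positivity
    have h2 := hlow ((n:ℝ) + 1) hn.le
    have e : ∀ y : ℝ, ENNReal.ofReal
      ((1 - Real.exp (-(((n:ℝ) + 1) * y))) * (1 / ((n:ℝ) + 1))) =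
      ENNReal.ofReal (1 - Real.exp (-(((n:ℝ) + 1) * y))) * ENNReal.ofReal (1 / ((n:ℝ) + 1)) :=
      fun y => ENNReal.ofReal_mul' (by positivity)
    simp_rw [e]
    rw [lintegral_mul_const _ (by fun_prop),
      ← ENNReal.ofReal_toReal (hfin ((n:ℝ) + 1) hn.le), ← ENNReal.ofReal_mul ENNReal.toReal_nonneg]
    refine ENNReal.ofReal_le_ofReal ?_
    rw [mul_one_div, le_div_iff₀ hn]
    linarith
  have := ge_of_tendsto' hlim hge
  simp at this
  linarith

lemma conv_density (g : ℝ → ℝ≥0∞) (hg : Measurable g) (Q : Measure ℝ) [SFinite Q] :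
    Q.conv (volume.withDensity g) = volume.withDensity (fun y => ∫⁻ w, g (y - w) ∂Q) := by
  refine Measure.ext_of_lintegral _ fun f hf => ?_
  rw [Measure.lintegral_conv hf]
  have hm : Measurable (fun z : ℝ × ℝ => g (z.1 - z.2)) := by fun_prop
  rw [lintegral_withDensity_eq_lintegral_mul _ (Measurable.lintegral_prod_right' hm) hf]
  have e1 : ∀ x : ℝ, ∫⁻ y, f (x + y) ∂(volume.withDensity g) = ∫⁻ y, g (y - x) * f y := by
    intro x
    rw [lintegral_withDensity_eq_lintegral_mul _ hg (by fun_prop)]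
    rw [← lintegral_add_right_eq_self (fun y => g (y - x) * f y) x]
    refine lintegral_congr fun y => ?_
    simp [add_comm]
  simp_rw [e1]
  rw [lintegral_lintegral_swap (by fun_prop)]
  refine lintegral_congr fun y => ?_
  simp only [Pi.mul_apply]
  rw [← lintegral_mul_const _ (by fun_prop)]

lemma lap_gamma {α r p : ℝ} (hα : 0 < α) (hr : 0 < r) (hp : 0 ≤ p) :
    ∫⁻ y, ENNReal.ofReal (Real.exp (-(p * y))) ∂(gammaMeasure α r) =
      ENNReal.ofReal ((r / (r + p)) ^ α) := by
  have hrp : 0 < r + p := by linarith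
  have hmg : ∀ r, Measurable (gammaPDF α r) := fun r =>
    (measurable_gammaPDFReal α r).ennreal_ofReal
  rw [gammaMeasure, lintegral_withDensity_eq_lintegral_mul _ (hmg r) (by fun_prop)]
  have : ∀ y, (gammaPDF α r * fun y => ENNReal.ofReal (Real.exp (-(p * y)))) y =
      ENNReal.ofReal ((r / (r + p)) ^ α) * gammaPDF α (r + p) y := by
    intro y
    simp only [Pi.mul_apply, gammaPDF]
    rw [← ENNReal.ofReal_mul (gammaPDFReal_nonneg hα hr _),
      ← ENNReal.ofReal_mul (by positivity)]
    congr 1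
    unfold gammaPDFReal
    split_ifs with hy
    · rw [Real.div_rpow hr.le hrp.le]
      have e : Real.exp (-((r + p) * y)) = Real.exp (-(r * y)) * Real.exp (-(p * y)) := by
        rw [← Real.exp_add]; congr 1; ring
      rw [e]
      have := (Real.rpow_pos_of_pos hrp α).ne'
      field_simp
    · simp
  simp_rw [this]
  rw [lintegral_const_mul _ (hmg _), lintegral_gammaPDF_eq_one hα hrp, mul_one]

lemma supp_gamma (α r : ℝ) : gammaMeasure α r (Set.Iio 0) = 0 := by
  rw [gammaMeasure, withDensity_apply _ measurableSet_Iio]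
  exact lintegral_gammaPDF_of_nonpos le_rfl

lemma one_sub_gamma {α r p : ℝ} (hα : 0 < α) (hr : 0 < r) (hp : 0 ≤ p) :
    ∫⁻ y, ENNReal.ofReal (1 - Real.exp (-(p * y))) ∂(gammaMeasure α r) =
      ENNReal.ofReal (1 - (r / (r + p)) ^ α) := by
  have := isProbabilityMeasure_gammaMeasure hα hr
  have h0 : ∀ᵐ y ∂(gammaMeasure α r), 0 ≤ y := by
    rw [ae_iff]; convert supp_gamma α r using 2; ext; simp
  have hadd : ENNReal.ofReal ((r / (r + p)) ^ α) +
      ∫⁻ y, ENNReal.ofReal (1 - Real.exp (-(p * y))) ∂(gammaMeasure α r) = 1 := by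
    rw [← lap_gamma hα hr hp, ← lintegral_add_left (by fun_prop),
      ← measure_univ (μ := gammaMeasure α r), ← lintegral_one]
    refine lintegral_congr_ae ?_
    filter_upwards [h0] with y hy
    have : Real.exp (-(p * y)) ≤ 1 := by
      rw [Real.exp_le_one_iff]; nlinarith [mul_nonneg hp hy]
    rw [← ENNReal.ofReal_add (Real.exp_pos _).le (by linarith)]
    simp
  have hrp : 0 < r + p := by linarith
  rw [ENNReal.ofReal_sub _ (by positivity), ENNReal.ofReal_one, ← hadd,
    ENNReal.add_sub_cancel_left ENNReal.ofReal_ne_top]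

lemma exists_mix {Θ : Type*} [MeasurableSpace Θ] (ρ : Measure Θ) [SFinite ρ] (c l : Θ → ℝ)
    (hc : Measurable c) (hl : Measurable l) (h0 : ∀ᵐ θ ∂ρ, 0 ≤ c θ ∧ 0 ≤ l θ) :
    ∃ M : Measure ℝ, SFinite M ∧ M (Set.Iio 0) = 0 ∧ ∀ p : ℝ, 0 ≤ p →
      ∫⁻ y, ENNReal.ofReal (1 - Real.exp (-(p * y))) ∂M =
      ∫⁻ θ, ENNReal.ofReal (1 - Real.exp (-(l θ * (p * c θ / (1 + p * c θ))))) ∂ρ := by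
  have hprob : ∀ n : ℕ, IsProbabilityMeasure (gammaMeasure ((n:ℝ) + 1) 1) := fun n =>
    isProbabilityMeasure_gammaMeasure (by positivity) one_pos
  let wt : ℕ → Θ → ℝ≥0∞ := fun n θ =>
    ENNReal.ofReal (Real.exp (-(l θ)) * (l θ ^ (n + 1) / (n + 1).factorial))
  have hwt : ∀ n, Measurable (wt n) := by intro n; simp only [wt]; fun_prop
  let M : ℕ → Measure ℝ := fun n =>
    ((ρ.prod (gammaMeasure ((n:ℝ) + 1) 1)).withDensity (fun q => wt n q.1)).map
      (fun q => c q.1 * q.2)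
  have hMi : ∀ n, ∀ F : ℝ → ℝ≥0∞, Measurable F → ∫⁻ y, F y ∂(M n) =
      ∫⁻ θ, wt n θ * ∫⁻ w, F (c θ * w) ∂(gammaMeasure ((n:ℝ) + 1) 1) ∂ρ := by
    intro n F hF
    simp only [M]
    rw [lintegral_map hF (by fun_prop), lintegral_withDensity_eq_lintegral_mul _ (by fun_prop)
      (by fun_prop), lintegral_prod _ (by fun_prop)]
    refine lintegral_congr fun θ => ?_
    simp only [Pi.mul_apply]
    rw [lintegral_const_mul _ (by fun_prop)]
  have hMs : ∀ n, SFinite (M n) := fun n => by simp only [M]; infer_instance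
  refine ⟨Measure.sum M, inferInstance, ?_, ?_⟩
  · rw [Measure.sum_apply _ measurableSet_Iio, ENNReal.tsum_eq_zero]
    intro n
    rw [← lintegral_indicator_one measurableSet_Iio, hMi n _ (by measurability),
      ← lintegral_zero (μ := ρ)]
    refine lintegral_congr_ae ?_
    filter_upwards [h0] with θ hθ
    have h1 : ∀ᵐ y ∂(gammaMeasure ((n:ℝ) + 1) 1), 0 ≤ y := by
      rw [ae_iff]; convert supp_gamma ((n:ℝ) + 1) 1 using 2; ext; simp
    have : ∫⁻ w, (Set.Iio (0:ℝ)).indicator 1 (c θ * w) ∂(gammaMeasure ((n:ℝ) + 1) 1)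
        = (0:ℝ≥0∞) := by
      rw [← lintegral_zero (μ := gammaMeasure ((n:ℝ) + 1) 1)]
      refine lintegral_congr_ae ?_
      filter_upwards [h1] with w hw
      rw [indicator_of_notMem]
      simpa using mul_nonneg hθ.1 hw
    rw [this, mul_zero]
  · intro p hp
    rw [lintegral_sum_measure]
    simp_rw [fun n => hMi n (fun y => ENNReal.ofReal (1 - Real.exp (-(p * y)))) (by fun_prop)]
    rw [← lintegral_tsum]
    swap
    · intro n
      refine ((hwt n).mul ?_).aemeasurable
      refine Measurable.lintegral_prod_right'
        (f := fun q : Θ × ℝ => ENNReal.ofReal (1 - Real.exp (-(p * (c q.1 * q.2))))) (by fun_prop)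
    refine lintegral_congr_ae ?_
    filter_upwards [h0] with θ hθ
    obtain ⟨hcθ, hlθ⟩ := hθ
    have hpc : 0 ≤ p * c θ := mul_nonneg hp hcθ
    set R : ℝ := 1 / (1 + p * c θ) with hR
    have hR0 : 0 < R := by positivity
    have hR1 : R ≤ 1 := by rw [hR, div_le_one (by positivity)]; linarith
    have e1 : ∀ n : ℕ, ∫⁻ w, ENNReal.ofReal (1 - Real.exp (-(p * (c θ * w))))
        ∂(gammaMeasure ((n:ℝ) + 1) 1) = ENNReal.ofReal (1 - R ^ (n + 1)) := by
      intro n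
      simp_rw [← mul_assoc]
      rw [one_sub_gamma (by positivity) one_pos hpc, ← hR]
      congr 2
      exact_mod_cast Real.rpow_natCast R (n + 1)
    simp_rw [e1]
    simp only [wt]
    have e2 : ∀ n : ℕ, ENNReal.ofReal (Real.exp (-(l θ)) * (l θ ^ (n + 1) / (n + 1).factorial)) *
        ENNReal.ofReal (1 - R ^ (n + 1)) =
        ENNReal.ofReal (Real.exp (-(l θ)) * (l θ ^ (n + 1) / (n + 1).factorial) *
          (1 - R ^ (n + 1))) := fun n => (ENNReal.ofReal_mul (by positivity)).symm
    simp_rw [e2]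
    have hs : HasSum (fun n : ℕ => Real.exp (-(l θ)) * (l θ ^ n / n.factorial) *
          (1 - R ^ n)) (Real.exp (-(l θ)) * (Real.exp (l θ) - Real.exp (l θ * R))) := by
      have a1 : HasSum (fun n : ℕ => l θ ^ n / n.factorial) (Real.exp (l θ)) := by
        rw [Real.exp_eq_exp_ℝ]
        exact NormedSpace.expSeries_div_hasSum_exp (l θ)
      have a2 : HasSum (fun n : ℕ => (l θ * R) ^ n / n.factorial) (Real.exp (l θ * R)) := by
        rw [Real.exp_eq_exp_ℝ]
        exact NormedSpace.expSeries_div_hasSum_exp (l θ * R)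
      have a3 := (a1.sub a2).mul_left (Real.exp (-(l θ)))
      have a4 : (fun n : ℕ => Real.exp (-(l θ)) * (l θ ^ n / n.factorial) * (1 - R ^ n)) =
          fun n : ℕ => Real.exp (-(l θ)) * (l θ ^ n / n.factorial - (l θ * R) ^ n / n.factorial) := by
        ext n
        rw [mul_pow]; ring
      rw [a4]; exact a3
    have hs2 := (hasSum_nat_add_iff' 1).2 hs
    simp only [Finset.sum_range_one, pow_zero, sub_self, mul_zero, sub_zero] at hs2
    rw [← ENNReal.ofReal_tsum_of_nonneg ?_ hs2.summable, hs2.tsum_eq]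
    · congr 1
      rw [mul_sub, ← Real.exp_add, ← Real.exp_add]
      simp only [neg_add_cancel, Real.exp_zero]
      congr 2
      rw [hR]
      have : (1 + p * c θ) ≠ 0 := by positivity
      field_simp
      ring
    · intro n
      have : R ^ (n + 1) ≤ 1 := pow_le_one₀ hR0.le hR1
      have : 0 ≤ 1 - R ^ (n + 1) := by linarith
      positivity

lemma sfinite_nu (ν : Measure ℝ)
    (hν : ∫⁻ z in Set.Ioi (0 : ℝ), ENNReal.ofReal (min z 1) ∂ν < ⊤) :
    SFinite (ν.restrict (Set.Ioi 0)) := by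
  set N := ν.restrict (Set.Ioi 0)
  have hm : Measurable (fun z : ℝ => ENNReal.ofReal (min z 1)) := by fun_prop
  have : IsFiniteMeasure (N.withDensity (fun z => ENNReal.ofReal (min z 1))) :=
    isFiniteMeasure_withDensity hν.ne
  have e : (N.withDensity (fun z => ENNReal.ofReal (min z 1))).withDensity
      (fun z : ℝ => ENNReal.ofReal (min z 1))⁻¹ = N := by
    refine withDensity_inv_same hm ?_ (ae_of_all _ fun z => ENNReal.ofReal_ne_top)
    filter_upwards [ae_restrict_mem measurableSet_Ioi] with z hz
    have : 0 < z := hz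
    simp [this]
  rw [← e]
  infer_instance

end JCIR

theorem jcir_positive_density (a b σ x t : ℝ) (ha : 0 < a) (hb : 0 < b) (hσ : 0 < σ)
    (hx : 0 ≤ x) (ht : 0 < t)
    (ν : Measure ℝ) (hνsupp : ν (Set.Iic 0) = 0)
    (hν : ∫⁻ z in Set.Ioi (0 : ℝ), ENNReal.ofReal (min z 1) ∂ν < ⊤)
    (μ : Measure ℝ) (hμ : IsProbabilityMeasure μ) (hμsupp : μ (Set.Iio 0) = 0)
    (hLap : ∀ u : ℝ, u ≤ 0 →
      ∫ y, Real.exp (u * y) ∂μ =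
        (1 - σ ^ 2 * u / (2 * b) * (1 - Real.exp (-b * t))) ^ (-(2 * a / σ ^ 2)) *
          Real.exp (x * psi b σ t u) *
          Real.exp (∫ s in Set.Ioc (0 : ℝ) t,
            ∫ z in Set.Ioi (0 : ℝ), (Real.exp (z * psi b σ s u) - 1) ∂ν)) :
    μ ≪ MeasureTheory.volume ∧
      ∃ f : ℝ → ℝ≥0∞, Measurable f ∧ μ = MeasureTheory.volume.withDensity f ∧
        ∀ y : ℝ, 0 < y → 0 < f y := by
  set c : ℝ → ℝ := fun s => σ ^ 2 / (2 * b) * (1 - Real.exp (-b * s)) with hc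
  have hcm : Measurable c := by simp only [hc]; fun_prop
  have hcpos : ∀ s, 0 < s → 0 < c s := by
    intro s hs
    have : Real.exp (-b * s) < 1 := by rw [Real.exp_lt_one_iff]; nlinarith
    have : 0 < 1 - Real.exp (-b * s) := by linarith
    simp only [hc]; positivity
  have hden : ∀ s p : ℝ, 1 - σ ^ 2 * (-p) / (2 * b) * (1 - Real.exp (-b * s)) = 1 + p * c s := by
    intro s p; simp only [hc]; ring
  have hpsi : ∀ s p : ℝ, psi b σ s (-p) = -(p * Real.exp (-b * s) / (1 + p * c s)) := by
    intro s p; unfold psi; rw [hden]; ring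
  -- relation of exponents
  have hrel : ∀ s p z : ℝ, 0 < s → 0 ≤ p →
      -(z * Real.exp (-b * s) / c s * (p * c s / (1 + p * c s))) = z * psi b σ s (-p) := by
    intro s p z hs hp
    rw [hpsi]
    have h1 := hcpos s hs
    have h2 : 0 < 1 + p * c s := by positivity
    field_simp
  have hSF := JCIR.sfinite_nu ν hν
  set N := ν.restrict (Set.Ioi 0) with hN
  set T := (volume : Measure ℝ).restrict (Set.Ioc 0 t) with hT
  have hTae : ∀ᵐ s ∂T, 0 < s := by
    filter_upwards [ae_restrict_mem measurableSet_Ioc] with s hs using hs.1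
  have hNae : ∀ᵐ z ∂N, 0 < z := by
    filter_upwards [ae_restrict_mem measurableSet_Ioi] with z hz using hz
  have hTN1 : ∀ᵐ q ∂(T.prod N), 0 < q.1 := Measure.quasiMeasurePreserving_fst.ae hTae
  have hTN2 : ∀ᵐ q ∂(T.prod N), 0 < q.2 := Measure.quasiMeasurePreserving_snd.ae hNae
  obtain ⟨M, hMs, hM0, hMΦ⟩ := JCIR.exists_mix (T.prod N) (fun q => c q.1)
    (fun q => q.2 * Real.exp (-b * q.1) / c q.1) (by fun_prop) (by fun_prop) (by
      filter_upwards [hTN1, hTN2] with q h1 h2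
      have := hcpos _ h1
      exact ⟨this.le, by positivity⟩)
  have hψm : ∀ u, Measurable (fun s => psi b σ s u) := by intro u; unfold psi; fun_prop
  let G : ℝ → ℝ → ℝ≥0∞ := fun p s => ∫⁻ z, ENNReal.ofReal (1 - Real.exp (z * psi b σ s (-p))) ∂N
  have hGm : ∀ p, Measurable (G p) := by
    intro p
    have := hψm (-p)
    exact Measurable.lintegral_prod_right'
      (f := fun q : ℝ × ℝ => ENNReal.ofReal (1 - Real.exp (q.2 * psi b σ q.1 (-p)))) (by fun_prop)
  have hMG : ∀ p, 0 ≤ p → ∫⁻ y, ENNReal.ofReal (1 - Real.exp (-(p * y))) ∂M =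
      ∫⁻ s, G p s ∂T := by
    intro p hp
    have := hψm (-p)
    rw [hMΦ p hp, ← lintegral_prod (fun q : ℝ × ℝ =>
      ENNReal.ofReal (1 - Real.exp (q.2 * psi b σ q.1 (-p)))) (by fun_prop)]
    refine lintegral_congr_ae ?_
    filter_upwards [hTN1] with q h1
    rw [hrel _ _ _ h1 hp]
  have hψle : ∀ s p, 0 < s → 0 ≤ p → psi b σ s (-p) ≤ 0 ∧ -p ≤ psi b σ s (-p) := by
    intro s p hs hp
    have h1 := hcpos s hs
    have h2 : 0 < 1 + p * c s := by positivity
    rw [hpsi]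
    refine ⟨by rw [neg_nonpos]; positivity, ?_⟩
    rw [neg_le_neg_iff, div_le_iff₀ h2]
    have h3 : Real.exp (-b * s) ≤ 1 := by rw [Real.exp_le_one_iff]; nlinarith
    have h4 : 0 ≤ p * (p * c s) := by positivity
    nlinarith
  have hGle : ∀ p s, 0 ≤ p → 0 < s →
      G p s ≤ ENNReal.ofReal (max 1 p) * ∫⁻ z, ENNReal.ofReal (min z 1) ∂N := by
    intro p s hp hs
    obtain ⟨h1, h2⟩ := hψle s p hs hp
    rw [← lintegral_const_mul _ (by fun_prop)]
    refine lintegral_mono_ae ?_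
    filter_upwards [hNae] with z hz
    rw [← ENNReal.ofReal_mul (by positivity)]
    refine ENNReal.ofReal_le_ofReal ?_
    have h3 := Real.add_one_le_exp (z * psi b σ s (-p))
    have h4 := Real.exp_pos (z * psi b σ s (-p))
    rcases le_total z 1 with h5 | h5
    · rw [min_eq_left h5]
      have : p ≤ max 1 p := le_max_right _ _
      nlinarith
    · rw [min_eq_right h5]
      have : 1 ≤ max 1 p := le_max_left _ _
      linarith
  have hGfin : ∀ p s, 0 ≤ p → 0 < s → G p s < ⊤ := fun p s hp hs =>
    (hGle p s hp hs).trans_lt (ENNReal.mul_lt_top ENNReal.ofReal_lt_top hν)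
  have hJfin : ∀ p, 0 ≤ p → ∫⁻ s, G p s ∂T ≠ ⊤ := by
    intro p hp
    refine ne_top_of_le_ne_top (b := ∫⁻ s, ENNReal.ofReal (max 1 p) *
      ∫⁻ z, ENNReal.ofReal (min z 1) ∂N ∂T) ?_ (lintegral_mono_ae ?_)
    · rw [lintegral_const]
      refine ENNReal.mul_ne_top (ENNReal.mul_lt_top ENNReal.ofReal_lt_top hν).ne ?_
      simp [hT]
    · filter_upwards [hTae] with s hs using hGle p s hp hs
  have hJ : ∀ p, 0 ≤ p → ∫ s, ∫ z, (Real.exp (z * psi b σ s (-p)) - 1) ∂N ∂T =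
      -(∫⁻ s, G p s ∂T).toReal := by
    intro p hp
    have e1 : ∀ᵐ s ∂T, ∫ z, (Real.exp (z * psi b σ s (-p)) - 1) ∂N = -(G p s).toReal := by
      filter_upwards [hTae] with s hs
      simp only [G]
      rw [← integral_eq_lintegral_of_nonneg_ae, ← integral_neg]
      · simp
      · filter_upwards [hNae] with z hz
        have := (hψle s p hs hp).1
        have : Real.exp (z * psi b σ s (-p)) ≤ 1 := by
          rw [Real.exp_le_one_iff]; exact mul_nonpos_of_nonneg_of_nonpos hz.le this
        simp only [Pi.zero_apply]; linarith
      · fun_prop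
    rw [integral_congr_ae e1, integral_neg, integral_toReal (hGm p).aemeasurable]
    filter_upwards [hTae] with s hs using hGfin p s hp hs
  -- the diffusion part
  have hct := hcpos t ht
  set lx : ℝ := x * Real.exp (-b * t) / c t with hlx
  have hlx0 : 0 ≤ lx := by positivity
  let Mx : Measure ℝ := ENNReal.ofReal lx • gammaMeasure 1 (1 / c t)
  have hg1 := isProbabilityMeasure_gammaMeasure one_pos (one_div_pos.2 hct)
  have hMx : ∀ p, 0 ≤ p → ∫⁻ y, ENNReal.ofReal (1 - Real.exp (-(p * y))) ∂Mx =
      ENNReal.ofReal (-(x * psi b σ t (-p))) := by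
    intro p hp
    simp only [Mx]
    rw [lintegral_smul_measure, JCIR.one_sub_gamma one_pos (one_div_pos.2 hct) hp, smul_eq_mul,
      ← ENNReal.ofReal_mul hlx0, ← hrel t p x ht hp, ← hlx, neg_neg, Real.rpow_one]
    congr 2
    have h2 : 0 < 1 + p * c t := by positivity
    field_simp
    ring
  have hMtot : ∀ p, ∫⁻ y, ENNReal.ofReal (1 - Real.exp (-(p * y))) ∂(M + Mx) =
      ∫⁻ y, ENNReal.ofReal (1 - Real.exp (-(p * y))) ∂M +
      ∫⁻ y, ENNReal.ofReal (1 - Real.exp (-(p * y))) ∂Mx := fun p => lintegral_add_measure _ _ _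
  have hMxs : SFinite Mx := by simp only [Mx]; infer_instance
  obtain ⟨Q, hQ1, hQ2, hQ3, hQ4⟩ := JCIR.exists_id (M + Mx) (by
      simp [hM0, Mx, JCIR.supp_gamma]) (by
      intro p hp
      rw [hMtot, hMG p hp, hMx p hp]
      exact ENNReal.add_ne_top.2 ⟨hJfin p hp, ENNReal.ofReal_ne_top⟩)
  have hα : 0 < 2 * a / σ ^ 2 := by positivity
  have hg2 := isProbabilityMeasure_gammaMeasure hα (one_div_pos.2 hct)
  have hQG : μ = Q.conv (gammaMeasure (2 * a / σ ^ 2) (1 / c t)) := by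
    refine JCIR.lap_unique _ _ hμsupp (JCIR.supp_conv _ _ hQ2 (JCIR.supp_gamma _ _)) ?_
    intro u hu
    obtain ⟨p, rfl⟩ : ∃ p, u = -p := ⟨-u, by ring⟩
    have hp : 0 ≤ p := by linarith
    rw [hLap _ hu.le]
    have e0 : ∫ s in Set.Ioc (0 : ℝ) t,
            ∫ z in Set.Ioi (0 : ℝ), (Real.exp (z * psi b σ s (-p)) - 1) ∂ν =
            -(∫⁻ s, G p s ∂T).toReal := hJ p hp
    rw [e0, hden, integral_eq_lintegral_of_nonneg_ae (ae_of_all _ fun y => (Real.exp_pos _).le)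
      (by fun_prop)]
    simp_rw [neg_mul]
    rw [JCIR.lap_conv, hQ3 p hp, JCIR.lap_gamma hα (one_div_pos.2 hct) hp,
      ← ENNReal.ofReal_mul (Real.exp_pos _).le, ENNReal.toReal_ofReal, hMtot, hMG p hp, hMx p hp,
      ENNReal.toReal_add (hJfin p hp) ENNReal.ofReal_ne_top, ENNReal.toReal_ofReal, neg_add,
      neg_neg, Real.exp_add]
    · have h2 : 0 < 1 + p * c t := by positivity
      have : 1 / c t / (1 / c t + p) = (1 + p * c t)⁻¹ := by field_simp
      rw [this, Real.inv_rpow h2.le, ← Real.rpow_neg h2.le]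
      ring
    · have := (hψle t p ht hp).1
      nlinarith [mul_nonneg hx (neg_nonneg.2 this)]
    · positivity
  have hgm : Measurable (gammaPDF (2 * a / σ ^ 2) (1 / c t)) :=
    (measurable_gammaPDFReal _ _).ennreal_ofReal
  have hfinal : μ = volume.withDensity
      (fun y => ∫⁻ w, gammaPDF (2 * a / σ ^ 2) (1 / c t) (y - w) ∂Q) := by
    rw [hQG, gammaMeasure, JCIR.conv_density _ hgm]
  have hfm : Measurable
      (fun y => ∫⁻ w, gammaPDF (2 * a / σ ^ 2) (1 / c t) (y - w) ∂Q) :=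
    Measurable.lintegral_prod_right'
      (f := fun q : ℝ × ℝ => gammaPDF (2 * a / σ ^ 2) (1 / c t) (q.1 - q.2)) (by fun_prop)
  refine ⟨?_, _, hfm, hfinal, ?_⟩
  · rw [hfinal]; exact withDensity_absolutelyContinuous _ _
  · intro y hy
    rw [lintegral_pos_iff_support (by fun_prop)]
    refine (hQ4 y hy).trans_le (measure_mono ?_)
    intro w hw
    have hw' : 0 < y - w := sub_pos.2 hw
    have := gammaPDFReal_pos hα (one_div_pos.2 hct) hw'
    simp only [Function.mem_support, gammaPDF]
    exact (ENNReal.ofReal_pos.2 this).ne'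
end
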